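/- Let X ⊂ ℝ^{n+1} be a convex surface and let (e₁,V₁) and (e₂,V₂) give standard charts on X with associated convex functions f₁ and f₂. Then the squared intrinsic distance in these charts, (x₁,x₂) ↦ dist_X(x₁ + f₁(x₁)e₁, x₂ + f₂(x₂)e₂)², is DC on V₁ × V₂, i.e. it is the difference of two continuous convex functions on the convex set V₁ × V₂ ⊆ e₁^⊥ × e₂^⊥. -/

import Mathlib

open scoped NNReal

open Set

/-- `f` is DC on the convex set `C`: a difference of two continuous convex functions on `C`. -/
def IsDCOn {E : Type*} [NormedAddCommGroup E] [NormedSpace ℝ E]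
    (C : Set E) (f : E → ℝ) : Prop :=
  ∃ g h : E → ℝ, ConvexOn ℝ C g ∧ ConvexOn ℝ C h ∧
    ContinuousOn g C ∧ ContinuousOn h C ∧ ∀ x ∈ C, f x = g x - h x

/-- A mapping `F : C → F'` is DC if `ℓ ∘ F` is DC for every linear functional `ℓ`. -/
def IsDCMapOn {E F' : Type*} [NormedAddCommGroup E] [NormedSpace ℝ E]
    [NormedAddCommGroup F'] [NormedSpace ℝ F'] (C : Set E) (F : E → F') : Prop :=
  ∀ ℓ : F' →ₗ[ℝ] ℝ, IsDCOn C (fun x => ℓ (F x))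

/-- `F` is locally DC on the open set `U`: every point of `U` has an open convex
neighborhood contained in `U` on which `F` is DC. -/
def LocallyDCMapOn {E F' : Type*} [NormedAddCommGroup E] [NormedSpace ℝ E]
    [NormedAddCommGroup F'] [NormedSpace ℝ F'] (U : Set E) (F : E → F') : Prop :=
  ∀ x ∈ U, ∃ V : Set E, IsOpen V ∧ Convex ℝ V ∧ x ∈ V ∧ V ⊆ U ∧ IsDCMapOn V F

/-- A convex body: a compact convex set with nonempty interior. -/
def IsConvexBody {E : Type*} [NormedAddCommGroup E] [NormedSpace ℝ E] (C : Set E) : Prop :=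
  IsCompact C ∧ Convex ℝ C ∧ (interior C).Nonempty

/-- A convex surface: the boundary of a convex body. -/
def IsConvexSurface {E : Type*} [NormedAddCommGroup E] [NormedSpace ℝ E] (X : Set E) : Prop :=
  ∃ C : Set E, IsConvexBody C ∧ X = frontier C

/-- The intrinsic distance on `X ⊆ E`: the infimum of lengths (total variations) of
continuous curves `γ : [0,1] → E` joining `a` and `b` within `X`. -/
noncomputable def intrinsicDist {E : Type*} [NormedAddCommGroup E] [NormedSpace ℝ E]
    (X : Set E) (a b : E) : ℝ :=
  (⨅ γ : {γ : ℝ → E // ContinuousOn γ (Set.Icc 0 1) ∧ γ 0 = a ∧ γ 1 = b ∧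
      Set.MapsTo γ (Set.Icc 0 1) X},
    eVariationOn γ.1 (Set.Icc 0 1)).toReal

/-- An `(e,V)`-standard chart on `X`, given by a unit vector `e`, a convex open subset `V`
of the hyperplane `e^⊥`, and a Lipschitz convex function `f : V → ℝ` whose graph
`{x + f(x)e : x ∈ V}` is a relatively open subset of `X`. -/
def IsStandardChart {E : Type*} [NormedAddCommGroup E] [InnerProductSpace ℝ E]
    (X : Set E) (e : E) (V : Set ↥((Submodule.span ℝ {e})ᗮ))
    (f : ↥((Submodule.span ℝ {e})ᗮ) → ℝ) : Prop :=
  ‖e‖ = 1 ∧ IsOpen V ∧ Convex ℝ V ∧ ConvexOn ℝ V f ∧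
    (∃ K : ℝ≥0, LipschitzOnWith K f V) ∧
    ∃ O : Set E, IsOpen O ∧
      (fun x : ↥((Submodule.span ℝ {e})ᗮ) => (x : E) + f x • e) '' V = X ∩ O

open Filter Topology

open scoped InnerProductSpace

theorem le_add_slope_of_eventually_le {φ s : ℝ → ℝ} (hφ : ContinuousOn φ (Icc 0 1)) {ε : ℝ}
    (hε : 0 < ε)
    (h : ∀ t ∈ Icc (0 : ℝ) 1, ∀ᶠ t' in 𝓝[Icc 0 1] t,
      φ t' ≤ φ t + s t * (t' - t) - ε * (t' - t) ^ 2) :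
    φ 1 ≤ φ 0 + s 0 := by
  by_contra! hlt
  obtain ⟨t, ht, hmin⟩ := isCompact_Icc.exists_isMinOn (nonempty_Icc.2 zero_le_one)
    (hφ.sub (by fun_prop : ContinuousOn (fun t : ℝ => (φ 1 - φ 0) * t) (Icc 0 1)))
  have key : ∃ t ∈ Icc (0 : ℝ) 1, φ t - (φ 1 - φ 0) * t < φ 0 := by
    have h0 := h 0 (by simp)
    rw [eventually_nhdsWithin_iff, Metric.eventually_nhds_iff] at h0
    obtain ⟨r, hr, h0⟩ := h0
    have hm : 0 < min (r / 2) 1 := by positivity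
    refine ⟨min (r / 2) 1, ⟨hm.le, min_le_right _ _⟩, ?_⟩
    have := @h0 (min (r / 2) 1) (by
      rw [dist_zero_right, Real.norm_of_nonneg hm.le]
      exact lt_of_le_of_lt (min_le_left _ _) (by linarith)) ⟨hm.le, min_le_right _ _⟩
    nlinarith [sq_nonneg (min (r / 2) 1)]
  obtain ⟨t₁, ht₁, hlt₁⟩ := key
  have hneg : φ t - (φ 1 - φ 0) * t < φ 0 := (hmin ht₁).trans_lt hlt₁
  have ht0 : 0 < t := by
    rcases ht.1.eq_or_lt with h' | h'
    · rw [← h'] at hneg; simp at hneg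
    · exact h'
  have ht1 : t < 1 := by
    rcases ht.2.eq_or_lt with h' | h'
    · rw [h'] at hneg; linarith
    · exact h'
  have hloc := h t ht
  rw [eventually_nhdsWithin_iff, Metric.eventually_nhds_iff] at hloc
  obtain ⟨r, hr, hloc⟩ := hloc
  obtain ⟨k, hk0, hkr, hk1, hk2⟩ : ∃ k : ℝ, 0 < k ∧ k < r ∧ k < t ∧ k < 1 - t := by
    refine ⟨min r (min t (1 - t)) / 2, by have := sub_pos.2 ht1; positivity, ?_, ?_, ?_⟩ <;>
    · have h1 := min_le_left r (min t (1 - t))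
      have h2 := min_le_right r (min t (1 - t))
      have h3 := min_le_left t (1 - t)
      have h4 := min_le_right t (1 - t)
      linarith
  have hp : t + k ∈ Icc (0 : ℝ) 1 := ⟨by linarith, by linarith⟩
  have hm : t - k ∈ Icc (0 : ℝ) 1 := ⟨by linarith, by linarith⟩
  have a1 := @hloc (t + k) (by simpa [abs_of_pos hk0] using hkr) hp
  have a2 := @hloc (t - k) (by simpa [Real.dist_eq, abs_of_pos hk0] using hkr) hm
  have b1 := hmin hp
  have b2 := hmin hm
  simp only [mem_ofPred_eq, Pi.sub_apply] at b1 b2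
  nlinarith [mul_pos hε (pow_pos hk0 2)]

section Radial

variable {E : Type*} [NormedAddCommGroup E] [InnerProductSpace ℝ E]

theorem inner_radial_step_le {u x y : E} {τ a a' ν M R ρ d : ℝ} (hρ : 0 < ρ) (hu : ‖u‖ ≤ M)
    (hx : ‖x‖ ≤ R) (hy : ‖y‖ ≤ d) (ha : 1 / 2 ≤ a) (ha' : 1 / 2 ≤ a')
    (hγ : |a' - a| ≤ d * |τ| / ρ) (hν : τ * ν ≤ a' - a) :
    ⟪u, a'⁻¹ • (x + τ • y) - a⁻¹ • x⟫_ℝ ≤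
      (⟪u, y⟫_ℝ / a - (4 * M * R + ⟪u, x⟫_ℝ / a ^ 2) * ν) * τ + 4 * M * R * (a' - a) +
        (4 * M / ρ + 8 * M * R / ρ ^ 2) * d ^ 2 * τ ^ 2 := by
  have hM : 0 ≤ M := (norm_nonneg _).trans hu
  have hR : 0 ≤ R := (norm_nonneg _).trans hx
  have hd : 0 ≤ d := (norm_nonneg _).trans hy
  have ha0 : 0 < a := by linarith
  have ha0' : 0 < a' := by linarith
  have huy : |⟪u, y⟫_ℝ| ≤ M * d := (abs_real_inner_le_norm _ _).trans (by gcongr)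
  have hux : |⟪u, x⟫_ℝ| ≤ M * R := (abs_real_inner_le_norm _ _).trans (by gcongr)
  set p := ⟪u, y⟫_ℝ
  set w := ⟪u, x⟫_ℝ
  set γ := a' - a with hγd
  have hia : a⁻¹ ≤ 2 := by
    rw [inv_le_comm₀ ha0 (by norm_num)]; linarith
  have hia' : a'⁻¹ ≤ 2 := by
    rw [inv_le_comm₀ ha0' (by norm_num)]; linarith
  have hia0 : 0 < a⁻¹ := by positivity
  have hia0' : 0 < a'⁻¹ := by positivity
  have e1 : ⟪u, a'⁻¹ • (x + τ • y) - a⁻¹ • x⟫_ℝ =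
      p / a * τ - γ * w / a ^ 2 - τ * γ * p * (a⁻¹ * a'⁻¹) + γ ^ 2 * w * (a⁻¹ ^ 2 * a'⁻¹) := by
    rw [inner_sub_right, real_inner_smul_right, real_inner_smul_right, inner_add_right,
      real_inner_smul_right]
    rw [hγd]
    field_simp
    ring
  have hw2 : |w / a ^ 2| ≤ 4 * M * R := by
    rw [abs_div, abs_of_pos (pow_pos ha0 2), div_le_iff₀ (by positivity)]
    have : (1 / 2 : ℝ) ^ 2 ≤ a ^ 2 := by gcongr
    nlinarith [mul_nonneg hM hR]
  have e2 : -(γ * w / a ^ 2) ≤ 4 * M * R * γ - (4 * M * R + w / a ^ 2) * ν * τ := by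
    have : 0 ≤ (4 * M * R + w / a ^ 2) := by linarith [neg_abs_le (w / a ^ 2)]
    have h3 := mul_le_mul_of_nonneg_left hν this
    have : γ * w / a ^ 2 = (w / a ^ 2) * γ := by ring
    rw [this]; linarith
  have e3 : -(τ * γ * p * (a⁻¹ * a'⁻¹)) ≤ 4 * M / ρ * d ^ 2 * τ ^ 2 := by
    refine (neg_le_abs _).trans ?_
    rw [abs_mul, abs_mul, abs_mul, abs_of_pos (mul_pos hia0 hia0')]
    calc |τ| * |γ| * |p| * (a⁻¹ * a'⁻¹) ≤ |τ| * (d * |τ| / ρ) * (M * d) * (2 * 2) := by gcongr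
      _ = 4 * M / ρ * d ^ 2 * |τ| ^ 2 := by ring
      _ = _ := by rw [sq_abs]
  have e4 : γ ^ 2 * w * (a⁻¹ ^ 2 * a'⁻¹) ≤ 8 * M * R / ρ ^ 2 * d ^ 2 * τ ^ 2 := by
    refine (le_abs_self _).trans ?_
    rw [abs_mul, abs_mul, abs_of_pos (mul_pos (pow_pos hia0 2) hia0'), abs_pow]
    calc |γ| ^ 2 * |w| * (a⁻¹ ^ 2 * a'⁻¹) ≤ (d * |τ| / ρ) ^ 2 * (M * R) * (2 ^ 2 * 2) := by gcongr
      _ = 8 * M * R / ρ ^ 2 * d ^ 2 * |τ| ^ 2 := by ring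
      _ = _ := by rw [sq_abs]
  rw [e1]
  linarith

theorem norm_radial_step_le {x y : E} {τ a a' R ρ d : ℝ} (hρ : 0 < ρ)
    (hx : ‖x‖ ≤ R) (hy : ‖y‖ ≤ d) (ha : 1 / 2 ≤ a) (ha' : 1 / 2 ≤ a')
    (hγ : |a' - a| ≤ d * |τ| / ρ) :
    ‖a'⁻¹ • (x + τ • y) - a⁻¹ • x‖ ≤ (2 + 4 * R / ρ) * d * |τ| := by
  have hR : 0 ≤ R := (norm_nonneg _).trans hx
  have hd : 0 ≤ d := (norm_nonneg _).trans hy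
  have ha0 : 0 < a := by linarith
  have ha0' : 0 < a' := by linarith
  have hia : a⁻¹ ≤ 2 := by
    rw [inv_le_comm₀ ha0 (by norm_num)]; linarith
  have hia' : a'⁻¹ ≤ 2 := by
    rw [inv_le_comm₀ ha0' (by norm_num)]; linarith
  have hia0 : 0 < a⁻¹ := by positivity
  have hia0' : 0 < a'⁻¹ := by positivity
  have e1 : a'⁻¹ • (x + τ • y) - a⁻¹ • x =
      (a'⁻¹ * τ) • y - ((a' - a) * (a⁻¹ * a'⁻¹)) • x := by
    have : a⁻¹ = a'⁻¹ + (a' - a) * (a⁻¹ * a'⁻¹) := by field_simp; ring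
    rw [smul_add, smul_smul]
    nth_rewrite 1 [this]
    module
  rw [e1]
  refine (norm_sub_le _ _).trans ?_
  rw [norm_smul, norm_smul, Real.norm_eq_abs, Real.norm_eq_abs, abs_mul, abs_mul,
    abs_of_pos hia0', abs_of_pos (mul_pos hia0 hia0')]
  calc a'⁻¹ * |τ| * ‖y‖ + |a' - a| * (a⁻¹ * a'⁻¹) * ‖x‖
      ≤ 2 * |τ| * d + (d * |τ| / ρ) * (2 * 2) * R := by gcongr
    _ = _ := by ring

/-- A family of sublinear functions pinched between multiples of the norm, with a supporting
functional at each point of the unit level. -/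
structure IsGaugeWithSupport (g : E → ℝ) (ρ R : ℝ) : Prop where
  add_le : ∀ x y, g (x + y) ≤ g x + g y
  smul : ∀ (t : ℝ) x, 0 ≤ t → g (t • x) = t * g x
  le_norm : ∀ x, g x ≤ ‖x‖ / ρ
  norm_le : ∀ x, g x = 1 → ‖x‖ ≤ R
  support : ∀ b, g b = 1 → ∃ n : E, ‖n‖ ≤ 1 / ρ ∧ ⟪n, b⟫_ℝ = 1 ∧ ∀ x, ⟪n, x⟫_ℝ ≤ g x

theorem IsGaugeWithSupport.abs_sub_le {g : E → ℝ} {ρ R : ℝ} (hg : IsGaugeWithSupport g ρ R)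
    (x y : E) : |g x - g y| ≤ ‖x - y‖ / ρ := by
  rw [abs_le]
  have h1 := hg.add_le (x - y) y
  have h2 := hg.add_le (y - x) x
  have h3 := hg.le_norm (x - y)
  have h4 := hg.le_norm (y - x)
  rw [norm_sub_rev] at h4
  simp only [sub_add_cancel] at h1 h2
  constructor <;> linarith

theorem semiconcave_of_locally_near {g : E → ℝ} {ρ R : ℝ} (hρ : 0 < ρ)
    (hg : IsGaugeWithSupport g ρ R) {φ : E → ℝ} (hφ : ContinuousOn φ {x | g x = 1})
    {M C : ℝ} (hC : 0 ≤ C)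
    (hloc : ∀ x, g x = 1 → ∃ u : E, ‖u‖ ≤ M ∧ ∀ᶠ q in 𝓝[{x | g x = 1}] x,
      φ q ≤ φ x + ⟪u, q - x⟫_ℝ + C * ‖q - x‖ ^ 2)
    {b : E} (hb : g b = 1) :
    ∃ u : E, ‖u‖ ≤ M + 5 * M * R / ρ ∧ ∀ q, g q = 1 → ‖q - b‖ ≤ ρ / 2 →
      φ q ≤ φ b + ⟪u, q - b⟫_ℝ +
        (C * (2 + 4 * R / ρ) ^ 2 + (4 * M / ρ + 8 * M * R / ρ ^ 2) + 1) * ‖q - b‖ ^ 2 := by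
  choose! u hu hloc using hloc
  choose! n hn hnb hnle using hg.support
  have hM : 0 ≤ M := (norm_nonneg _).trans (hu b hb)
  have hR : 0 ≤ R := (norm_nonneg _).trans (hg.norm_le b hb)
  have hub : |⟪u b, b⟫_ℝ| ≤ M * R :=
    (abs_real_inner_le_norm _ _).trans (by
      have := hu b hb; have := hg.norm_le b hb; gcongr)
  refine ⟨u b - (4 * M * R + ⟪u b, b⟫_ℝ) • n b, ?_, ?_⟩
  · refine (norm_sub_le _ _).trans ?_
    rw [norm_smul, Real.norm_eq_abs]
    have h1 : |4 * M * R + ⟪u b, b⟫_ℝ| ≤ 5 * M * R := by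
      have : 0 ≤ M * R := by positivity
      rw [abs_le] at hub ⊢; constructor <;> linarith [hub.1, hub.2]
    have h2 := hu b hb
    have h3 := hn b hb
    calc ‖u b‖ + |4 * M * R + ⟪u b, b⟫_ℝ| * ‖n b‖ ≤ M + 5 * M * R * (1 / ρ) := by gcongr
      _ = _ := by ring
  intro q hq hqb
  rcases eq_or_ne q b with rfl | hne
  · simp
  set y := q - b with hy
  have hd : 0 < ‖y‖ := norm_pos_iff.2 (sub_ne_zero.2 hne)
  set d := ‖y‖ with hdd
  set xx : ℝ → E := fun t => b + t • y with hxx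
  have hgc : Continuous g := by
    have : LipschitzWith (Real.toNNReal (1 / ρ)) g := LipschitzWith.of_dist_le_mul fun x y => by
      rw [Real.dist_eq, dist_eq_norm, Real.coe_toNNReal _ (by positivity)]
      refine (hg.abs_sub_le x y).trans (le_of_eq (by ring))
    exact this.continuous
  have hxc : Continuous xx := by rw [hxx]; fun_prop
  have hxcomb : ∀ t, xx t = (1 - t) • b + t • q := fun t => by
    simp only [hxx, hy]; module
  have hge : ∀ t ∈ Icc (0 : ℝ) 1, 1 / 2 ≤ g (xx t) := fun t ht => by
    have h1 := hg.abs_sub_le (xx t) b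
    have h2 : ‖xx t - b‖ ≤ ρ / 2 := by
      simp only [hxx, add_sub_cancel_left, norm_smul, Real.norm_eq_abs, abs_of_nonneg ht.1]
      nlinarith [ht.1, ht.2]
    have h3 : ‖xx t - b‖ / ρ ≤ 1 / 2 := by
      rw [div_le_iff₀ hρ]; linarith
    rw [hb] at h1
    linarith [(abs_le.1 (h1.trans h3)).1]
  have hxR : ∀ t ∈ Icc (0 : ℝ) 1, ‖xx t‖ ≤ R := fun t ht => by
    rw [hxcomb]
    refine (norm_add_le _ _).trans ?_
    rw [norm_smul, norm_smul, Real.norm_eq_abs, Real.norm_eq_abs, abs_of_nonneg ht.1,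
      abs_of_nonneg (sub_nonneg.2 ht.2)]
    nlinarith [ht.1, ht.2, hg.norm_le b hb, hg.norm_le q hq]
  set Q : ℝ → E := fun t => (g (xx t))⁻¹ • xx t with hQ
  have hQmem : ∀ t ∈ Icc (0 : ℝ) 1, g (Q t) = 1 := fun t ht => by
    have := hge t ht
    have h0 : 0 < g (xx t) := by linarith
    simp only [hQ]
    rw [hg.smul _ _ (by positivity), inv_mul_cancel₀ h0.ne']
  have hQc : ContinuousOn Q (Icc 0 1) := by
    refine ContinuousOn.smul (ContinuousOn.inv₀ (hgc.comp hxc).continuousOn fun t ht => ?_)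
      hxc.continuousOn
    have := hge t ht
    exact ne_of_gt (by linarith : 0 < g (xx t))
  set A0 := 4 * M * R with hA0
  set L := 2 + 4 * R / ρ with hL
  set C1 := 4 * M / ρ + 8 * M * R / ρ ^ 2 with hC1
  set K := C * L ^ 2 + C1 + 1 with hK
  have x0 : xx 0 = b := by simp [hxx]
  have x1 : xx 1 = q := by simp [hxx, hy]
  have Q0 : Q 0 = b := by simp [hQ, x0, hb]
  have Q1 : Q 1 = q := by simp [hQ, x1, hq]
  set s : ℝ → ℝ := fun t => (⟪u (Q t), y⟫_ℝ / g (xx t) -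
    (A0 + ⟪u (Q t), xx t⟫_ℝ / g (xx t) ^ 2) * ⟪n (Q t), y⟫_ℝ) - K * d ^ 2 * (2 * t) with hs
  have main := @le_add_slope_of_eventually_le
    (fun t => φ (Q t) - A0 * g (xx t) - K * d ^ 2 * t ^ 2) s ?_ (d ^ 2) (by positivity) ?_
  · simp only [Q0, Q1, x0, x1, hb, hq, hs] at main
    rw [inner_sub_left, real_inner_smul_left]
    norm_num at main
    linarith
  · refine ContinuousOn.sub (ContinuousOn.sub ?_ ?_) (by fun_prop)
    · exact hφ.comp hQc hQmem
    · exact (continuous_const.mul (hgc.comp hxc)).continuousOn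
  · intro t ht
    have htend : Tendsto Q (𝓝[Icc 0 1] t) (𝓝[{x | g x = 1}] (Q t)) :=
      tendsto_nhdsWithin_iff.2 ⟨hQc t ht, eventually_nhdsWithin_of_forall hQmem⟩
    filter_upwards [htend.eventually (hloc _ (hQmem t ht)), self_mem_nhdsWithin] with t' h1 ht'
    have hγ : |g (xx t') - g (xx t)| ≤ d * |t' - t| / ρ := by
      refine (hg.abs_sub_le _ _).trans (le_of_eq ?_)
      have : xx t' - xx t = (t' - t) • y := by simp only [hxx]; module
      rw [this, norm_smul, Real.norm_eq_abs]; ring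
    have hx' : xx t' = xx t + (t' - t) • y := by simp only [hxx]; module
    have hν : (t' - t) * ⟪n (Q t), y⟫_ℝ ≤ g (xx t') - g (xx t) := by
      have h2 := hnle _ (hQmem t ht) (xx t')
      have h3 := hnb _ (hQmem t ht)
      have h0 : 0 < g (xx t) := by linarith [hge t ht]
      have h4 : ⟪n (Q t), xx t⟫_ℝ = g (xx t) := by
        have : xx t = g (xx t) • Q t := by
          simp only [hQ]; rw [smul_smul, mul_inv_cancel₀ h0.ne', one_smul]
        rw [this, real_inner_smul_right, h3, mul_one, ← this]
      rw [hx', inner_add_right, real_inner_smul_right, h4, ← hx'] at h2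
      linarith
    have hst : ⟪u (Q t), Q t' - Q t⟫_ℝ ≤
        (⟪u (Q t), y⟫_ℝ / g (xx t) - (A0 + ⟪u (Q t), xx t⟫_ℝ / g (xx t) ^ 2) * ⟪n (Q t), y⟫_ℝ) *
          (t' - t) + A0 * (g (xx t') - g (xx t)) + C1 * d ^ 2 * (t' - t) ^ 2 := by
      have := inner_radial_step_le hρ (hu _ (hQmem t ht)) (hxR t ht) hdd.ge (hge t ht)
        (hge t' ht') hγ hν
      rwa [← hx'] at this
    have hst2 : ‖Q t' - Q t‖ ≤ L * d * |t' - t| := by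
      have := norm_radial_step_le hρ (hxR t ht) hdd.ge (hge t ht) (hge t' ht') hγ
      rwa [← hx'] at this
    have hst3 : C * ‖Q t' - Q t‖ ^ 2 ≤ C * (L * d * |t' - t|) ^ 2 := by gcongr
    rw [mul_pow, sq_abs] at hst3
    simp only [hs, hK]
    generalize ⟪u (Q t), y⟫_ℝ / g (xx t) -
      (A0 + ⟪u (Q t), xx t⟫_ℝ / g (xx t) ^ 2) * ⟪n (Q t), y⟫_ℝ = ss at hst ⊢
    linear_combination h1 + hst + hst3

theorem semiconcave_of_locally (ρ R M C B : ℝ) (hρ : 0 < ρ) (hR : 0 ≤ R) (hM : 0 ≤ M)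
    (hC : 0 ≤ C) (hB : 0 ≤ B) :
    ∃ M' C' : ℝ, 0 ≤ M' ∧ 0 ≤ C' ∧ ∀ (g φ : E → ℝ), IsGaugeWithSupport g ρ R →
      ContinuousOn φ {x | g x = 1} → (∀ x, g x = 1 → 0 ≤ φ x ∧ φ x ≤ B) →
      (∀ x, g x = 1 → ∃ u : E, ‖u‖ ≤ M ∧ ∀ᶠ q in 𝓝[{x | g x = 1}] x,
        φ q ≤ φ x + ⟪u, q - x⟫_ℝ + C * ‖q - x‖ ^ 2) →
      ∀ b, g b = 1 → ∃ u : E, ‖u‖ ≤ M' ∧ ∀ q, g q = 1 →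
        φ q ≤ φ b + ⟪u, q - b⟫_ℝ + C' * ‖q - b‖ ^ 2 := by
  set M' := M + 5 * M * R / ρ with hM'
  set K := (C * (2 + 4 * R / ρ) ^ 2 + (4 * M / ρ + 8 * M * R / ρ ^ 2) + 1) with hK
  have hM'0 : 0 ≤ M' := by positivity
  have hK0 : 0 ≤ K := by positivity
  refine ⟨M', K + (4 * B / ρ ^ 2 + 2 * M' / ρ), hM'0, by positivity, ?_⟩
  intro g φ hg hφ hφB hloc b hb
  obtain ⟨u, hu, h⟩ := semiconcave_of_locally_near hρ hg hφ hC hloc hb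
  refine ⟨u, hu, fun q hq => ?_⟩
  have hsq : 0 ≤ ‖q - b‖ ^ 2 := by positivity
  rcases le_or_gt ‖q - b‖ (ρ / 2) with hle | hgt
  · have h1 := h q hq hle
    have : 0 ≤ (4 * B / ρ ^ 2 + 2 * M' / ρ) * ‖q - b‖ ^ 2 := by positivity
    linarith
  · have h1 : -(M' * ‖q - b‖) ≤ ⟪u, q - b⟫_ℝ := by
      have := (abs_le.1 (abs_real_inner_le_norm u (q - b))).1
      have : ‖u‖ * ‖q - b‖ ≤ M' * ‖q - b‖ := by gcongr
      linarith
    have h2 : B ≤ 4 * B / ρ ^ 2 * ‖q - b‖ ^ 2 := by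
      have : (ρ / 2) ^ 2 ≤ ‖q - b‖ ^ 2 := by gcongr
      have h3 : 4 * B / ρ ^ 2 * (ρ / 2) ^ 2 = B := by field_simp; ring
      have h4 : 4 * B / ρ ^ 2 * (ρ / 2) ^ 2 ≤ 4 * B / ρ ^ 2 * ‖q - b‖ ^ 2 := by gcongr
      linarith
    have h3 : M' * ‖q - b‖ ≤ 2 * M' / ρ * ‖q - b‖ ^ 2 := by
      have h3 : 2 * M' / ρ * ‖q - b‖ ^ 2 = M' * ‖q - b‖ * (‖q - b‖ / (ρ / 2)) := by field_simp
      have h4 : 1 ≤ ‖q - b‖ / (ρ / 2) := by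
        rw [le_div_iff₀ (by positivity)]; linarith
      rw [h3]
      exact le_mul_of_one_le_right (by positivity) h4
    have h4 : 0 ≤ K * ‖q - b‖ ^ 2 := by positivity
    have := hφB q hq
    have := hφB b hb
    linarith

end Radial

section Polygon

variable {E : Type*} [NormedAddCommGroup E]

/-- The discrete energy of the polygon with vertices `p 0, …, p N`. -/
def polyEnergy (N : ℕ) (p : ℕ → E) : ℝ := N * ∑ i ∈ Finset.range N, ‖p (i + 1) - p i‖ ^ 2

/-- Polygons with `N` edges from `a` to `b` and vertices in `X`. -/
def polygons (X : Set E) (N : ℕ) (a b : E) : Set (ℕ → E) :=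
  {p | p 0 = a ∧ p N = b ∧ ∀ i, p i ∈ X}

/-- The least energy of a polygon with `N` edges from `a` to `b` and vertices in `X`. -/
noncomputable def minEnergy (X : Set E) (N : ℕ) (a b : E) : ℝ :=
  sInf (polyEnergy N '' polygons X N a b)

theorem polyEnergy_nonneg (N : ℕ) (p : ℕ → E) : 0 ≤ polyEnergy N p := by
  unfold polyEnergy; positivity

theorem minEnergy_nonneg (X : Set E) (N : ℕ) (a b : E) : 0 ≤ minEnergy X N a b :=
  Real.sInf_nonneg (by rintro _ ⟨p, -, rfl⟩; exact polyEnergy_nonneg N p)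

theorem minEnergy_le {X : Set E} {N : ℕ} {a b : E} {p : ℕ → E} (hp : p ∈ polygons X N a b) :
    minEnergy X N a b ≤ polyEnergy N p :=
  csInf_le ⟨0, by rintro _ ⟨p, -, rfl⟩; exact polyEnergy_nonneg N p⟩ (mem_image_of_mem _ hp)

theorem exists_polyEnergy_eq_minEnergy {X : Set E} (hX : IsCompact X) {N : ℕ} (hN : 0 < N)
    {a b : E} (ha : a ∈ X) (hb : b ∈ X) :
    ∃ p ∈ polygons X N a b, polyEnergy N p = minEnergy X N a b := by
  have hK : IsCompact (polygons X N a b) := by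
    have h1 : IsCompact (Set.pi univ fun _ : ℕ => X) := isCompact_univ_pi fun _ => hX
    have h2 : polygons X N a b = (Set.pi univ fun _ : ℕ => X) ∩ {p | p 0 = a ∧ p N = b} := by
      ext p; simp only [polygons, mem_ofPred_eq, mem_inter_iff, mem_univ_pi]; tauto
    rw [h2]
    refine h1.inter_right ?_
    exact (isClosed_eq (continuous_apply 0) continuous_const).inter
      (isClosed_eq (continuous_apply N) continuous_const)
  have hne : (polygons X N a b).Nonempty := by
    refine ⟨fun i => if i = 0 then a else b, by simp, by simp [hN.ne'], fun i => ?_⟩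
    dsimp only
    split_ifs <;> assumption
  have hcont : ContinuousOn (polyEnergy (E := E) N) (polygons X N a b) := by
    unfold polyEnergy; fun_prop
  obtain ⟨p, hp, h⟩ := hK.exists_sInf_image_eq hne hcont
  exact ⟨p, hp, h.symm⟩

theorem minEnergy_symm (X : Set E) (N : ℕ) (a b : E) :
    minEnergy X N a b = minEnergy X N b a := by
  have key : ∀ a b : E, polyEnergy N '' polygons X N a b ⊆ polyEnergy N '' polygons X N b a := by
    rintro a b _ ⟨p, ⟨h0, hN, hX⟩, rfl⟩
    refine ⟨fun i => p (N - i), ⟨by simpa using hN, by simpa using h0, fun i => hX _⟩, ?_⟩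
    unfold polyEnergy
    congr 1
    rw [← Finset.sum_range_reflect]
    refine Finset.sum_congr rfl fun i hi => ?_
    have hi := Finset.mem_range.1 hi
    dsimp only
    rw [norm_sub_rev, show N - (N - 1 - i) = i + 1 by omega,
      show N - (N - 1 - i + 1) = i by omega]
  exact congrArg sInf (Subset.antisymm (key a b) (key b a))

theorem polyEnergy_add_self (N : ℕ) (p : ℕ → E) :
    polyEnergy (N + N) p = 2 * polyEnergy N p + 2 * polyEnergy N fun i => p (N + i) := by
  unfold polyEnergy
  rw [Finset.sum_range_add]
  push_cast
  simp only [add_assoc]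
  ring

theorem minEnergy_add_self_le {X : Set E} (hX : IsCompact X) {N : ℕ} (hN : 0 < N)
    {a m b : E} (ha : a ∈ X) (hm : m ∈ X) (hb : b ∈ X) :
    minEnergy X (N + N) a b ≤ 2 * minEnergy X N a m + 2 * minEnergy X N m b := by
  obtain ⟨p, ⟨hp0, hpN, hpX⟩, hp⟩ := exists_polyEnergy_eq_minEnergy hX hN ha hm
  obtain ⟨q, ⟨hq0, hqN, hqX⟩, hq⟩ := exists_polyEnergy_eq_minEnergy hX hN hm hb
  have hr : (fun i => if i ≤ N then p i else q (i - N)) ∈ polygons X (N + N) a b := by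
    refine ⟨by simpa using hp0, by simp [hN.ne', hqN], fun i => ?_⟩
    dsimp only
    split_ifs
    exacts [hpX _, hqX _]
  refine (minEnergy_le hr).trans (le_of_eq ?_)
  rw [polyEnergy_add_self, ← hp, ← hq]
  congr 2
  · unfold polyEnergy
    congr 1
    refine Finset.sum_congr rfl fun i hi => ?_
    have hi := Finset.mem_range.1 hi
    dsimp only
    rw [if_pos (by omega), if_pos (by omega)]
  · unfold polyEnergy
    congr 1
    refine Finset.sum_congr rfl fun i hi => ?_
    rcases Nat.eq_zero_or_pos i with rfl | h
    · simp [hq0, hpN]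
    · dsimp only
      rw [if_neg (by omega), if_neg (by omega), show N + (i + 1) - N = i + 1 by omega,
        show N + i - N = i by omega]

theorem exists_midpoint_minEnergy {X : Set E} (hX : IsCompact X) {N : ℕ} (hN : 0 < N)
    {a b : E} (ha : a ∈ X) (hb : b ∈ X) :
    ∃ m ∈ X, 2 * minEnergy X N a m + 2 * minEnergy X N m b ≤ minEnergy X (N + N) a b := by
  obtain ⟨p, ⟨hp0, hpN, hpX⟩, hp⟩ := exists_polyEnergy_eq_minEnergy hX (N := N + N) (by omega) ha hb
  refine ⟨p N, hpX N, ?_⟩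
  rw [← hp, polyEnergy_add_self]
  have h1 : minEnergy X N a (p N) ≤ polyEnergy N p := minEnergy_le ⟨hp0, rfl, hpX⟩
  have h2 : minEnergy X N (p N) b ≤ polyEnergy N fun i => p (N + i) :=
    minEnergy_le ⟨rfl, hpN, fun i => hpX _⟩
  linarith

theorem minEnergy_le_add {X : Set E} (hX : IsCompact X) {N : ℕ} (hN : 0 < N) {R : ℝ}
    (hR : ∀ x ∈ X, ‖x‖ ≤ R) {a a' b : E} (ha : a ∈ X) (ha' : a' ∈ X) (hb : b ∈ X) :
    minEnergy X N a' b ≤ minEnergy X N a b + N * (4 * R) * ‖a' - a‖ := by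
  obtain ⟨p, ⟨hp0, hpN, hpX⟩, hp⟩ := exists_polyEnergy_eq_minEnergy hX hN ha hb
  have hq : Function.update p 0 a' ∈ polygons X N a' b := by
    refine ⟨by simp, by simp [hN.ne', hpN], fun i => ?_⟩
    rcases eq_or_ne i 0 with rfl | h
    · simpa using ha'
    · simpa [h] using hpX i
  refine (minEnergy_le hq).trans ?_
  rw [← hp]
  obtain ⟨k, rfl⟩ : ∃ k, N = k + 1 := ⟨N - 1, by omega⟩
  unfold polyEnergy
  rw [Finset.sum_range_succ', Finset.sum_range_succ']
  have hs : ∑ i ∈ Finset.range k, ‖Function.update p 0 a' (i + 1 + 1) -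
      Function.update p 0 a' (i + 1)‖ ^ 2 = ∑ i ∈ Finset.range k, ‖p (i + 1 + 1) - p (i + 1)‖ ^ 2 :=
    Finset.sum_congr rfl fun i _ => by simp
  rw [hs]
  have h0 : Function.update p 0 a' (0 + 1) = p 1 := by simp
  have h0' : Function.update p 0 a' 0 = a' := by simp
  rw [h0, h0', zero_add, hp0]
  have h1 : ‖p 1 - a'‖ ≤ ‖p 1 - a‖ + ‖a' - a‖ := by
    rw [show p 1 - a' = (p 1 - a) - (a' - a) by abel]; exact norm_sub_le _ _
  have h2 : ‖p 1 - a‖ ≤ 2 * R := by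
    refine (norm_sub_le _ _).trans ?_
    linarith [hR _ (hpX 1), hR _ ha]
  have h3 : ‖p 1 - a'‖ ≤ 2 * R := by
    refine (norm_sub_le _ _).trans ?_
    linarith [hR _ (hpX 1), hR _ ha']
  have h4 : ‖p 1 - a'‖ ^ 2 ≤ ‖p 1 - a‖ ^ 2 + 4 * R * ‖a' - a‖ := by
    nlinarith [norm_nonneg (p 1 - a), norm_nonneg (p 1 - a'), norm_nonneg (a' - a)]
  have h5 : ((k + 1 : ℕ) : ℝ) * ‖p 1 - a'‖ ^ 2 ≤
      ((k + 1 : ℕ) : ℝ) * (‖p 1 - a‖ ^ 2 + 4 * R * ‖a' - a‖) := by gcongr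
  linarith

theorem continuousOn_minEnergy {X : Set E} (hX : IsCompact X) {N : ℕ} (hN : 0 < N) {b : E}
    (hb : b ∈ X) : ContinuousOn (fun a => minEnergy X N a b) X := by
  obtain ⟨R, hR⟩ := hX.isBounded.exists_norm_le
  have hR0 : 0 ≤ R := (norm_nonneg _).trans (hR b hb)
  refine (LipschitzOnWith.of_dist_le_mul (K := Real.toNNReal (N * (4 * R))) fun x hx y hy => ?_).continuousOn
  rw [Real.coe_toNNReal _ (by positivity), Real.dist_eq, dist_eq_norm, abs_le]
  have h1 := minEnergy_le_add hX hN hR hx hy hb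
  have h2 := minEnergy_le_add hX hN hR hy hx hb
  rw [norm_sub_rev] at h1
  constructor <;> linarith

theorem sq_sum_edge_le (N : ℕ) (p : ℕ → E) :
    (∑ i ∈ Finset.range N, ‖p (i + 1) - p i‖) ^ 2 ≤ polyEnergy N p := by
  have := sq_sum_le_card_mul_sum_sq (s := Finset.range N) (f := fun i => ‖p (i + 1) - p i‖)
  rwa [Finset.card_range] at this

end Polygon

section SmoothCore

variable {E : Type*} [NormedAddCommGroup E] [InnerProductSpace ℝ E]

/-- A convex function `G` with gradient `G'` and Hessian `H`, with uniform bounds at the points of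
the level set `{G = 1}`. -/
structure IsSmoothConvex (G : E → ℝ) (G' : E → E) (H : E → E →ₗ[ℝ] E →ₗ[ℝ] ℝ) (A : ℝ) : Prop where
  one_le : 1 ≤ A
  strict : ∀ x, HasStrictFDerivAt G (innerSL ℝ (G' x)) x
  le : ∀ x y, G x + ⟪G' x, y - x⟫_ℝ ≤ G y
  taylor : ∀ x, G x = 1 → ∀ v, ‖v‖ ≤ 1 → |G (x + v) - G x - ⟪G' x, v⟫_ℝ - H x v v / 2| ≤ A * ‖v‖ ^ 3
  grad_taylor : ∀ x, G x = 1 → ∀ v w, ‖v‖ ≤ 1 →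
    |⟪G' (x + v) - G' x, w⟫_ℝ - H x v w| ≤ A * ‖v‖ ^ 2 * ‖w‖
  symm : ∀ x v w, H x v w = H x w v
  nonneg : ∀ x v, 0 ≤ H x v v
  sq_le : ∀ x v w, H x v w ^ 2 ≤ H x v v * H x w w
  bound : ∀ x, G x = 1 → ∀ v w, |H x v w| ≤ A * ‖v‖ * ‖w‖
  grad_le : ∀ x, G x = 1 → ‖G' x‖ ≤ A
  le_grad : ∀ x, G x = 1 → 1 ≤ A * ‖G' x‖

namespace IsSmoothConvex

variable {G : E → ℝ} {G' : E → E} {H : E → E →ₗ[ℝ] E →ₗ[ℝ] ℝ} {A : ℝ}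

theorem inner_grad_nonpos (hG : IsSmoothConvex G G' H A) {x v : E} (hx : G x = 1)
    (hv : G (x + v) = 1) : ⟪G' x, v⟫_ℝ ≤ 0 := by
  have := hG.le x (x + v)
  rw [hx, hv, add_sub_cancel_left] at this
  linarith

theorem abs_inner_grad_add_le (hG : IsSmoothConvex G G' H A) {x v : E} (hx : G x = 1)
    (hv : G (x + v) = 1) (h1 : ‖v‖ ≤ 1) : |⟪G' x, v⟫_ℝ + H x v v / 2| ≤ A * ‖v‖ ^ 3 := by
  have := hG.taylor x hx v h1
  rw [hx, hv] at this
  rw [abs_le] at this ⊢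
  constructor <;> linarith [this.1, this.2]

theorem neg_inner_grad_le (hG : IsSmoothConvex G G' H A) {x v : E} (hx : G x = 1)
    (hv : G (x + v) = 1) (h1 : ‖v‖ ≤ 1) : -⟪G' x, v⟫_ℝ ≤ 2 * A * ‖v‖ ^ 2 := by
  have h2 := (abs_le.1 (hG.abs_inner_grad_add_le hx hv h1)).1
  have h3 := (abs_le.1 (hG.bound x hx v v)).2
  have hA := hG.one_le
  have h4 : A * ‖v‖ ^ 3 ≤ A * ‖v‖ ^ 2 := by
    have : ‖v‖ ^ 3 ≤ ‖v‖ ^ 2 := pow_le_pow_of_le_one (norm_nonneg _) h1 (by norm_num)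
    gcongr
  nlinarith [norm_nonneg v, sq_nonneg ‖v‖]

theorem norm_grad_sub_le (hG : IsSmoothConvex G G' H A) {x v : E} (hx : G x = 1)
    (h1 : ‖v‖ ≤ 1) : ‖G' (x + v) - G' x‖ ≤ 2 * A * ‖v‖ := by
  set w := G' (x + v) - G' x with hw
  have h2 := (abs_le.1 (hG.grad_taylor x hx v w h1)).2
  have h3 := (abs_le.1 (hG.bound x hx v w)).2
  rw [← hw, real_inner_self_eq_norm_sq] at h2
  have hA := hG.one_le
  rcases (norm_nonneg w).eq_or_lt with h0 | h0
  · rw [← h0]; positivity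
  · have h4 : A * ‖v‖ ^ 2 * ‖w‖ ≤ A * ‖v‖ * ‖w‖ := by
      have : ‖v‖ ^ 2 ≤ ‖v‖ := by nlinarith [norm_nonneg v]
      gcongr
    have : ‖w‖ * ‖w‖ ≤ (2 * A * ‖v‖) * ‖w‖ := by linarith
    exact le_of_mul_le_mul_right this h0

theorem multiplier_le (hG : IsSmoothConvex G G' H A) {x v v' : E} {lam : ℝ} (hx : G x = 1)
    (hv : G (x + v) = 1) (hv' : G (x - v') = 1) (h : v - v' = -(lam • G' x))
    (h1 : ‖v‖ ≤ 1) (h1' : ‖v'‖ ≤ 1) :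
    0 ≤ lam ∧ lam ≤ 2 * A ^ 3 * (‖v‖ ^ 2 + ‖v'‖ ^ 2) := by
  have hA := hG.one_le
  have e1 : lam * ‖G' x‖ ^ 2 = ⟪G' x, v'⟫_ℝ - ⟪G' x, v⟫_ℝ := by
    have := congrArg (fun z => ⟪G' x, z⟫_ℝ) h
    simp only [inner_sub_right, inner_neg_right, real_inner_smul_right,
      real_inner_self_eq_norm_sq] at this
    linarith
  rw [sub_eq_add_neg] at hv'
  have a1 := hG.inner_grad_nonpos hx hv
  have a2 := hG.inner_grad_nonpos hx hv'
  have b1 := hG.neg_inner_grad_le hx hv h1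
  have b2 := hG.neg_inner_grad_le hx hv' (by rwa [norm_neg])
  rw [inner_neg_right] at a2 b2
  rw [norm_neg] at b2
  have hg := hG.le_grad x hx
  have hg0 : 0 < ‖G' x‖ := by
    by_contra! hh
    nlinarith
  have hl : 0 ≤ lam := by
    have : 0 ≤ lam * ‖G' x‖ ^ 2 := by rw [e1]; linarith
    exact nonneg_of_mul_nonneg_left this (by positivity)
  refine ⟨hl, ?_⟩
  have hg2 : 1 ≤ A ^ 2 * ‖G' x‖ ^ 2 := by
    rw [← mul_pow]; exact one_le_pow₀ hg
  calc lam ≤ lam * (A ^ 2 * ‖G' x‖ ^ 2) := le_mul_of_one_le_right hl hg2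
    _ = A ^ 2 * (lam * ‖G' x‖ ^ 2) := by ring
    _ ≤ A ^ 2 * (2 * A * (‖v‖ ^ 2 + ‖v'‖ ^ 2)) := by
        have : lam * ‖G' x‖ ^ 2 ≤ 2 * A * (‖v‖ ^ 2 + ‖v'‖ ^ 2) := by rw [e1]; linarith
        gcongr
    _ = _ := by ring

theorem abs_sq_sub_sq_le (hG : IsSmoothConvex G G' H A) {x v v' : E} {lam : ℝ} (hx : G x = 1)
    (hv : G (x + v) = 1) (hv' : G (x - v') = 1) (h : v - v' = -(lam • G' x))
    (h1 : ‖v‖ ≤ 1) (h1' : ‖v'‖ ≤ 1) :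
    |‖v‖ ^ 2 - ‖v'‖ ^ 2| ≤ 4 * A ^ 4 * (‖v‖ ^ 2 + ‖v'‖ ^ 2) ^ 2 := by
  have hA := hG.one_le
  obtain ⟨hl, hl'⟩ := hG.multiplier_le hx hv hv' h h1 h1'
  have e1 : ‖v‖ ^ 2 - ‖v'‖ ^ 2 = -lam * (⟪G' x, v⟫_ℝ + ⟪G' x, v'⟫_ℝ) := by
    have h2 : ⟪v - v', v + v'⟫_ℝ = ‖v‖ ^ 2 - ‖v'‖ ^ 2 := by
      rw [inner_sub_left, inner_add_right, inner_add_right, real_inner_self_eq_norm_sq,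
        real_inner_self_eq_norm_sq, real_inner_comm v v']
      ring
    rw [← h2, h, inner_neg_left, real_inner_smul_left, inner_add_right]
    ring
  rw [sub_eq_add_neg] at hv'
  have a1 := hG.inner_grad_nonpos hx hv
  have a2 := hG.inner_grad_nonpos hx hv'
  have b1 := hG.neg_inner_grad_le hx hv h1
  have b2 := hG.neg_inner_grad_le hx hv' (by rwa [norm_neg])
  rw [inner_neg_right] at a2 b2
  rw [norm_neg] at b2
  have h3 : |⟪G' x, v⟫_ℝ + ⟪G' x, v'⟫_ℝ| ≤ 2 * A * (‖v‖ ^ 2 + ‖v'‖ ^ 2) := by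
    rw [abs_le]
    constructor <;> nlinarith [sq_nonneg ‖v‖, sq_nonneg ‖v'‖]
  rw [e1, abs_mul, abs_neg, abs_of_nonneg hl]
  calc lam * |⟪G' x, v⟫_ℝ + ⟪G' x, v'⟫_ℝ|
      ≤ (2 * A ^ 3 * (‖v‖ ^ 2 + ‖v'‖ ^ 2)) * (2 * A * (‖v‖ ^ 2 + ‖v'‖ ^ 2)) := by gcongr
    _ = _ := by ring

theorem inner_grad_sq_le (hG : IsSmoothConvex G G' H A) {x v v' w : E} {lam σ : ℝ} (hx : G x = 1)
    (hv : G (x + v) = 1) (hv' : G (x - v') = 1) (h : v - v' = -(lam • G' x))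
    (h1 : ‖v‖ ≤ σ) (h1' : ‖v'‖ ≤ σ) (hσ : σ ≤ 1) (hw : ⟪G' x, w⟫_ℝ = 0) :
    ⟪w, G' (x + v)⟫_ℝ ^ 2 ≤ ‖G' (x + v)‖ ^ 2 * (lam * H x w w) + 25 * A ^ 6 * σ ^ 3 * ‖w‖ ^ 2 := by
  have hA := hG.one_le
  have hσ0 : 0 ≤ σ := (norm_nonneg _).trans h1
  have hv1 := h1.trans hσ
  have hv1' := h1'.trans hσ
  obtain ⟨hl, hl'⟩ := hG.multiplier_le hx hv hv' h hv1 hv1'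
  have hl2 : lam ≤ 4 * A ^ 3 * σ ^ 2 := by
    refine hl'.trans ?_
    have : ‖v‖ ^ 2 + ‖v'‖ ^ 2 ≤ σ ^ 2 + σ ^ 2 := by gcongr
    calc 2 * A ^ 3 * (‖v‖ ^ 2 + ‖v'‖ ^ 2) ≤ 2 * A ^ 3 * (σ ^ 2 + σ ^ 2) := by gcongr
      _ = _ := by ring
  have e1 : lam * ‖G' x‖ ^ 2 = ⟪G' x, v'⟫_ℝ - ⟪G' x, v⟫_ℝ := by
    have := congrArg (fun z => ⟪G' x, z⟫_ℝ) h
    simp only [inner_sub_right, inner_neg_right, real_inner_smul_right,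
      real_inner_self_eq_norm_sq] at this
    linarith
  have hHv' : H x v v - 8 * A ^ 5 * σ ^ 3 ≤ H x v' v' := by
    have hvv : v' = v + lam • G' x := by
      have : v' = v - (v - v') := by abel
      rw [this, h, sub_neg_eq_add]
    have h2 : H x v' v' = H x v v + 2 * lam * H x v (G' x) + lam ^ 2 * H x (G' x) (G' x) := by
      rw [hvv]
      simp only [map_add, map_smul, LinearMap.add_apply, LinearMap.smul_apply, smul_eq_mul]
      rw [hG.symm x (G' x) v]
      ring
    have h3 := (abs_le.1 (hG.bound x hx v (G' x))).1
    have h4 : A * ‖v‖ * ‖G' x‖ ≤ A * σ * A := by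
      have := hG.grad_le x hx
      gcongr
    have h5 : 2 * lam * (A * σ * A) ≤ 2 * (4 * A ^ 3 * σ ^ 2) * (A * σ * A) := by gcongr
    have h6 : 2 * lam * (-(A * σ * A)) ≤ 2 * lam * H x v (G' x) := by
      gcongr; linarith
    have h7 : 0 ≤ lam ^ 2 * H x (G' x) (G' x) := mul_nonneg (sq_nonneg _) (hG.nonneg _ _)
    nlinarith
  have hlow : H x v v - 6 * A ^ 5 * σ ^ 3 ≤ lam * ‖G' x‖ ^ 2 := by
    rw [sub_eq_add_neg] at hv'
    have b1 := (abs_le.1 (hG.abs_inner_grad_add_le hx hv hv1)).2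
    have b2 := (abs_le.1 (hG.abs_inner_grad_add_le hx hv' (by rwa [norm_neg]))).2
    simp only [inner_neg_right, map_neg, LinearMap.neg_apply, neg_neg, norm_neg] at b2
    have c1 : A * ‖v‖ ^ 3 ≤ A ^ 5 * σ ^ 3 := by
      have : A ≤ A ^ 5 := le_self_pow₀ hA (by norm_num)
      gcongr
    have c2 : A * ‖v'‖ ^ 3 ≤ A ^ 5 * σ ^ 3 := by
      have : A ≤ A ^ 5 := le_self_pow₀ hA (by norm_num)
      gcongr
    rw [e1]
    linarith
  have hx1 : G' (x + v) = G' x + (G' (x + v) - G' x) := by abel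
  have hgs : ‖G' x‖ ^ 2 - 4 * A ^ 2 * σ ≤ ‖G' (x + v)‖ ^ 2 := by
    have d1 := hG.norm_grad_sub_le hx hv1
    have d2 : ‖G' x‖ ≤ ‖G' (x + v)‖ + ‖G' (x + v) - G' x‖ := by
      have := norm_sub_le (G' (x + v)) (G' (x + v) - G' x)
      rwa [sub_sub_cancel] at this
    have d3 := hG.grad_le x hx
    have d4 := hG.grad_le _ hv
    have d5 : ‖G' x‖ - ‖G' (x + v)‖ ≤ 2 * A * σ := by
      have : 2 * A * ‖v‖ ≤ 2 * A * σ := by gcongr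
      linarith
    have d6 : 0 ≤ ‖G' x‖ + ‖G' (x + v)‖ := by positivity
    have : (‖G' x‖ - ‖G' (x + v)‖) * (‖G' x‖ + ‖G' (x + v)‖) ≤
        (2 * A * σ) * (A + A) := by
      calc _ ≤ (2 * A * σ) * (‖G' x‖ + ‖G' (x + v)‖) := by gcongr
        _ ≤ _ := by gcongr
    linarith
  have hlow2 : H x v v - 22 * A ^ 5 * σ ^ 3 ≤ lam * ‖G' (x + v)‖ ^ 2 := by
    have h2 : lam * (‖G' x‖ ^ 2 - 4 * A ^ 2 * σ) ≤ lam * ‖G' (x + v)‖ ^ 2 := by gcongr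
    have h3 : lam * (4 * A ^ 2 * σ) ≤ (4 * A ^ 3 * σ ^ 2) * (4 * A ^ 2 * σ) := by gcongr
    linarith
  set e := ⟪G' (x + v) - G' x, w⟫_ℝ - H x v w with he
  have he' : |e| ≤ A * σ ^ 2 * ‖w‖ := (hG.grad_taylor x hx v w hv1).trans (by gcongr)
  have hin : ⟪w, G' (x + v)⟫_ℝ = H x v w + e := by
    rw [he, inner_sub_left, hw, real_inner_comm]; ring
  have hHvw : |H x v w| ≤ A * σ * ‖w‖ := (hG.bound x hx v w).trans (by gcongr)
  have hcs := hG.sq_le x v w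
  have hHw : H x w w ≤ A * ‖w‖ * ‖w‖ := (abs_le.1 (hG.bound x hx w w)).2
  have hHw0 := hG.nonneg x w
  have f1 : e * H x v w ≤ (A * σ ^ 2 * ‖w‖) * (A * σ * ‖w‖) := by
    refine (le_abs_self _).trans ?_
    rw [abs_mul]; gcongr
  have f2 : e ^ 2 ≤ (A * σ ^ 2 * ‖w‖) ^ 2 := by
    rw [← sq_abs]; gcongr
  have f3 : (A * σ ^ 2 * ‖w‖) ^ 2 ≤ A ^ 2 * σ ^ 3 * ‖w‖ ^ 2 := by
    have : σ ^ 4 ≤ σ ^ 3 := pow_le_pow_of_le_one hσ0 hσ (by norm_num)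
    calc (A * σ ^ 2 * ‖w‖) ^ 2 = A ^ 2 * σ ^ 4 * ‖w‖ ^ 2 := by ring
      _ ≤ _ := by gcongr
  have f4 : (H x v v - 22 * A ^ 5 * σ ^ 3) * H x w w ≤
      lam * ‖G' (x + v)‖ ^ 2 * H x w w := by gcongr
  have f5 : 22 * A ^ 5 * σ ^ 3 * H x w w ≤ 22 * A ^ 5 * σ ^ 3 * (A * ‖w‖ * ‖w‖) := by gcongr
  have f6 : A ^ 2 * (σ ^ 3 * ‖w‖ ^ 2) ≤ A ^ 6 * (σ ^ 3 * ‖w‖ ^ 2) := by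
    have : A ^ 2 ≤ A ^ 6 := pow_le_pow_right₀ hA (by norm_num)
    gcongr
  rw [hin]
  nlinarith

theorem exists_multiplier [CompleteSpace E] (hG : IsSmoothConvex G G' H A) {N : ℕ} {a b : E}
    {p : ℕ → E} (hp : p ∈ polygons {x | G x = 1} N a b)
    (hmin : polyEnergy N p = minEnergy {x | G x = 1} N a b) {i : ℕ} (hi : i + 1 < N) :
    ∃ lam : ℝ, (p (i + 2) - p (i + 1)) - (p (i + 1) - p i) = -(lam • G' (p (i + 1))) := by
  set ψ : E → ℝ := fun x => ‖x - p i‖ ^ 2 + ‖p (i + 2) - x‖ ^ 2 with hψ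
  set x₀ := p (i + 1) with hx₀
  have hx1 : G x₀ = 1 := hp.2.2 _
  have hN : (0 : ℝ) < N := by exact_mod_cast (by omega : 0 < N)
  have hext : IsLocalExtrOn ψ {x | G x = G x₀} x₀ := by
    left
    refine eventually_nhdsWithin_of_forall fun x hx => ?_
    have hx : G x = 1 := by rw [← hx1]; exact hx
    have hq : Function.update p (i + 1) x ∈ polygons {x | G x = 1} N a b := by
      refine ⟨?_, ?_, fun j => ?_⟩
      · rw [Function.update_of_ne (by omega)]; exact hp.1
      · rw [Function.update_of_ne (by omega)]; exact hp.2.1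
      · rcases eq_or_ne j (i + 1) with rfl | hj
        · simpa using hx
        · simpa [hj] using hp.2.2 j
    have h1 := minEnergy_le hq
    rw [← hmin] at h1
    unfold polyEnergy at h1
    have h2 := le_of_mul_le_mul_left h1 hN
    have hs : ∀ f : ℕ → ℝ, ∑ j ∈ Finset.range N, f j =
        f i + f (i + 1) + ∑ j ∈ (Finset.range N).filter (fun j => j ≠ i ∧ j ≠ i + 1), f j := by
      intro f
      rw [← Finset.sum_pair (show i ≠ i + 1 by omega), ← Finset.sum_union]
      · refine Finset.sum_congr ?_ fun _ _ => rfl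
        ext j
        simp only [Finset.mem_range, Finset.mem_union, Finset.mem_insert, Finset.mem_singleton,
          Finset.mem_filter]
        omega
      · rw [Finset.disjoint_left]
        intro j
        simp only [Finset.mem_insert, Finset.mem_singleton, Finset.mem_filter]
        omega
    rw [hs, hs fun j => ‖Function.update p (i + 1) x (j + 1) - Function.update p (i + 1) x j‖ ^ 2]
      at h2
    have h3 : ∑ j ∈ (Finset.range N).filter (fun j => j ≠ i ∧ j ≠ i + 1),
        ‖Function.update p (i + 1) x (j + 1) - Function.update p (i + 1) x j‖ ^ 2 =
        ∑ j ∈ (Finset.range N).filter (fun j => j ≠ i ∧ j ≠ i + 1), ‖p (j + 1) - p j‖ ^ 2 := by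
      refine Finset.sum_congr rfl fun j hj => ?_
      simp only [Finset.mem_filter] at hj
      rw [Function.update_of_ne (by omega), Function.update_of_ne (by omega)]
    rw [h3] at h2
    simp only [Function.update_self] at h2
    rw [Function.update_of_ne (by omega), Function.update_of_ne (by omega)] at h2
    simp only [hψ]
    linarith
  have hψ' : HasStrictFDerivAt ψ (innerSL ℝ ((2 : ℝ) • (x₀ - p i) - (2 : ℝ) • (p (i + 2) - x₀))) x₀ := by
    have h1 : HasStrictFDerivAt (fun x : E => x - p i) (ContinuousLinearMap.id ℝ E) x₀ :=
      (hasStrictFDerivAt_id x₀).sub_const _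
    have h2 : HasStrictFDerivAt (fun x : E => p (i + 2) - x) (-ContinuousLinearMap.id ℝ E) x₀ :=
      (hasStrictFDerivAt_id x₀).const_sub _
    have h3 := ((hasStrictFDerivAt_norm_sq (x₀ - p i)).comp x₀ h1).add
      ((hasStrictFDerivAt_norm_sq (p (i + 2) - x₀)).comp x₀ h2)
    refine h3.congr_fderiv ?_
    ext z
    simp
    ring
  obtain ⟨α, β, hne, hab⟩ := hext.exists_multipliers_of_hasStrictFDerivAt_1d (hG.strict x₀) hψ'
  have hg := hG.le_grad x₀ hx1
  have hg0 : G' x₀ ≠ 0 := by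
    intro h0
    rw [h0, norm_zero, mul_zero] at hg
    linarith
  have hvec : α • G' x₀ + β • ((2 : ℝ) • (x₀ - p i) - (2 : ℝ) • (p (i + 2) - x₀)) = 0 := by
    refine ext_inner_right ℝ fun z => ?_
    have := congrArg (fun L : E →L[ℝ] ℝ => L z) hab
    simpa [inner_add_left, inner_sub_left, real_inner_smul_left] using this
  have hβ : β ≠ 0 := by
    rintro rfl
    rw [zero_smul, add_zero] at hvec
    rcases smul_eq_zero.1 hvec with h | h
    · exact hne (by rw [h]; rfl)
    · exact hg0 h
  refine ⟨-(α / (2 * β)), ?_⟩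
  have h5 : (p (i + 2) - x₀) - (x₀ - p i) =
      (α / (2 * β)) • G' x₀ - (1 / (2 * β)) •
        (α • G' x₀ + β • ((2 : ℝ) • (x₀ - p i) - (2 : ℝ) • (p (i + 2) - x₀))) := by
    rw [smul_add, smul_smul, smul_smul]
    have e1 : 1 / (2 * β) * α = α / (2 * β) := by ring
    have e2 : 1 / (2 * β) * β = 1 / 2 := by field_simp
    rw [e1, e2]
    module
  rw [h5, hvec]
  simp

end IsSmoothConvex

theorem le_of_sum_le_of_abs_sub_le {N : ℕ} {s : ℕ → ℝ} {κ B : ℝ} (hN : 0 < N)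
    (hs : ∀ i < N, 0 ≤ s i) (hκ : 0 ≤ κ) (hsum : N * ∑ i ∈ Finset.range N, s i ≤ B)
    (hstep : ∀ i, i + 1 < N → |s (i + 1) - s i| ≤ κ * (s (i + 1) + s i) ^ 2)
    (hNκ : 8 * κ * B ≤ N) {i : ℕ} (hi : i < N) : s i ≤ 2 * B / N ^ 2 := by
  have hN' : (0 : ℝ) < N := by exact_mod_cast hN
  have hne : (Finset.range N).Nonempty := ⟨0, by simpa using hN⟩
  obtain ⟨j, hj, hjmax⟩ := Finset.exists_max_image _ s hne
  obtain ⟨k, hk, hkmin⟩ := Finset.exists_min_image _ s hne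
  simp only [Finset.mem_range] at hj hk hjmax hkmin
  have hS0 := hs j hj
  have hsumB : ∑ i ∈ Finset.range N, s i ≤ B / N := by
    rw [le_div_iff₀ hN']; linarith
  have hkB : s k ≤ B / N ^ 2 := by
    have : N • s k ≤ ∑ i ∈ Finset.range N, s i := by
      have := Finset.card_nsmul_le_sum (Finset.range N) s (s k)
        fun i hi => hkmin i (Finset.mem_range.1 hi)
      simpa using this
    rw [le_div_iff₀ (by positivity)]
    rw [nsmul_eq_mul] at this
    nlinarith
  have hvar : ∀ m n, m ≤ n → n < N → |s n - s m| ≤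
      ∑ i ∈ Finset.Ico m n, |s (i + 1) - s i| := by
    intro m n hmn _
    rw [← Finset.sum_Ico_sub s hmn]
    exact Finset.abs_sum_le_sum_abs _ _
  have hvar2 : ∀ m n, m ≤ n → n < N → |s n - s m| ≤ s j / 2 := by
    intro m n hmn hn
    refine (hvar m n hmn hn).trans ?_
    have hsub : Finset.Ico m n ⊆ Finset.range (N - 1) := fun i hi => by
      simp only [Finset.mem_Ico, Finset.mem_range] at hi ⊢; omega
    have t1 : ∑ i ∈ Finset.Ico m n, |s (i + 1) - s i| ≤
        ∑ i ∈ Finset.range (N - 1), |s (i + 1) - s i| :=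
      Finset.sum_le_sum_of_subset_of_nonneg hsub fun _ _ _ => abs_nonneg _
    have t2 : ∑ i ∈ Finset.range (N - 1), |s (i + 1) - s i| ≤
        ∑ i ∈ Finset.range (N - 1), (κ * (2 * s j)) * (s (i + 1) + s i) := by
      refine Finset.sum_le_sum fun i hi => ?_
      have hi := Finset.mem_range.1 hi
      refine (hstep i (by omega)).trans ?_
      have h1 := hjmax i (by omega)
      have h2 := hjmax (i + 1) (by omega)
      have h3 := hs i (by omega)
      have h4 := hs (i + 1) (by omega)
      calc κ * (s (i + 1) + s i) ^ 2 = κ * ((s (i + 1) + s i)) * (s (i + 1) + s i) := by ring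
        _ ≤ κ * (2 * s j) * (s (i + 1) + s i) := by gcongr; linarith
    have t3 : ∑ i ∈ Finset.range (N - 1), (s (i + 1) + s i) ≤ 2 * (B / N) := by
      obtain ⟨n', rfl⟩ : ∃ n', N = n' + 1 := ⟨N - 1, by omega⟩
      rw [Finset.sum_add_distrib]
      simp only [Nat.add_sub_cancel]
      have u1 := Finset.sum_range_succ s n'
      have u2 := Finset.sum_range_succ' s n'
      have u3 := hs 0 hN
      have u4 := hs n' (by omega)
      linarith
    have t4 : κ * (2 * s j) * (2 * (B / N)) ≤ s j / 2 := by
      have : κ * (2 * s j) * (2 * (B / N)) = s j / 2 * (8 * κ * B / N) := by ring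
      rw [this]
      refine mul_le_of_le_one_right (by positivity) ?_
      rw [div_le_one hN']; exact hNκ
    rw [← Finset.mul_sum] at t2
    have t5 : κ * (2 * s j) * ∑ i ∈ Finset.range (N - 1), (s (i + 1) + s i) ≤
        κ * (2 * s j) * (2 * (B / N)) := by gcongr
    linarith
  have hjk : s j - s k ≤ s j / 2 := by
    rcases le_total j k with h | h
    · exact ((neg_le_abs _).trans (hvar2 j k h hk)).trans' (by linarith)
    · exact (le_abs_self _).trans (hvar2 k j h hj)
  have := hjmax i hi
  have : 2 * B / N ^ 2 = 2 * (B / N ^ 2) := by ring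
  linarith

end SmoothCore

section SmoothLocal

variable {E : Type*} [NormedAddCommGroup E] [InnerProductSpace ℝ E]

/-- Transport of `w₀` along a sequence of unit normals by successive orthogonal projection. -/
noncomputable def transport (ν : ℕ → E) (w₀ : E) : ℕ → E
  | 0 => w₀
  | i + 1 => transport ν w₀ i - ⟪transport ν w₀ i, ν (i + 1)⟫_ℝ • ν (i + 1)

theorem norm_sub_inner_smul_le {w ν : E} (hν : ‖ν‖ = 1) : ‖w - ⟪w, ν⟫_ℝ • ν‖ ≤ ‖w‖ := by
  have : ‖w - ⟪w, ν⟫_ℝ • ν‖ ^ 2 ≤ ‖w‖ ^ 2 := by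
    rw [norm_sub_sq_real, real_inner_smul_right, norm_smul, hν, mul_one, Real.norm_eq_abs, sq_abs]
    nlinarith [sq_nonneg ⟪w, ν⟫_ℝ]
  exact (sq_le_sq₀ (norm_nonneg _) (norm_nonneg _)).1 this

theorem inner_sub_inner_smul {w ν : E} (hν : ‖ν‖ = 1) : ⟪ν, w - ⟪w, ν⟫_ℝ • ν⟫_ℝ = 0 := by
  rw [inner_sub_right, real_inner_smul_right, real_inner_self_eq_norm_sq, hν, real_inner_comm]
  ring

theorem norm_transport_le {ν : ℕ → E} (hν : ∀ i, ‖ν i‖ = 1) (w₀ : E) (i : ℕ) :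
    ‖transport ν w₀ i‖ ≤ ‖w₀‖ := by
  induction i with
  | zero => exact le_rfl
  | succ k ih => exact (norm_sub_inner_smul_le (hν _)).trans ih

theorem inner_transport {ν : ℕ → E} (hν : ∀ i, ‖ν i‖ = 1) {w₀ : E} (h0 : ⟪ν 0, w₀⟫_ℝ = 0) (i : ℕ) :
    ⟪ν i, transport ν w₀ i⟫_ℝ = 0 := by
  cases i with
  | zero => exact h0
  | succ k => exact inner_sub_inner_smul (hν _)

theorem sum_inner_sub_eq {N : ℕ} {D Y g : ℕ → E} {lam : ℕ → ℝ} (h0 : lam 0 = 0)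
    (h : ∀ i, i + 1 < N → D (i + 1) - D i = -(lam (i + 1) • g (i + 1))) (n : ℕ) (hn : n < N) :
    ∑ i ∈ Finset.range (n + 1), ⟪D i, Y (i + 1) - Y i⟫_ℝ =
      ⟪D n, Y (n + 1)⟫_ℝ - ⟪D 0, Y 0⟫_ℝ + ∑ i ∈ Finset.range (n + 1), lam i * ⟪g i, Y i⟫_ℝ := by
  induction n with
  | zero => simp [h0, inner_sub_right]
  | succ k ih =>
    rw [Finset.sum_range_succ, ih (by omega), Finset.sum_range_succ _ (k + 1)]
    have hD : D (k + 1) = D k - lam (k + 1) • g (k + 1) := by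
      have := h k hn
      rw [sub_eq_iff_eq_add] at this
      rw [this]; abel
    have e : ⟪D k, Y (k + 1)⟫_ℝ = ⟪D (k + 1), Y (k + 1)⟫_ℝ + lam (k + 1) * ⟪g (k + 1), Y (k + 1)⟫_ℝ := by
      rw [hD, inner_sub_left, real_inner_smul_left]; ring
    rw [e, inner_sub_right]
    ring

namespace IsSmoothConvex

variable {G : E → ℝ} {G' : E → E} {H : E → E →ₗ[ℝ] E →ₗ[ℝ] ℝ} {A : ℝ}

theorem grad_norm_pos (hG : IsSmoothConvex G G' H A) {x : E} (hx : G x = 1) : 0 < ‖G' x‖ := by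
  have hg := hG.le_grad x hx
  have := hG.one_le
  by_contra! hh
  nlinarith

theorem continuous (hG : IsSmoothConvex G G' H A) : Continuous G :=
  continuous_iff_continuousAt.2 fun x => (hG.strict x).continuousAt

theorem exists_normal_displacement (hG : IsSmoothConvex G G' H A) {x z : E} {r : ℝ}
    (hx : G x = 1) (hz : ⟪G' x, z⟫_ℝ = 0) (hzr : ‖z‖ ≤ r) (hr : 6 * A ^ 2 * r ≤ 1) :
    ∃ κ : ℝ, 0 ≤ κ ∧ κ ≤ 6 * A ^ 2 * r ^ 2 ∧ G (x + (z - κ • (‖G' x‖⁻¹ • G' x))) = 1 := by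
  have hA := hG.one_le
  have hr0 : 0 ≤ r := (norm_nonneg _).trans hzr
  have hg := hG.grad_norm_pos hx
  set ν := ‖G' x‖⁻¹ • G' x with hν
  have hν1 : ‖ν‖ = 1 := by
    rw [hν, norm_smul, norm_inv, norm_norm, inv_mul_cancel₀ hg.ne']
  have hgν : ⟪G' x, ν⟫_ℝ = ‖G' x‖ := by
    rw [hν, real_inner_smul_right, real_inner_self_eq_norm_sq]; field_simp
  set k := 6 * A ^ 2 * r ^ 2 with hk
  have hk0 : 0 ≤ k := by positivity
  have hkr : k ≤ r := by
    have : k = (6 * A ^ 2 * r) * r := by rw [hk]; ring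
    rw [this]; exact mul_le_of_le_one_left hr0 hr
  have hr6 : r ≤ 1 / 6 := by
    have : 1 ≤ A ^ 2 := one_le_pow₀ hA
    nlinarith
  have hcont : ContinuousOn (fun κ : ℝ => G (x + (z - κ • ν))) (Icc 0 k) :=
    (hG.continuous.comp (by fun_prop)).continuousOn
  have h0 : 1 ≤ G (x + (z - (0 : ℝ) • ν)) := by
    have := hG.le x (x + (z - (0 : ℝ) • ν))
    rw [add_sub_cancel_left, zero_smul, sub_zero, hz, hx] at this
    simpa using this
  have h1 : G (x + (z - k • ν)) ≤ 1 := by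
    have hn : ‖z - k • ν‖ ≤ 2 * r := by
      refine (norm_sub_le _ _).trans ?_
      rw [norm_smul, hν1, mul_one, Real.norm_eq_abs, abs_of_nonneg hk0]
      linarith
    have t := (abs_le.1 (hG.taylor x hx (z - k • ν) (by linarith))).2
    have b := (abs_le.1 (hG.bound x hx (z - k • ν) (z - k • ν))).2
    rw [inner_sub_right, real_inner_smul_right, hz, hgν, hx] at t
    set v := z - k • ν
    have c1 : ‖v‖ ^ 2 ≤ (2 * r) ^ 2 := by gcongr
    have c2 : ‖v‖ ^ 3 ≤ (2 * r) ^ 2 * (1 / 3) := by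
      have : ‖v‖ ≤ 1 / 3 := by linarith
      calc ‖v‖ ^ 3 = ‖v‖ ^ 2 * ‖v‖ := by ring
        _ ≤ _ := by gcongr
    have c3 : A * ‖v‖ ^ 3 ≤ A * ((2 * r) ^ 2 * (1 / 3)) := by gcongr
    have c4 : A * ‖v‖ ^ 2 ≤ A * (2 * r) ^ 2 := by gcongr
    have c5 : 6 * A * r ^ 2 ≤ k * ‖G' x‖ := by
      have := hG.le_grad x hx
      calc 6 * A * r ^ 2 = 6 * A * r ^ 2 * 1 := by ring
        _ ≤ 6 * A * r ^ 2 * (A * ‖G' x‖) := by gcongr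
        _ = _ := by rw [hk]; ring
    have c6 : 0 ≤ A * r ^ 2 := by positivity
    linarith
  obtain ⟨κ, hκ, h⟩ := intermediate_value_Icc' hk0 hcont ⟨h1, h0⟩
  exact ⟨κ, hκ.1, hκ.2, h⟩

theorem inner_grad_le_of_displacement (hG : IsSmoothConvex G G' H A) {x z ν : E} {r κ : ℝ}
    (hx : G x = 1) (hν : ‖ν‖ = 1) (hzr : ‖z‖ ≤ r) (hr : 6 * A ^ 2 * r ≤ 1) (hκ : 0 ≤ κ)
    (hκr : κ ≤ 6 * A ^ 2 * r ^ 2) (hc : G (x + (z - κ • ν)) = 1) :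
    ⟪G' x, z - κ • ν⟫_ℝ ≤ -(H x z z / 2) + 14 * A ^ 3 * r ^ 3 := by
  have hA := hG.one_le
  have hr0 : 0 ≤ r := (norm_nonneg _).trans hzr
  have hkr : κ ≤ r := by
    have : 6 * A ^ 2 * r ^ 2 = (6 * A ^ 2 * r) * r := by ring
    rw [this] at hκr; exact hκr.trans (mul_le_of_le_one_left hr0 hr)
  have hr6 : r ≤ 1 / 6 := by
    have : 1 ≤ A ^ 2 := one_le_pow₀ hA
    nlinarith
  have hn : ‖z - κ • ν‖ ≤ 2 * r := by
    refine (norm_sub_le _ _).trans ?_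
    rw [norm_smul, hν, mul_one, Real.norm_eq_abs, abs_of_nonneg hκ]
    linarith
  have t := (abs_le.1 (hG.abs_inner_grad_add_le hx hc (by linarith))).2
  have e1 : H x (z - κ • ν) (z - κ • ν) = H x z z - 2 * κ * H x z ν + κ ^ 2 * H x ν ν := by
    simp only [map_sub, map_smul, LinearMap.sub_apply, LinearMap.smul_apply, smul_eq_mul]
    rw [hG.symm x ν z]
    ring
  have e2 : 0 ≤ κ ^ 2 * H x ν ν := mul_nonneg (sq_nonneg _) (hG.nonneg _ _)
  have e3 := (abs_le.1 (hG.bound x hx z ν)).2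
  rw [hν, mul_one] at e3
  have e4 : κ * H x z ν ≤ (6 * A ^ 2 * r ^ 2) * (A * r) := by
    calc κ * H x z ν ≤ κ * (A * r) := by
          have : A * ‖z‖ ≤ A * r := by gcongr
          gcongr; linarith
      _ ≤ _ := by gcongr
  have e5 : A * ‖z - κ • ν‖ ^ 3 ≤ A ^ 3 * (2 * r) ^ 3 := by
    have : A ≤ A ^ 3 := le_self_pow₀ hA (by norm_num)
    gcongr
  rw [e1] at t
  nlinarith

theorem minEnergy_le_of_near [CompleteSpace E] (hG : IsSmoothConvex G G' H A) {N : ℕ}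
    (hN : 0 < N) {b m q : E} {p : ℕ → E} (hp : p ∈ polygons {x | G x = 1} N b m)
    (hmin : polyEnergy N p = minEnergy {x | G x = 1} N b m) {σ : ℝ} (hσ : σ ≤ 1)
    (hpσ : ∀ i < N, ‖p (i + 1) - p i‖ ≤ σ) (hq : G q = 1) (hr : 6 * A ^ 2 * ‖q - b‖ ≤ 1) :
    minEnergy {x | G x = 1} N q m ≤ minEnergy {x | G x = 1} N b m +
      ⟪-((2 * N : ℝ) • (p 1 - p 0)), q - b⟫_ℝ + ‖q - b‖ ^ 2 +
      (N * (4 * A ^ 4 * σ ^ 2) + N ^ 2 * (25 * A ^ 8 * σ ^ 3)) * ‖q - b‖ ^ 2 +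
      N ^ 2 * (184 * A ^ 6) * ‖q - b‖ ^ 3 := by
  have hA := hG.one_le
  have hNr : (0 : ℝ) < N := by exact_mod_cast hN
  set r := ‖q - b‖ with hrd
  have hr0 : 0 ≤ r := norm_nonneg _
  have hr6 : r ≤ 1 / 6 := by
    have : 1 ≤ A ^ 2 := one_le_pow₀ hA
    nlinarith
  have hp1 : ∀ i, G (p i) = 1 := hp.2.2
  have hσ0 : 0 ≤ σ := (norm_nonneg _).trans (hpσ 0 hN)
  set ν : ℕ → E := fun i => ‖G' (p i)‖⁻¹ • G' (p i) with hν
  have hν1 : ∀ i, ‖ν i‖ = 1 := fun i => by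
    simp only [hν]
    rw [norm_smul, norm_inv, norm_norm, inv_mul_cancel₀ (hG.grad_norm_pos (hp1 i)).ne']
  have hgν : ∀ i, G' (p i) = ‖G' (p i)‖ • ν i := fun i => by
    simp only [hν]
    rw [smul_smul, mul_inv_cancel₀ (hG.grad_norm_pos (hp1 i)).ne', one_smul]
  have hνs : ∀ (c : ℝ) i, ‖c • ν i‖ = |c| := fun c i => by
    rw [norm_smul, hν1, mul_one, Real.norm_eq_abs]
  obtain ⟨lam, hlam0, hlam⟩ : ∃ lam : ℕ → ℝ, lam 0 = 0 ∧ ∀ i, i + 1 < N →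
      (p (i + 2) - p (i + 1)) - (p (i + 1) - p i) = -(lam (i + 1) • G' (p (i + 1))) := by
    have : ∀ i, ∃ l : ℝ, i + 1 < N →
        (p (i + 2) - p (i + 1)) - (p (i + 1) - p i) = -(l • G' (p (i + 1))) := fun i => by
      by_cases hi : i + 1 < N
      · obtain ⟨l, hl⟩ := hG.exists_multiplier hp hmin hi
        exact ⟨l, fun _ => hl⟩
      · exact ⟨0, fun h => absurd h hi⟩
    choose f hf using this
    exact ⟨fun j => Nat.casesOn j 0 f, rfl, hf⟩
  have hlamb : ∀ i < N, 0 ≤ lam i ∧ lam i ≤ 4 * A ^ 3 := by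
    intro i hi
    cases i with
    | zero => rw [hlam0]; exact ⟨le_rfl, by positivity⟩
    | succ k =>
      have h1 := hG.multiplier_le (x := p (k + 1)) (v := p (k + 2) - p (k + 1))
        (v' := p (k + 1) - p k) (hp1 _) (by rw [add_sub_cancel]; exact hp1 _)
        (by rw [sub_sub_cancel]; exact hp1 _) (hlam k hi)
        ((hpσ _ hi).trans hσ) ((hpσ _ (by omega)).trans hσ)
      refine ⟨h1.1, h1.2.trans ?_⟩
      have h2 : ‖p (k + 2) - p (k + 1)‖ ^ 2 + ‖p (k + 1) - p k‖ ^ 2 ≤ 1 ^ 2 + 1 ^ 2 := by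
        have a1 := (hpσ (k + 1) hi).trans hσ
        have a2 := (hpσ k (by omega)).trans hσ
        gcongr
      calc _ ≤ 2 * A ^ 3 * (1 ^ 2 + 1 ^ 2) := by gcongr
        _ = _ := by ring
  -- the tangential part of `q - b`
  set κ₀ := -⟪q - b, ν 0⟫_ℝ with hκ₀
  set w₀ := (q - b) - ⟪q - b, ν 0⟫_ℝ • ν 0 with hw₀
  have hw₀r : ‖w₀‖ ≤ r := norm_sub_inner_smul_le (hν1 0)
  have hκ₀b : 0 ≤ κ₀ ∧ κ₀ ≤ 6 * A ^ 2 * r ^ 2 := by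
    have hqb : G (b + (q - b)) = 1 := by rw [add_sub_cancel]; exact hq
    have hGb : G b = 1 := by rw [← hp.1]; exact hp1 0
    have i1 := hG.inner_grad_nonpos hGb hqb
    have i2 := hG.neg_inner_grad_le hGb hqb (by linarith)
    have i3 := hG.le_grad b hGb
    have i4 := hG.grad_norm_pos hGb
    have e1 : ⟪G' b, q - b⟫_ℝ = -(‖G' b‖ * κ₀) := by
      have := hgν 0
      rw [hp.1] at this
      rw [hκ₀]
      nth_rewrite 1 [this]
      rw [real_inner_smul_left, real_inner_comm]; ring
    rw [e1] at i1 i2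
    have hκp : 0 ≤ κ₀ := by
      have : 0 ≤ ‖G' b‖ * κ₀ := by linarith
      exact nonneg_of_mul_nonneg_right this i4
    refine ⟨hκp, ?_⟩
    calc κ₀ ≤ κ₀ * (A * ‖G' b‖) := le_mul_of_one_le_right hκp i3
      _ = A * (‖G' b‖ * κ₀) := by ring
      _ ≤ A * (2 * A * r ^ 2) := by
          have : ‖G' b‖ * κ₀ ≤ 2 * A * r ^ 2 := by linarith
          gcongr
      _ ≤ 6 * A ^ 2 * r ^ 2 := by nlinarith [mul_nonneg (sq_nonneg A) (sq_nonneg r)]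
  set w := transport ν w₀ with hw
  have hwr : ∀ i, ‖w i‖ ≤ r := fun i => (norm_transport_le hν1 w₀ i).trans hw₀r
  have hwν : ∀ i, ⟪ν i, w i⟫_ℝ = 0 := inner_transport hν1 (inner_sub_inner_smul (hν1 0))
  have hwg : ∀ i, ⟪G' (p i), w i⟫_ℝ = 0 := fun i => by
    rw [hgν, real_inner_smul_left, hwν, mul_zero]
  set a : ℕ → ℝ := fun i => max (1 - i / N) 0 with ha
  have ha0 : ∀ i, 0 ≤ a i := fun i => le_max_right _ _
  have ha1 : ∀ i, a i ≤ 1 := fun i => max_le (by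
    have : (0 : ℝ) ≤ i / N := by positivity
    linarith) zero_le_one
  have haN : ∀ i, N ≤ i → a i = 0 := fun i hi => by
    refine max_eq_right ?_
    have : (1 : ℝ) ≤ i / N := by
      rw [le_div_iff₀ hNr, one_mul]; exact_mod_cast hi
    linarith
  have hastep : ∀ i < N, a (i + 1) = a i - 1 / N := fun i hi => by
    have h1 : ((i : ℝ) + 1) / N ≤ 1 := by
      rw [div_le_one hNr]; exact_mod_cast hi
    have h2 : (i : ℝ) / N ≤ 1 := by
      rw [div_le_one hNr]; exact_mod_cast hi.le
    simp only [ha]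
    push_cast
    rw [max_eq_left (by linarith), max_eq_left (by linarith)]
    ring
  have hZr : ∀ i, ‖a i • w i‖ ≤ r := fun i => by
    rw [norm_smul, Real.norm_eq_abs, abs_of_nonneg (ha0 i)]
    exact (mul_le_of_le_one_left (norm_nonneg _) (ha1 i)).trans (hwr i)
  have hκ : ∀ i, ∃ κ : ℝ, (0 ≤ κ ∧ κ ≤ 6 * A ^ 2 * r ^ 2) ∧
      G (p i + (a i • w i - κ • ν i)) = 1 ∧ (i = 0 → κ = κ₀) ∧ (N ≤ i → κ = 0) := by
    intro i
    rcases Nat.eq_zero_or_pos i with rfl | hi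
    · refine ⟨κ₀, hκ₀b, ?_, fun _ => rfl, fun h => by omega⟩
      have : a 0 = 1 := by simp [ha]
      rw [this, hw, hp.1]
      simp only [transport, hw₀, hκ₀, one_smul, neg_smul, sub_neg_eq_add, sub_add_cancel,
        add_sub_cancel]
      exact hq
    · by_cases hiN : N ≤ i
      · refine ⟨0, ⟨le_rfl, by positivity⟩, ?_, fun h => by omega, fun _ => rfl⟩
        simpa [haN i hiN] using hp1 i
      · obtain ⟨κ, h1, h2, h3⟩ := hG.exists_normal_displacement (hp1 i) (z := a i • w i)
          (by rw [real_inner_smul_right, hwg, mul_zero]) (hZr i) hr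
        exact ⟨κ, ⟨h1, h2⟩, h3, fun h => by omega, fun h => absurd h hiN⟩
  choose κ hκb hκG hκ0 hκN using hκ
  set Y : ℕ → E := fun i => a i • w i - κ i • ν i with hY
  have hY0 : Y 0 = q - b := by
    have : a 0 = 1 := by simp [ha]
    simp only [hY]
    rw [this, hκ0 0 rfl, hw]
    simp only [transport, hw₀, hκ₀, one_smul, neg_smul, sub_neg_eq_add, sub_add_cancel]
  have hYN : Y N = 0 := by
    simp only [hY]
    rw [haN N le_rfl, hκN N le_rfl]; simp
  have hc : (fun i => p i + Y i) ∈ polygons {x | G x = 1} N q m := by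
    refine ⟨?_, ?_, hκG⟩
    · simp only [hY0, hp.1, add_sub_cancel]
    · simp only [hYN, hp.2.1, add_zero]
  have hstep : ∀ i < N, ‖Y (i + 1) - Y i‖ ^ 2 + 2 * (lam i * ⟪G' (p i), Y i⟫_ℝ) ≤
      r ^ 2 / N ^ 2 + ((if i = 0 then 4 * A ^ 4 * σ ^ 2 * r ^ 2 else 0) +
        25 * A ^ 8 * σ ^ 3 * r ^ 2) + 184 * A ^ 6 * r ^ 3 := by
    intro i hi
    set t := ⟪w i, ν (i + 1)⟫_ℝ with ht
    have hD : a (i + 1) • w (i + 1) - a i • w i =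
        -((1 / N : ℝ) • w (i + 1)) - (a i * t) • ν (i + 1) := by
      have : w (i + 1) = w i - t • ν (i + 1) := rfl
      rw [hastep i hi, this]
      module
    have hD2 : ‖a (i + 1) • w (i + 1) - a i • w i‖ ^ 2 ≤ r ^ 2 / N ^ 2 + a i ^ 2 * t ^ 2 := by
      rw [hD, norm_sub_sq_real, inner_neg_left, real_inner_smul_left, real_inner_smul_right,
        real_inner_comm, hwν, norm_neg, hνs, norm_smul, Real.norm_eq_abs,
        abs_of_nonneg (by positivity : (0 : ℝ) ≤ 1 / N), sq_abs]
      have := hwr (i + 1)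
      have h2 : (1 / N * ‖w (i + 1)‖) ^ 2 ≤ (1 / N * r) ^ 2 := by gcongr
      have h3 : (1 / N * r) ^ 2 = r ^ 2 / (N : ℝ) ^ 2 := by field_simp
      rw [h3] at h2
      linarith [mul_pow (a i) t 2]
    have hDn : ‖a (i + 1) • w (i + 1) - a i • w i‖ ≤ 2 * r :=
      (norm_sub_le _ _).trans (by linarith [hZr i, hZr (i + 1)])
    have hFn : ‖κ (i + 1) • ν (i + 1) - κ i • ν i‖ ≤ 12 * A ^ 2 * r ^ 2 := by
      refine (norm_sub_le _ _).trans ?_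
      rw [hνs, hνs, abs_of_nonneg (hκb i).1, abs_of_nonneg (hκb (i + 1)).1]
      linarith [(hκb i).2, (hκb (i + 1)).2]
    have hYd : ‖Y (i + 1) - Y i‖ ^ 2 ≤ r ^ 2 / N ^ 2 + a i ^ 2 * t ^ 2 + 72 * A ^ 2 * r ^ 3 := by
      have e : Y (i + 1) - Y i = (a (i + 1) • w (i + 1) - a i • w i) -
          (κ (i + 1) • ν (i + 1) - κ i • ν i) := by simp only [hY]; abel
      set D := a (i + 1) • w (i + 1) - a i • w i
      set F := κ (i + 1) • ν (i + 1) - κ i • ν i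
      have h1 : ‖Y (i + 1) - Y i‖ ≤ ‖D‖ + ‖F‖ := by rw [e]; exact norm_sub_le _ _
      have h2 : ‖Y (i + 1) - Y i‖ ^ 2 ≤ (‖D‖ + ‖F‖) ^ 2 := by gcongr
      have h3 : ‖D‖ * ‖F‖ ≤ (2 * r) * (12 * A ^ 2 * r ^ 2) := by gcongr
      have h4 : ‖F‖ ^ 2 ≤ (12 * A ^ 2 * r ^ 2) ^ 2 := by gcongr
      have h5 : (12 * A ^ 2 * r ^ 2) ^ 2 ≤ 24 * A ^ 2 * r ^ 3 := by
        calc (12 * A ^ 2 * r ^ 2) ^ 2 = (24 * A ^ 2 * r ^ 3) * (6 * A ^ 2 * r) := by ring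
          _ ≤ _ := mul_le_of_le_one_right (by positivity) hr
      linarith
    have hG1 := hG.inner_grad_le_of_displacement (hp1 i) (hν1 i) (hZr i) hr (hκb i).1 (hκb i).2
      (hκG i)
    simp only [map_smul, LinearMap.smul_apply, smul_eq_mul] at hG1
    have hG2 : lam i * ⟪G' (p i), Y i⟫_ℝ ≤
        -(a i ^ 2 * (lam i * H (p i) (w i) (w i)) / 2) + 56 * A ^ 6 * r ^ 3 := by
      have h1 := mul_le_mul_of_nonneg_left hG1 (hlamb i hi).1
      have h2 : lam i * (14 * A ^ 3 * r ^ 3) ≤ (4 * A ^ 3) * (14 * A ^ 3 * r ^ 3) := by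
        have := (hlamb i hi).2
        gcongr
      linarith
    have ht2 : t ^ 2 ≤ lam i * H (p i) (w i) (w i) +
        ((if i = 0 then 4 * A ^ 4 * σ ^ 2 * r ^ 2 else 0) + 25 * A ^ 8 * σ ^ 3 * r ^ 2) := by
      have hg1 := hG.le_grad _ (hp1 (i + 1))
      have hgp := hG.grad_norm_pos (hp1 (i + 1))
      have htg : ⟪w i, G' (p (i + 1))⟫_ℝ = ‖G' (p (i + 1))‖ * t := by
        rw [ht]; nth_rewrite 1 [hgν (i + 1)]; rw [real_inner_smul_right]
      have hpi : p i + (p (i + 1) - p i) = p (i + 1) := add_sub_cancel _ _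
      have hA2 : 1 ≤ A ^ 2 * ‖G' (p (i + 1))‖ ^ 2 := by
        rw [← mul_pow]; exact one_le_pow₀ hg1
      cases i with
      | zero =>
        rw [hlam0, if_pos rfl, zero_mul, zero_add]
        have l1 := hG.norm_grad_sub_le (hp1 0) ((hpσ 0 hN).trans hσ)
        rw [hpi] at l1
        have l2 : |⟪w 0, G' (p (0 + 1))⟫_ℝ| ≤ r * (2 * A * σ) := by
          have : ⟪w 0, G' (p (0 + 1))⟫_ℝ = ⟪w 0, G' (p (0 + 1)) - G' (p 0)⟫_ℝ := by
            rw [inner_sub_right, real_inner_comm (G' (p 0)), hwg 0, sub_zero]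
          rw [this]
          refine (abs_real_inner_le_norm _ _).trans ?_
          have l3 : ‖G' (p (0 + 1)) - G' (p 0)‖ ≤ 2 * A * σ :=
            l1.trans (by have := hpσ 0 hN; gcongr)
          have := hwr 0
          gcongr
        have l4 : ⟪w 0, G' (p (0 + 1))⟫_ℝ ^ 2 ≤ (r * (2 * A * σ)) ^ 2 := by
          rw [← sq_abs]; gcongr
        have l5 : t ^ 2 ≤ A ^ 2 * (r * (2 * A * σ)) ^ 2 := by
          rw [htg] at l4
          calc t ^ 2 ≤ t ^ 2 * (A ^ 2 * ‖G' (p (0 + 1))‖ ^ 2) :=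
                le_mul_of_one_le_right (sq_nonneg _) hA2
            _ = A ^ 2 * (‖G' (p (0 + 1))‖ * t) ^ 2 := by ring
            _ ≤ _ := by gcongr
        have l6 : 0 ≤ 25 * A ^ 8 * σ ^ 3 * r ^ 2 := by positivity
        linarith
      | succ k =>
        rw [if_neg (by omega), zero_add]
        have l1 := hG.inner_grad_sq_le (x := p (k + 1)) (v := p (k + 2) - p (k + 1))
          (v' := p (k + 1) - p k) (w := w (k + 1)) (hp1 _) (by rw [add_sub_cancel]; exact hp1 _)
          (by rw [sub_sub_cancel]; exact hp1 _) (hlam k hi) (hpσ _ hi) (hpσ _ (by omega)) hσ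
          (hwg _)
        rw [add_sub_cancel] at l1
        rw [htg] at l1
        have l2 : 25 * A ^ 6 * σ ^ 3 * ‖w (k + 1)‖ ^ 2 ≤ 25 * A ^ 6 * σ ^ 3 * r ^ 2 := by
          have := hwr (k + 1)
          gcongr
        set g := ‖G' (p (k + 1 + 1))‖
        set h := lam (k + 1) * H (p (k + 1)) (w (k + 1)) (w (k + 1))
        have l3 : g ^ 2 * (t ^ 2 - h) ≤ 25 * A ^ 6 * σ ^ 3 * r ^ 2 := by
          change (g * t) ^ 2 ≤ g ^ 2 * h + _ at l1
          linarith
        rcases le_or_gt (t ^ 2 - h) 0 with h0 | h0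
        · have : 0 ≤ 25 * A ^ 8 * σ ^ 3 * r ^ 2 := by positivity
          linarith
        · have : t ^ 2 - h ≤ A ^ 2 * (25 * A ^ 6 * σ ^ 3 * r ^ 2) := by
            calc t ^ 2 - h ≤ (A ^ 2 * g ^ 2) * (t ^ 2 - h) := le_mul_of_one_le_left h0.le hA2
              _ = A ^ 2 * (g ^ 2 * (t ^ 2 - h)) := by ring
              _ ≤ _ := by gcongr
          linarith
    have ha2 : a i ^ 2 ≤ 1 := pow_le_one₀ (ha0 i) (ha1 i)
    have he0 : 0 ≤ ((if i = 0 then 4 * A ^ 4 * σ ^ 2 * r ^ 2 else 0) +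
        25 * A ^ 8 * σ ^ 3 * r ^ 2) := by
      have : 0 ≤ 4 * A ^ 4 * σ ^ 2 * r ^ 2 := by positivity
      split_ifs <;> positivity
    generalize ((if i = 0 then 4 * A ^ 4 * σ ^ 2 * r ^ 2 else 0) +
        25 * A ^ 8 * σ ^ 3 * r ^ 2) = e at *
    have h3 : a i ^ 2 * t ^ 2 ≤ a i ^ 2 * (lam i * H (p i) (w i) (w i)) + e := by
      have := mul_le_mul_of_nonneg_left ht2 (sq_nonneg (a i))
      have h4 : a i ^ 2 * e ≤ e := mul_le_of_le_one_left he0 ha2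
      linarith
    have h5 : 72 * A ^ 2 * r ^ 3 ≤ 72 * A ^ 6 * r ^ 3 := by
      have : A ^ 2 ≤ A ^ 6 := pow_le_pow_right₀ hA (by norm_num)
      gcongr
    linarith
  refine (minEnergy_le hc).trans ?_
  rw [← hmin]
  have hexp : polyEnergy N (fun i => p i + Y i) = polyEnergy N p +
      N * (2 * ∑ i ∈ Finset.range N, ⟪p (i + 1) - p i, Y (i + 1) - Y i⟫_ℝ +
        ∑ i ∈ Finset.range N, ‖Y (i + 1) - Y i‖ ^ 2) := by
    unfold polyEnergy
    rw [Finset.mul_sum _ _ (2 : ℝ), ← Finset.sum_add_distrib, ← mul_add, ← Finset.sum_add_distrib]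
    congr 1
    refine Finset.sum_congr rfl fun i _ => ?_
    rw [show p (i + 1) + Y (i + 1) - (p i + Y i) = (p (i + 1) - p i) + (Y (i + 1) - Y i) by abel,
      norm_add_sq_real]
    ring
  have habel := sum_inner_sub_eq (N := N) (D := fun i => p (i + 1) - p i) (Y := Y)
    (g := fun i => G' (p i)) hlam0 hlam (N - 1) (by omega)
  rw [Nat.sub_add_cancel hN, hYN, inner_zero_right, hY0] at habel
  rw [hexp, habel]
  have hsum : ∑ i ∈ Finset.range N, (‖Y (i + 1) - Y i‖ ^ 2 + 2 * (lam i * ⟪G' (p i), Y i⟫_ℝ)) ≤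
      r ^ 2 / N + (4 * A ^ 4 * σ ^ 2 * r ^ 2 + N * (25 * A ^ 8 * σ ^ 3 * r ^ 2)) +
        N * (184 * A ^ 6 * r ^ 3) := by
    refine (Finset.sum_le_sum fun i hi => hstep i (Finset.mem_range.1 hi)).trans (le_of_eq ?_)
    rw [Finset.sum_add_distrib, Finset.sum_add_distrib, Finset.sum_add_distrib,
      Finset.sum_ite_eq' (Finset.range N) 0, if_pos (Finset.mem_range.2 hN)]
    simp only [Finset.sum_const, Finset.card_range, nsmul_eq_mul]
    congr 2
    field_simp
  rw [Finset.sum_add_distrib, ← Finset.mul_sum] at hsum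
  have hsum2 := mul_le_mul_of_nonneg_left hsum hNr.le
  have hfin : (N : ℝ) * (r ^ 2 / N) = r ^ 2 := by field_simp
  rw [inner_neg_left, real_inner_smul_left]
  simp only [zero_add] at *
  linarith

end IsSmoothConvex

end SmoothLocal

section SmoothGlobal

variable {E : Type*} [NormedAddCommGroup E] [InnerProductSpace ℝ E]

namespace IsSmoothConvex

variable {G : E → ℝ} {G' : E → E} {H : E → E →ₗ[ℝ] E →ₗ[ℝ] ℝ} {A : ℝ}

theorem norm_edge_le (hG : IsSmoothConvex G G' H A) [CompleteSpace E] {N : ℕ} (hN : 0 < N)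
    {b m : E} {p : ℕ → E} (hp : p ∈ polygons {x | G x = 1} N b m)
    (hmin : polyEnergy N p = minEnergy {x | G x = 1} N b m) {B : ℝ} (hB : polyEnergy N p ≤ B)
    (hNB : 32 * A ^ 4 * B ≤ N) {i : ℕ} (hi : i < N) : ‖p (i + 1) - p i‖ ≤ √(2 * B) / N := by
  have hA := hG.one_le
  have hB0 : 0 ≤ B := (polyEnergy_nonneg N p).trans hB
  have hNr : (0 : ℝ) < N := by exact_mod_cast hN
  have hNB1 : B ≤ N := by
    have : 1 ≤ A ^ 4 := one_le_pow₀ hA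
    nlinarith
  have h1 : ∀ i < N, ‖p (i + 1) - p i‖ ≤ 1 := by
    intro i hi
    have h2 : ‖p (i + 1) - p i‖ ^ 2 ≤ ∑ j ∈ Finset.range N, ‖p (j + 1) - p j‖ ^ 2 :=
      Finset.single_le_sum (f := fun j => ‖p (j + 1) - p j‖ ^ 2) (fun _ _ => by positivity)
        (Finset.mem_range.2 hi)
    have h3 : N * ‖p (i + 1) - p i‖ ^ 2 ≤ N * 1 := by
      calc N * ‖p (i + 1) - p i‖ ^ 2 ≤ polyEnergy N p := by unfold polyEnergy; gcongr
        _ ≤ _ := by linarith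
    have h4 := le_of_mul_le_mul_left h3 hNr
    nlinarith [norm_nonneg (p (i + 1) - p i)]
  have hs := le_of_sum_le_of_abs_sub_le (s := fun i => ‖p (i + 1) - p i‖ ^ 2) (κ := 4 * A ^ 4)
    (B := B) hN (fun _ _ => by positivity) (by positivity) hB (fun j hj => ?_) (by linarith) hi
  · refine le_of_sq_le_sq ?_ (by positivity) 
    rw [div_pow, Real.sq_sqrt (by positivity)]
    exact hs
  · obtain ⟨l, hl⟩ := hG.exists_multiplier hp hmin hj
    exact hG.abs_sq_sub_sq_le (x := p (j + 1)) (v := p (j + 2) - p (j + 1))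
      (v' := p (j + 1) - p j) (hp.2.2 _) (by rw [add_sub_cancel]; exact hp.2.2 _)
      (by rw [sub_sub_cancel]; exact hp.2.2 _) hl (h1 _ hj) (h1 _ (by omega))

theorem exists_local_upper [CompleteSpace E] (hG : IsSmoothConvex G G' H A)
    (hX : IsCompact {x | G x = 1}) {B : ℝ} (hB : 0 ≤ B) :
    ∃ N₀ : ℕ, 0 < N₀ ∧ ∀ N ≥ N₀, ∀ b m, G b = 1 → G m = 1 →
      minEnergy {x | G x = 1} N b m ≤ B →
      ∃ u : E, ‖u‖ ≤ 2 * √(2 * B) ∧ ∀ᶠ q in 𝓝[{x | G x = 1}] b,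
        minEnergy {x | G x = 1} N q m ≤
          minEnergy {x | G x = 1} N b m + ⟪u, q - b⟫_ℝ + 3 * ‖q - b‖ ^ 2 := by
  have hA := hG.one_le
  set D := √(2 * B) with hD
  have hD0 : 0 ≤ D := Real.sqrt_nonneg _
  have hD2 : D ^ 2 = 2 * B := Real.sq_sqrt (by positivity)
  obtain ⟨N₀, hN₀⟩ := exists_nat_ge (32 * A ^ 4 * B + D + (8 * A ^ 4 * B + 25 * A ^ 8 * D ^ 3) + 1)
  have t1 : 0 ≤ 32 * A ^ 4 * B := by positivity
  have t2 : 0 ≤ 8 * A ^ 4 * B + 25 * A ^ 8 * D ^ 3 := by positivity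
  refine ⟨N₀, by have : (0 : ℝ) < N₀ := by linarith
                 exact_mod_cast this, fun N hN b m hb hm hBm => ?_⟩
  have hNN : (N₀ : ℝ) ≤ N := by exact_mod_cast hN
  have hNr : (0 : ℝ) < N := by linarith
  have hNp : 0 < N := by exact_mod_cast hNr
  obtain ⟨p, hp, hmin⟩ := exists_polyEnergy_eq_minEnergy hX hNp hb hm
  have hedge := fun i hi => hG.norm_edge_le hNp hp hmin (hmin.le.trans hBm) (by linarith) (i := i) hi
  rw [← hD] at hedge
  refine ⟨-((2 * N : ℝ) • (p 1 - p 0)), ?_, ?_⟩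
  · rw [norm_neg, norm_smul, Real.norm_eq_abs, abs_of_nonneg (by positivity)]
    have := hedge 0 hNp
    calc 2 * N * ‖p 1 - p 0‖ ≤ 2 * N * (D / N) := by gcongr
      _ = 2 * D := by field_simp
  · have hc : 0 < 6 * A ^ 2 + N ^ 2 * (184 * A ^ 6) := by positivity
    have hnear : ∀ᶠ q in 𝓝[{x | G x = 1}] b, ‖q - b‖ < 1 / (6 * A ^ 2 + N ^ 2 * (184 * A ^ 6)) := by
      refine mem_nhdsWithin_of_mem_nhds ?_
      filter_upwards [Metric.ball_mem_nhds b (by positivity :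
        0 < 1 / (6 * A ^ 2 + N ^ 2 * (184 * A ^ 6)))] with q hq
      rwa [mem_ball_iff_norm] at hq
    filter_upwards [hnear, self_mem_nhdsWithin] with q hq hqX
    rw [lt_div_iff₀ hc] at hq
    have hr0 := norm_nonneg (q - b)
    have k1 : 0 ≤ A ^ 2 * ‖q - b‖ := by positivity
    have k2 : 0 ≤ N ^ 2 * (184 * A ^ 6) * ‖q - b‖ := by positivity
    have h := hG.minEnergy_le_of_near hNp hp hmin (σ := D / N)
      (by rw [div_le_one hNr]; linarith) hedge hqX (by linarith)
    have h2 : N * (4 * A ^ 4 * (D / N) ^ 2) + N ^ 2 * (25 * A ^ 8 * (D / N) ^ 3) ≤ 1 := by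
      have : N * (4 * A ^ 4 * (D / N) ^ 2) + N ^ 2 * (25 * A ^ 8 * (D / N) ^ 3) =
          (4 * A ^ 4 * D ^ 2 + 25 * A ^ 8 * D ^ 3) / N := by field_simp
      rw [this, div_le_one hNr, hD2]
      linarith
    have h3 : (N * (4 * A ^ 4 * (D / N) ^ 2) + N ^ 2 * (25 * A ^ 8 * (D / N) ^ 3)) *
        ‖q - b‖ ^ 2 ≤ 1 * ‖q - b‖ ^ 2 := by gcongr
    have h4 : N ^ 2 * (184 * A ^ 6) * ‖q - b‖ ^ 3 ≤ 1 * ‖q - b‖ ^ 2 := by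
      calc N ^ 2 * (184 * A ^ 6) * ‖q - b‖ ^ 3 =
          (N ^ 2 * (184 * A ^ 6) * ‖q - b‖) * ‖q - b‖ ^ 2 := by ring
        _ ≤ _ := by gcongr; linarith
    linarith

theorem gauge_support (hG : IsSmoothConvex G G' H A) {ρ R : ℝ} (hρ : 0 < ρ) (h0 : G 0 < 1)
    (hball : Metric.ball 0 ρ ⊆ {x | G x ≤ 1}) (hR : ∀ x, G x ≤ 1 → ‖x‖ ≤ R)
    (hconv : Convex ℝ {x | G x ≤ 1}) :
    IsGaugeWithSupport (gauge {x | G x ≤ 1}) ρ R ∧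
      ∀ x, gauge {x | G x ≤ 1} x = 1 ↔ G x = 1 := by
  set K := {x | G x ≤ 1} with hK
  have hKn : K ∈ 𝓝 (0 : E) := Filter.mem_of_superset (Metric.ball_mem_nhds 0 hρ) hball
  have habs : Absorbent ℝ K := absorbent_nhds_zero hKn
  have hle : ∀ x, gauge K x ≤ ‖x‖ / ρ := fun x => by
    rw [le_div_iff₀ hρ, mul_comm]; exact mul_gauge_le_norm hball
  have hsup : ∀ b, G b = 1 → ∃ n : E, ‖n‖ ≤ 1 / ρ ∧ ⟪n, b⟫_ℝ = 1 ∧ ∀ x, ⟪n, x⟫_ℝ ≤ gauge K x := by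
    intro b hb
    have hpos : 0 < ⟪G' b, b⟫_ℝ := by
      have := hG.le b 0
      rw [zero_sub, inner_neg_right] at this
      linarith
    set n := (⟪G' b, b⟫_ℝ)⁻¹ • G' b with hn
    have hnK : ∀ x ∈ K, ⟪n, x⟫_ℝ ≤ 1 := fun x hx => by
      have := hG.le b x
      have hx : G x ≤ 1 := hx
      rw [inner_sub_right] at this
      rw [hn, real_inner_smul_left, inv_mul_le_iff₀ hpos]
      linarith
    have hnle : ∀ x, ⟪n, x⟫_ℝ ≤ gauge K x := fun x => by
      refine le_of_forall_gt_imp_ge_of_dense fun a ha => ?_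
      obtain ⟨r, hr0, hra, y, hy, rfl⟩ := exists_lt_of_gauge_lt habs ha
      simp only [real_inner_smul_right]
      nlinarith [hnK y hy]
    refine ⟨n, ?_, ?_, hnle⟩
    · have h1 := (hnle n).trans (hle n)
      rw [real_inner_self_eq_norm_sq] at h1
      rcases (norm_nonneg n).eq_or_lt with h | h
      · rw [← h]; positivity
      · rw [le_div_iff₀ hρ] at h1 ⊢
        refine le_of_mul_le_mul_left ?_ h
        linarith
    · rw [hn, real_inner_smul_left, inv_mul_cancel₀ hpos.ne']
  have hiff : ∀ x, gauge K x = 1 ↔ G x = 1 := by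
    intro x
    constructor
    · intro h
      have := (gauge_eq_one_iff_mem_frontier hconv hKn).1 h
      exact frontier_le_subset_eq hG.continuous continuous_const this
    · intro h
      obtain ⟨n, -, hn, hnle⟩ := hsup x h
      refine le_antisymm (gauge_le_one_of_mem (show G x ≤ 1 from h.le)) ?_
      rw [← hn]; exact hnle x
  refine ⟨⟨fun x y => gauge_add_le hconv habs x y,
    fun t x ht => by rw [gauge_smul_of_nonneg ht, smul_eq_mul], hle,
    fun x hx => hR x ((hiff x).1 hx).le, fun b hb => hsup b ((hiff b).1 hb)⟩, hiff⟩

theorem exists_joint_upper [CompleteSpace E] (ρ R B : ℝ) (hρ : 0 < ρ) (hR0 : 0 ≤ R) (hB : 0 ≤ B) :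
    ∃ M C : ℝ, 0 ≤ M ∧ 0 ≤ C ∧ ∀ (G : E → ℝ) (G' : E → E) (H : E → E →ₗ[ℝ] E →ₗ[ℝ] ℝ) (A : ℝ),
      IsSmoothConvex G G' H A → G 0 < 1 → Metric.ball 0 ρ ⊆ {x | G x ≤ 1} →
      (∀ x, G x ≤ 1 → ‖x‖ ≤ R) → Convex ℝ {x | G x ≤ 1} → IsCompact {x | G x = 1} →
      (∀ N : ℕ, 0 < N → ∀ a b, G a = 1 → G b = 1 → minEnergy {x | G x = 1} N a b ≤ B) →
      ∃ N₀ : ℕ, 0 < N₀ ∧ ∀ N ≥ N₀, ∀ b₁ b₂, G b₁ = 1 → G b₂ = 1 →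
        ∃ u₁ u₂ : E, ‖u₁‖ ≤ M ∧ ‖u₂‖ ≤ M ∧ ∀ q₁ q₂, G q₁ = 1 → G q₂ = 1 →
          minEnergy {x | G x = 1} (N + N) q₁ q₂ ≤ minEnergy {x | G x = 1} (N + N) b₁ b₂ +
            ⟪u₁, q₁ - b₁⟫_ℝ + ⟪u₂, q₂ - b₂⟫_ℝ + C * (‖q₁ - b₁‖ ^ 2 + ‖q₂ - b₂‖ ^ 2) := by
  obtain ⟨M, C, hM, hC, key⟩ := semiconcave_of_locally (E := E) ρ R (2 * √(2 * B)) 3 B hρ hR0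
    (by positivity) (by norm_num) hB
  refine ⟨2 * M, 2 * C, by positivity, by positivity, ?_⟩
  intro G G' H A hG h0 hball hR hconv hX hEB
  obtain ⟨N₀, hN₀, hloc⟩ := hG.exists_local_upper hX hB
  obtain ⟨hgs, hiff⟩ := hG.gauge_support hρ h0 hball hR hconv
  refine ⟨N₀, hN₀, fun N hN b₁ b₂ hb₁ hb₂ => ?_⟩
  have hNp : 0 < N := hN₀.trans_le hN
  obtain ⟨m, hm, hmid⟩ := exists_midpoint_minEnergy hX hNp (a := b₁) (b := b₂) hb₁ hb₂
  have hset : {x | gauge {x | G x ≤ 1} x = 1} = {x | G x = 1} := Set.ext hiff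
  have hone : ∀ b, G b = 1 → ∃ u : E, ‖u‖ ≤ M ∧ ∀ q, G q = 1 →
      minEnergy {x | G x = 1} N q m ≤ minEnergy {x | G x = 1} N b m + ⟪u, q - b⟫_ℝ +
        C * ‖q - b‖ ^ 2 := by
    intro b hb
    obtain ⟨u, hu, h⟩ := key _ (fun q => minEnergy {x | G x = 1} N q m) hgs
      (by rw [hset]; exact continuousOn_minEnergy hX hNp hm)
      (fun x hx => ⟨minEnergy_nonneg _ _ _ _, hEB N hNp x m ((hiff x).1 hx) hm⟩)
      (fun x hx => by
        rw [hset]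
        exact hloc N hN x m ((hiff x).1 hx) hm (hEB N hNp x m ((hiff x).1 hx) hm))
      b ((hiff b).2 hb)
    exact ⟨u, hu, fun q hq => h q ((hiff q).2 hq)⟩
  obtain ⟨u₁, hu₁, h₁⟩ := hone b₁ hb₁
  obtain ⟨u₂, hu₂, h₂⟩ := hone b₂ hb₂
  refine ⟨(2 : ℝ) • u₁, (2 : ℝ) • u₂, by rw [norm_smul]; norm_num; exact hu₁,
    by rw [norm_smul]; norm_num; exact hu₂, fun q₁ q₂ hq₁ hq₂ => ?_⟩
  have h3 := minEnergy_add_self_le hX hNp (a := q₁) (m := m) (b := q₂) hq₁ hm hq₂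
  rw [minEnergy_symm _ _ m q₂] at h3
  rw [minEnergy_symm _ _ m b₂] at hmid
  rw [real_inner_smul_left, real_inner_smul_left]
  linarith [h₁ q₁ hq₁, h₂ q₂ hq₂]

end IsSmoothConvex

end SmoothGlobal

section CurveDist

open scoped ENNReal

variable {E : Type*} [NormedAddCommGroup E]

/-- The intrinsic distance as an extended nonnegative real number. -/
noncomputable def curveDist (X : Set E) (a b : E) : ℝ≥0∞ :=
  ⨅ γ : {γ : ℝ → E // ContinuousOn γ (Set.Icc 0 1) ∧ γ 0 = a ∧ γ 1 = b ∧
      Set.MapsTo γ (Set.Icc 0 1) X},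
    eVariationOn γ.1 (Set.Icc 0 1)

theorem curveDist_le {X : Set E} {γ : ℝ → E} {a b : E} (hc : ContinuousOn γ (Icc 0 1))
    (h0 : γ 0 = a) (h1 : γ 1 = b) (hX : MapsTo γ (Icc 0 1) X) :
    curveDist X a b ≤ eVariationOn γ (Icc 0 1) :=
  iInf_le_of_le ⟨γ, hc, h0, h1, hX⟩ le_rfl

theorem curveDist_comm (X : Set E) (a b : E) : curveDist X a b = curveDist X b a := by
  have key : ∀ a b : E, curveDist X a b ≤ curveDist X b a := by
    intro a b
    refine le_iInf ?_
    rintro ⟨γ, hc, h0, h1, hX⟩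
    have hm : MapsTo (fun t : ℝ => 1 - t) (Icc 0 1) (Icc 0 1) := by
      intro t ht
      simp only [mem_Icc] at ht ⊢
      constructor <;> linarith [ht.1, ht.2]
    refine (curveDist_le (γ := γ ∘ fun t => 1 - t) ?_ ?_ ?_ (hX.comp hm)).trans ?_
    · exact hc.comp (by fun_prop) hm
    · simpa using h1
    · simpa using h0
    · exact eVariationOn.comp_le_of_antitoneOn γ _ (fun x _ y _ hxy => by linarith) hm
  exact le_antisymm (key a b) (key b a)

theorem curveDist_triangle (X : Set E) (a b c : E) :
    curveDist X a c ≤ curveDist X a b + curveDist X b c := by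
  refine ENNReal.le_iInf_add_iInf ?_
  rintro ⟨γ, hc, h0, h1, hX⟩ ⟨δ, dc, d0, d1, dX⟩
  dsimp only
  obtain ⟨w, hw⟩ : ∃ w : ℝ → E, ∀ t, w t = if t ≤ 1 / 2 then γ (2 * t) else δ (2 * t - 1) :=
    ⟨_, fun t => rfl⟩
  have e1 : EqOn w (γ ∘ fun t => 2 * t) (Icc 0 (1 / 2)) := by
    intro t ht
    rw [hw, if_pos ht.2]; rfl
  have e2 : EqOn w (δ ∘ fun t => 2 * t - 1) (Icc (1 / 2) 1) := by
    intro t ht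
    rw [hw]
    rcases eq_or_lt_of_le ht.1 with h | h
    · subst h; norm_num [h1, d0]
    · rw [if_neg (not_le.2 h)]; rfl
  have m1 : MapsTo (fun t : ℝ => 2 * t) (Icc 0 (1 / 2)) (Icc 0 1) := fun t ht =>
    ⟨by linarith [ht.1], by linarith [ht.2]⟩
  have m2 : MapsTo (fun t : ℝ => 2 * t - 1) (Icc (1 / 2) 1) (Icc 0 1) := fun t ht =>
    ⟨by linarith [ht.1], by linarith [ht.2]⟩
  have hun : Icc (0 : ℝ) 1 = Icc 0 (1 / 2) ∪ Icc (1 / 2) 1 := by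
    rw [Icc_union_Icc_eq_Icc] <;> norm_num
  refine (curveDist_le (γ := w) ?_ ?_ ?_ ?_).trans ?_
  · rw [hun]
    refine ContinuousOn.union_of_isClosed ?_ ?_ isClosed_Icc isClosed_Icc
    · exact (hc.comp (by fun_prop) m1).congr e1
    · exact (dc.comp (by fun_prop) m2).congr e2
  · rw [hw]; norm_num [h0]
  · rw [hw]; norm_num [d1]
  · rw [hun]
    refine MapsTo.union ?_ ?_
    · exact (hX.comp m1).congr e1.symm
    · exact (dX.comp m2).congr e2.symm
  · have := eVariationOn.Icc_add_Icc w
      (s := univ) (a := 0) (b := 1 / 2) (c := 1) (by norm_num) (by norm_num) (mem_univ _)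
    simp only [univ_inter] at this
    rw [← this, eVariationOn.eq_of_eqOn e1, eVariationOn.eq_of_eqOn e2]
    exact add_le_add
      (eVariationOn.comp_le_of_monotoneOn γ _ (fun x _ y _ hxy => by linarith) m1)
      (eVariationOn.comp_le_of_monotoneOn δ _ (fun x _ y _ hxy => by linarith) m2)

theorem curveDist_map_le {F : Type*} [NormedAddCommGroup F] {S : Set E}
    {X : Set F} {T : E → F} {C : ℝ≥0} (hC : C ≠ 0) (hT : LipschitzOnWith C T S) (hm : MapsTo T S X) (a b : E) :
    curveDist X (T a) (T b) ≤ C * curveDist S a b := by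
  unfold curveDist
  rw [ENNReal.mul_iInf_of_ne (by simpa using hC) (by simp)]
  refine le_iInf ?_
  rintro ⟨γ, hc, h0, h1, hS⟩
  refine (curveDist_le (γ := T ∘ γ) (hT.continuousOn.comp hc hS) (by simp [h0]) (by simp [h1])
    (hm.comp hS)).trans ?_
  exact hT.comp_eVariationOn_le hS

variable [NormedSpace ℝ E] in
theorem curveDist_le_of_segment {S : Set E} {a b : E} (h : segment ℝ a b ⊆ S) :
    curveDist S a b ≤ ENNReal.ofReal ‖a - b‖ := by
  have h1 : LipschitzWith ‖b - a‖₊ (fun t : ℝ => a + t • (b - a)) := by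
    refine LipschitzWith.of_dist_le_mul fun s t => ?_
    rw [dist_eq_norm, dist_eq_norm, add_sub_add_left_eq_sub, ← sub_smul, norm_smul, mul_comm]
    simp
  have hm : MapsTo (fun t : ℝ => a + t • (b - a)) (Icc 0 1) S := by
    intro t ht
    exact h (by rw [segment_eq_image']; exact ⟨t, ht, rfl⟩)
  refine (curveDist_le h1.continuous.continuousOn (by simp) (by simp) hm).trans ?_
  have := (h1.lipschitzOnWith (s := Icc (0 : ℝ) 1)).comp_eVariationOn_le (g := id) (s := Icc 0 1)
    (mapsTo_id _)
  rw [eVariationOn_id_Icc] at this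
  simp only [Function.comp_id, sub_zero, ENNReal.ofReal_one, mul_one] at this
  refine this.trans (le_of_eq ?_)
  rw [norm_sub_rev, ofReal_norm]; rfl

variable [NormedSpace ℝ E] in
theorem curveDist_sum_le {S : Set E} {N : ℕ} (p : ℕ → E)
    (h : ∀ i < N, segment ℝ (p i) (p (i + 1)) ⊆ S) (h0 : p 0 ∈ S) :
    curveDist S (p 0) (p N) ≤ ENNReal.ofReal (∑ i ∈ Finset.range N, ‖p (i + 1) - p i‖) := by
  induction N with
  | zero =>
    refine (curveDist_le_of_segment (by simpa using h0)).trans (by simp)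
  | succ N ih =>
    refine (curveDist_triangle S _ (p N) _).trans ?_
    rw [Finset.sum_range_succ, ENNReal.ofReal_add (by positivity) (by positivity)]
    refine add_le_add (ih fun i hi => h i (by omega)) ?_
    rw [norm_sub_rev]
    exact curveDist_le_of_segment (h N (by omega))

theorem minEnergy_le_sq_of_curveDist_lt {X : Set E} {a b : E} {V : ℝ}
    (hV : curveDist X a b < ENNReal.ofReal V) {N : ℕ} (hN : 0 < N) :
    minEnergy X N a b ≤ V ^ 2 := by
  obtain ⟨⟨γ, hc, h0, h1, hX⟩, hγ⟩ := iInf_lt_iff.1 hV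
  dsimp only at hγ
  have hV0 : 0 < V := by
    by_contra hcon
    rw [ENNReal.ofReal_of_nonpos (not_lt.1 hcon)] at hγ
    exact not_lt_bot hγ
  have hNr : (0 : ℝ) < N := by exact_mod_cast hN
  have hstep : ∀ s ∈ Icc (0 : ℝ) 1, ∃ t ∈ Icc (0 : ℝ) 1, s ≤ t ∧ ‖γ t - γ s‖ ≤ V / N ∧
      (t = 1 ∨ ‖γ t - γ s‖ = V / N) := by
    intro s hs
    rcases le_or_gt (‖γ 1 - γ s‖) (V / N) with h | h
    · exact ⟨1, by simp, hs.2, h, Or.inl rfl⟩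
    · have hcs : ContinuousOn (fun t => ‖γ t - γ s‖) (Icc s 1) :=
        ((hc.mono (Icc_subset_Icc_left hs.1)).sub continuousOn_const).norm
      obtain ⟨t, ht, he⟩ := intermediate_value_Icc hs.2 hcs
        (show V / N ∈ Icc _ _ from ⟨by simp; positivity, h.le⟩)
      exact ⟨t, ⟨hs.1.trans ht.1, ht.2⟩, ht.1, le_of_eq he, Or.inr he⟩
  choose! nx hnx hle hnorm hor using hstep
  set t : ℕ → ℝ := fun i => nx^[i] 0 with ht
  have ht1 : ∀ i, t (i + 1) = nx (t i) := fun i => Function.iterate_succ_apply' nx i 0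
  have htm : ∀ i, t i ∈ Icc (0 : ℝ) 1 := by
    intro i
    induction i with
    | zero => simp [ht]
    | succ i ih => rw [ht1]; exact hnx _ ih
  have hmono : Monotone t := monotone_nat_of_le_succ fun i => by rw [ht1]; exact hle _ (htm i)
  have hend : t N = 1 := by
    by_contra hcon
    have hne : ∀ i < N, ‖γ (t (i + 1)) - γ (t i)‖ = V / N := by
      intro i hi
      rw [ht1]
      refine (hor _ (htm i)).resolve_left fun h => hcon ?_
      have h2 : t (i + 1) ≤ t N := hmono (by omega)
      rw [ht1, h] at h2
      exact le_antisymm (htm N).2 h2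
    have hs := eVariationOn.sum_le (f := γ) (s := Icc 0 1) (n := N) hmono htm
    have he : ∑ i ∈ Finset.range N, edist (γ (t (i + 1))) (γ (t i)) = ENNReal.ofReal V := by
      have : ∀ i ∈ Finset.range N, edist (γ (t (i + 1))) (γ (t i)) = ENNReal.ofReal (V / N) := by
        intro i hi
        rw [edist_dist, dist_eq_norm, hne i (Finset.mem_range.1 hi)]
      rw [Finset.sum_congr rfl this, Finset.sum_const, Finset.card_range, nsmul_eq_mul,
        ← ENNReal.ofReal_natCast, ← ENNReal.ofReal_mul hNr.le, mul_div_cancel₀ _ hNr.ne']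
    rw [he] at hs
    exact absurd hγ (not_lt.2 hs)
  refine (minEnergy_le (p := fun i => γ (t i)) ⟨by simp [ht, h0], by simp [hend, h1],
    fun i => hX (htm i)⟩).trans ?_
  unfold polyEnergy
  have hs : ∑ i ∈ Finset.range N, ‖γ (t (i + 1)) - γ (t i)‖ ^ 2 ≤
      ∑ i ∈ Finset.range N, (V / N) ^ 2 := by
    refine Finset.sum_le_sum fun i _ => pow_le_pow_left₀ (norm_nonneg _) ?_ 2
    rw [ht1]; exact hnorm _ (htm i)
  rw [Finset.sum_const, Finset.card_range, nsmul_eq_mul] at hs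
  calc (N : ℝ) * _ ≤ N * (N * (V / N) ^ 2) := mul_le_mul_of_nonneg_left hs hNr.le
    _ = V ^ 2 := by field_simp

theorem curveDist_preimage_add (X : Set E) (v a b : E) :
    curveDist ((v + ·) ⁻¹' X) a b = curveDist X (v + a) (v + b) := by
  refine le_antisymm ?_ ?_
  · have h := curveDist_map_le (C := 1) (T := (-v + ·)) (S := X) (X := (v + ·) ⁻¹' X) one_ne_zero
      (LipschitzWith.of_dist_le_mul fun x y => by simp).lipschitzOnWith
      (fun x hx => by simpa using hx) (v + a) (v + b)
    simpa using h
  · have h := curveDist_map_le (C := 1) (T := (v + ·)) (S := (v + ·) ⁻¹' X) (X := X) one_ne_zero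
      (LipschitzWith.of_dist_le_mul fun x y => by simp).lipschitzOnWith
      (fun x hx => hx) a b
    simpa using h

end CurveDist

section Projection

open scoped ENNReal

variable {E : Type*} [NormedAddCommGroup E] [InnerProductSpace ℝ E]

theorem exists_metric_projection {K : Set E} (hK : IsCompact K) (hc : Convex ℝ K)
    (hne : K.Nonempty) :
    ∃ P : E → E, LipschitzWith 1 P ∧ (∀ x, P x ∈ K) ∧ (∀ x ∈ K, P x = x) ∧
      (∀ x, ∀ y ∈ K, ‖x - P x‖ ≤ ‖x - y‖) := by
  choose P hPK hP using fun x => exists_norm_eq_iInf_of_complete_convex hne hK.isComplete hc x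
  have hvar : ∀ x, ∀ w ∈ K, ⟪x - P x, w - P x⟫_ℝ ≤ 0 := fun x =>
    (norm_eq_iInf_iff_real_inner_le_zero hc (hPK x)).1 (hP x)
  have hmin : ∀ x, ∀ y ∈ K, ‖x - P x‖ ≤ ‖x - y‖ := by
    intro x y hy
    rw [hP]
    exact ciInf_le ⟨0, by rintro _ ⟨w, rfl⟩; exact norm_nonneg _⟩ (⟨y, hy⟩ : K)
  refine ⟨P, ?_, hPK, ?_, hmin⟩
  · refine LipschitzWith.of_dist_le_mul fun x y => ?_
    rw [NNReal.coe_one, one_mul, dist_eq_norm, dist_eq_norm]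
    have h1 := hvar x _ (hPK y)
    have h2 := hvar y _ (hPK x)
    have h3 : ‖P x - P y‖ ^ 2 ≤ ⟪x - y, P x - P y⟫_ℝ := by
      rw [← real_inner_self_eq_norm_sq]
      have e : ⟪x - y, P x - P y⟫_ℝ - ⟪P x - P y, P x - P y⟫_ℝ =
          -⟪x - P x, P y - P x⟫_ℝ - ⟪y - P y, P x - P y⟫_ℝ := by
        simp only [inner_sub_left, inner_sub_right]; ring
      linarith
    have h4 := real_inner_le_norm (x - y) (P x - P y)
    rcases (norm_nonneg (P x - P y)).eq_or_lt with h | h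
    · rw [← h]; positivity
    · nlinarith
  · intro x hx
    have := hmin x x hx
    rw [sub_self, norm_zero, norm_le_zero_iff] at this
    exact (sub_eq_zero.1 this).symm

theorem segment_subset_compl_interior {K : Set E} {x z : E} (hx : x ∉ interior K)
    (hmin : ∀ y ∈ K, ‖x - z‖ ≤ ‖x - y‖) : segment ℝ x z ⊆ (interior K)ᶜ := by
  rw [segment_eq_image']
  rintro _ ⟨t, ht, rfl⟩ hw
  dsimp only at hw
  have hxz : 0 < ‖x - z‖ := by
    refine norm_pos_iff.2 fun h => hx ?_
    rw [sub_eq_zero.1 h] at hw ⊢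
    simpa using hw
  have ht0 : 0 < t := by
    refine lt_of_le_of_ne ht.1 fun h => hx ?_
    rw [← h] at hw
    simpa using hw
  have hcont : Continuous fun t : ℝ => x + t • (z - x) := by fun_prop
  have hev : ∀ᶠ s in 𝓝 t, x + s • (z - x) ∈ interior K :=
    hcont.continuousAt.eventually_mem (isOpen_interior.mem_nhds hw)
  obtain ⟨s, hs, hs0, hst⟩ := ((hev.filter_mono (nhdsWithin_le_nhds (s := Iio t))).and
    (Ioo_mem_nhdsLT ht0)).exists
  have := hmin _ (interior_subset hs)
  rw [sub_add_cancel_left, norm_neg, norm_smul, norm_sub_rev z x, Real.norm_of_nonneg hs0.le] at this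
  nlinarith [ht.2]

theorem projection_mem_frontier {K : Set E} (hK : IsCompact K) {x z : E} (hx : x ∉ interior K)
    (hz : z ∈ K) (hmin : ∀ y ∈ K, ‖x - z‖ ≤ ‖x - y‖) : z ∈ frontier K := by
  rw [hK.isClosed.frontier_eq]
  exact ⟨hz, segment_subset_compl_interior hx hmin (right_mem_segment ℝ x z)⟩

theorem curveDist_frontier_le {K : Set E} (hK : IsCompact K) (hc : Convex ℝ K) {a b : E}
    (ha : a ∈ frontier K) (hb : b ∈ frontier K) :
    curveDist (frontier K) a b ≤ curveDist (interior K)ᶜ a b := by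
  have haK := hK.isClosed.frontier_subset ha
  obtain ⟨P, hP, hPK, hfix, hmin⟩ := exists_metric_projection hK hc ⟨a, haK⟩
  have := curveDist_map_le (T := P) (S := (interior K)ᶜ) (X := frontier K) one_ne_zero
    hP.lipschitzOnWith (fun x hx => projection_mem_frontier hK hx (hPK x) (hmin x)) a b
  rwa [hfix a haK, hfix b (hK.isClosed.frontier_subset hb), ENNReal.coe_one, one_mul] at this

theorem smul_notMem_interior {K : Set E} (hc : Convex ℝ K) (h0 : 0 ∈ interior K) {x : E}
    (hx : x ∉ interior K) {l : ℝ} (hl : 1 ≤ l) : l • x ∉ interior K := by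
  intro h
  refine hx ?_
  have hl0 : 0 < l := by linarith
  have := hc.interior.smul_mem_of_zero_mem h0 h (t := l⁻¹)
    ⟨by positivity, inv_le_one_of_one_le₀ hl⟩
  rwa [smul_smul, inv_mul_cancel₀ hl0.ne', one_smul] at this

theorem curveDist_smul_le {K : Set E} (hc : Convex ℝ K) (h0 : 0 ∈ interior K) {x : E}
    (hx : x ∉ interior K) {l : ℝ} (hl : 1 ≤ l) :
    curveDist (interior K)ᶜ x (l • x) ≤ ENNReal.ofReal ((l - 1) * ‖x‖) := by
  refine (curveDist_le_of_segment ?_).trans (le_of_eq ?_)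
  · rw [segment_eq_image']
    rintro _ ⟨t, ht, rfl⟩
    have : x + t • (l • x - x) = (1 + t * (l - 1)) • x := by module
    dsimp only
    rw [this]
    exact smul_notMem_interior hc h0 hx (by nlinarith [ht.1])
  · have : x - l • x = -((l - 1) • x) := by module
    rw [this, norm_neg, norm_smul, Real.norm_of_nonneg (by linarith)]

theorem smul_notMem_interior_of_near {K : Set E} (hc : Convex ℝ K) {ρ η : ℝ} 
    (hball : Metric.ball 0 ρ ⊆ K) {x z : E} (hx : x ∉ interior K) (hη : 0 < η) (hηρ : η < ρ / 2)
    (hz : ‖z - x‖ ≤ η) : (1 + 2 * η / ρ) • z ∉ interior K := by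
  intro h
  refine hx ?_
  have hρ : 0 < ρ := by linarith
  set l := 1 + 2 * η / ρ with hl
  have h1 : 0 < l - 1 := by rw [hl]; ring_nf; positivity
  have h2 : l < 2 := by
    rw [hl]
    have : 2 * η / ρ < 1 := by rw [div_lt_one hρ]; linarith
    linarith
  have hl0 : 0 < l := by linarith
  have hu : (l / (l - 1)) • (x - z) ∈ K := by
    refine hball ?_
    rw [mem_ball_zero_iff, norm_smul, Real.norm_of_nonneg (by positivity), norm_sub_rev]
    have : (l - 1) = 2 * η / ρ := by rw [hl]; ring
    calc l / (l - 1) * ‖z - x‖ ≤ l / (l - 1) * η := by gcongr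
      _ = l * ρ / 2 := by rw [this]; field_simp
      _ < ρ := by nlinarith
  have := hc.combo_interior_self_mem_interior h hu (a := l⁻¹) (b := 1 - l⁻¹) (by positivity)
    (by rw [sub_nonneg]; exact inv_le_one_of_one_le₀ (by linarith)) (by ring)
  convert this using 1
  rw [smul_smul, smul_smul, inv_mul_cancel₀ hl0.ne',
    show (1 - l⁻¹) * (l / (l - 1)) = 1 by field_simp]
  module

theorem curveDist_polygon_le {K : Set E} (hc : Convex ℝ K) {ρ η : ℝ}
    (hball : Metric.ball 0 ρ ⊆ K) (hη : 0 < η) (hηρ : η < ρ / 2) {N : ℕ} {p : ℕ → E}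
    (hp : ∀ i, p i ∉ interior K) (hedge : ∀ i < N, ‖p (i + 1) - p i‖ ≤ η) :
    curveDist (interior K)ᶜ ((1 + 2 * η / ρ) • p 0) ((1 + 2 * η / ρ) • p N) ≤
      ENNReal.ofReal ((1 + 2 * η / ρ) * ∑ i ∈ Finset.range N, ‖p (i + 1) - p i‖) := by
  have hρ : 0 < ρ := by linarith
  have hl : 0 < 1 + 2 * η / ρ := by positivity
  refine (curveDist_sum_le (N := N) (fun i => (1 + 2 * η / ρ) • p i) ?_ ?_).trans (le_of_eq ?_)
  · intro i hi
    rw [segment_eq_image']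
    rintro _ ⟨t, ht, rfl⟩
    have : (1 + 2 * η / ρ) • p i + t • ((1 + 2 * η / ρ) • p (i + 1) - (1 + 2 * η / ρ) • p i) =
      (1 + 2 * η / ρ) • (p i + t • (p (i + 1) - p i)) := by module
    dsimp only
    rw [this]
    refine smul_notMem_interior_of_near hc hball (hp i) hη hηρ ?_
    rw [add_sub_cancel_left, norm_smul, Real.norm_of_nonneg ht.1]
    nlinarith [ht.2, hedge i hi, norm_nonneg (p (i + 1) - p i)]
  · simpa using smul_notMem_interior_of_near hc hball (hp 0) hη hηρ (z := p 0) (by simp [hη.le])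
  · rw [Finset.mul_sum]
    congr 1
    refine Finset.sum_congr rfl fun i _ => ?_
    rw [← smul_sub, norm_smul, Real.norm_of_nonneg hl.le]

theorem exists_unit_orthogonal [FiniteDimensional ℝ E] (hE : 2 ≤ Module.finrank ℝ E) (a : E) :
    ∃ c : E, ‖c‖ = 1 ∧ ⟪a, c⟫_ℝ = 0 := by
  have h1 := Submodule.finrank_add_finrank_orthogonal (ℝ ∙ a)
  have h2 := finrank_span_le_card (R := ℝ) ({a} : Set E)
  simp only [toFinset_singleton, Finset.card_singleton] at h2
  have h3 : (ℝ ∙ a)ᗮ ≠ ⊥ := by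
    intro h
    rw [h, finrank_bot] at h1
    omega
  obtain ⟨c, hc, hc0⟩ := Submodule.exists_mem_ne_zero_of_ne_bot h3
  refine ⟨‖c‖⁻¹ • c, ?_, ?_⟩
  · rw [norm_smul, norm_inv, norm_norm, inv_mul_cancel₀ (norm_ne_zero_iff.2 hc0)]
  · rw [inner_smul_right, Submodule.mem_orthogonal_singleton_iff_inner_right.1 hc, mul_zero]

theorem curveDist_far_le {K : Set E} {R : ℝ} (hR : 0 < R) (hKR : K ⊆ Metric.closedBall 0 R)
    {u v : E} (hu : ‖u‖ = 2 * R) (hv : ‖v‖ = 2 * R) (huv : 0 ≤ ⟪u, v⟫_ℝ) :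
    curveDist (interior K)ᶜ u v ≤ ENNReal.ofReal (4 * R) := by
  refine (curveDist_le_of_segment ?_).trans (ENNReal.ofReal_le_ofReal ?_)
  · rintro _ ⟨s, t, hs, ht, hst, rfl⟩ hw
    have h1 := mem_closedBall_zero_iff.1 (hKR (interior_subset hw))
    have h2 : ‖s • u + t • v‖ ^ 2 ≤ R ^ 2 := pow_le_pow_left₀ (norm_nonneg _) h1 2
    rw [norm_add_sq_real, norm_smul, norm_smul, inner_smul_left, inner_smul_right, hu, hv,
      Real.norm_of_nonneg hs, Real.norm_of_nonneg ht] at h2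
    simp only [conj_trivial] at h2
    have h3 : 0 ≤ s * (t * ⟪u, v⟫_ℝ) := by positivity
    have h4 : 2 * (s ^ 2 + t ^ 2) ≥ 1 := by nlinarith [sq_nonneg (s - t)]
    nlinarith [mul_pos hR hR]
  · refine (norm_sub_le _ _).trans ?_
    linarith

theorem curveDist_le_of_norm_le [FiniteDimensional ℝ E] (hE : 2 ≤ Module.finrank ℝ E) {K : Set E}
    (hc : Convex ℝ K) (h0 : 0 ∈ interior K) {R : ℝ} (hKR : K ⊆ Metric.closedBall 0 R)
    {a b : E} (ha : a ∉ interior K) (hb : b ∉ interior K) (haR : ‖a‖ ≤ R) (hbR : ‖b‖ ≤ R) :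
    curveDist (interior K)ᶜ a b ≤ ENNReal.ofReal (12 * R) := by
  have ne : ∀ x, x ∉ interior K → 0 < ‖x‖ := fun x hx =>
    norm_pos_iff.2 fun h => hx (h ▸ h0)
  have hR : 0 < R := (ne a ha).trans_le haR
  have hrad : ∀ x, x ∉ interior K → ‖x‖ ≤ R →
      curveDist (interior K)ᶜ x ((2 * R / ‖x‖) • x) ≤ ENNReal.ofReal (2 * R) := by
    intro x hx hxR
    have hx0 := ne x hx
    refine (curveDist_smul_le hc h0 hx ?_).trans (ENNReal.ofReal_le_ofReal ?_)
    · rw [one_le_div hx0]; linarith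
    · rw [sub_mul, div_mul_cancel₀ _ hx0.ne']; linarith
  have hn : ∀ x, x ∉ interior K → ‖(2 * R / ‖x‖) • x‖ = 2 * R := by
    intro x hx
    rw [norm_smul, Real.norm_of_nonneg (by positivity), div_mul_cancel₀ _ (ne x hx).ne']
  obtain ⟨c, hc1, hac, hbc⟩ : ∃ c : E, ‖c‖ = 1 ∧ ⟪a, c⟫_ℝ = 0 ∧ 0 ≤ ⟪b, c⟫_ℝ := by
    obtain ⟨c, h1, h2⟩ := exists_unit_orthogonal hE a
    rcases le_total 0 ⟪b, c⟫_ℝ with h | h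
    · exact ⟨c, h1, h2, h⟩
    · exact ⟨-c, by simpa, by simpa, by simpa⟩
  have hcn : ‖(2 * R) • c‖ = 2 * R := by
    rw [norm_smul, hc1, Real.norm_of_nonneg (by positivity), mul_one]
  have t1 := curveDist_triangle (interior K)ᶜ a ((2 * R / ‖a‖) • a) b
  have t2 := curveDist_triangle (interior K)ᶜ ((2 * R / ‖a‖) • a) ((2 * R) • c) b
  have t3 := curveDist_triangle (interior K)ᶜ ((2 * R) • c) ((2 * R / ‖b‖) • b) b
  have s1 := hrad a ha haR
  have s4 := hrad b hb hbR
  rw [curveDist_comm] at s4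
  have s2 := curveDist_far_le hR hKR (hn a ha) hcn
    (by rw [inner_smul_left, inner_smul_right, hac]; simp)
  have s3 := curveDist_far_le hR hKR hcn (hn b hb)
    (by rw [inner_smul_left, inner_smul_right, real_inner_comm]; simp only [conj_trivial]; positivity)
  calc curveDist (interior K)ᶜ a b ≤ _ + (_ + (_ + _)) :=
        t1.trans (add_le_add_right (t2.trans (add_le_add_right t3 _)) _)
    _ ≤ ENNReal.ofReal (2 * R) + (ENNReal.ofReal (4 * R) + (ENNReal.ofReal (4 * R) +
        ENNReal.ofReal (2 * R))) := add_le_add s1 (add_le_add s2 (add_le_add s3 s4))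
    _ = ENNReal.ofReal (12 * R) := by
      rw [← ENNReal.ofReal_add, ← ENNReal.ofReal_add, ← ENNReal.ofReal_add] <;> try positivity
      congr 1; ring

end Projection

theorem abs_exp_sub_one_sub_le (s : ℝ) : |Real.exp s - 1 - s| ≤ |s| ^ 2 * Real.exp |s| := by
  have h := Complex.norm_exp_sub_sum_le_norm_mul_exp (s : ℂ) 2
  have e : Complex.exp (s : ℂ) - ∑ m ∈ Finset.range 2, (s : ℂ) ^ m / m.factorial =
      ((Real.exp s - 1 - s : ℝ) : ℂ) := by
    simp [Finset.sum_range_succ]; ring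
  rwa [e, Complex.norm_real, Complex.norm_real, Real.norm_eq_abs, Real.norm_eq_abs] at h

theorem abs_exp_sub_one_sub_sub_le (s : ℝ) :
    |Real.exp s - 1 - s - s ^ 2 / 2| ≤ |s| ^ 3 * Real.exp |s| := by
  have h := Complex.norm_exp_sub_sum_le_norm_mul_exp (s : ℂ) 3
  have e : Complex.exp (s : ℂ) - ∑ m ∈ Finset.range 3, (s : ℂ) ^ m / m.factorial =
      ((Real.exp s - 1 - s - s ^ 2 / 2 : ℝ) : ℂ) := by
    simp [Finset.sum_range_succ]; ring
  rwa [e, Complex.norm_real, Complex.norm_real, Real.norm_eq_abs, Real.norm_eq_abs] at h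

section ExpSum

variable {E : Type*} [NormedAddCommGroup E] [InnerProductSpace ℝ E] {ι : Type*} [Fintype ι]

/-- The convex function `∑ j, exp (⟪b j, x⟫_ℝ - c j)`. -/
noncomputable def expSum (b : ι → E) (c : ι → ℝ) (x : E) : ℝ := ∑ j, Real.exp (⟪b j, x⟫_ℝ - c j)

/-- The gradient of `expSum b c`. -/
noncomputable def expSumGrad (b : ι → E) (c : ι → ℝ) (x : E) : E :=
  ∑ j, Real.exp (⟪b j, x⟫_ℝ - c j) • b j

/-- The Hessian of `expSum b c`. -/
noncomputable def expSumHess (b : ι → E) (c : ι → ℝ) (x : E) : E →ₗ[ℝ] E →ₗ[ℝ] ℝ :=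
  LinearMap.mk₂ ℝ (fun v w => ∑ j, Real.exp (⟪b j, x⟫_ℝ - c j) * (⟪b j, v⟫_ℝ * ⟪b j, w⟫_ℝ))
    (fun v v' w => by
      rw [← Finset.sum_add_distrib]
      exact Finset.sum_congr rfl fun j _ => by rw [inner_add_right]; ring)
    (fun t v w => by
      rw [smul_eq_mul, Finset.mul_sum]
      exact Finset.sum_congr rfl fun j _ => by rw [inner_smul_right]; ring)
    (fun v w w' => by
      rw [← Finset.sum_add_distrib]
      exact Finset.sum_congr rfl fun j _ => by rw [inner_add_right]; ring)
    (fun t v w => by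
      rw [smul_eq_mul, Finset.mul_sum]
      exact Finset.sum_congr rfl fun j _ => by rw [inner_smul_right]; ring)

variable (b : ι → E) (c : ι → ℝ)

theorem expSumHess_apply (x v w : E) :
    expSumHess b c x v w = ∑ j, Real.exp (⟪b j, x⟫_ℝ - c j) * (⟪b j, v⟫_ℝ * ⟪b j, w⟫_ℝ) := rfl

theorem inner_expSumGrad (x w : E) :
    ⟪expSumGrad b c x, w⟫_ℝ = ∑ j, Real.exp (⟪b j, x⟫_ℝ - c j) * ⟪b j, w⟫_ℝ := by
  simp only [expSumGrad, sum_inner, inner_smul_left, conj_trivial]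

theorem hasStrictFDerivAt_expSum (x : E) :
    HasStrictFDerivAt (expSum b c) (innerSL ℝ (expSumGrad b c x)) x := by
  have h : HasStrictFDerivAt (fun x => ∑ j, Real.exp (⟪b j, x⟫_ℝ - c j))
      (∑ j, Real.exp (⟪b j, x⟫_ℝ - c j) • innerSL ℝ (b j)) x := by
    refine HasStrictFDerivAt.fun_sum fun j _ => ?_
    exact ((innerSL ℝ (b j)).hasStrictFDerivAt.sub_const (c j)).exp
  have e : innerSL ℝ (expSumGrad b c x) = ∑ j, Real.exp (⟪b j, x⟫_ℝ - c j) • innerSL ℝ (b j) := by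
    simp only [expSumGrad, map_sum, map_smul]
  rw [e]
  exact h

theorem expSum_add_inner_le (x y : E) :
    expSum b c x + ⟪expSumGrad b c x, y - x⟫_ℝ ≤ expSum b c y := by
  rw [inner_expSumGrad]
  unfold expSum
  rw [← Finset.sum_add_distrib]
  refine Finset.sum_le_sum fun j _ => ?_
  have e : ⟪b j, y⟫_ℝ - c j = (⟪b j, x⟫_ℝ - c j) + ⟪b j, y - x⟫_ℝ := by rw [inner_sub_right]; ring
  rw [e, Real.exp_add]
  have := Real.add_one_le_exp ⟪b j, y - x⟫_ℝ
  nlinarith [Real.exp_pos (⟪b j, x⟫_ℝ - c j)]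

theorem abs_sum_exp_mul_le {x : E} (hx : expSum b c x = 1) {s : ι → ℝ} {D : ℝ}
    (hs : ∀ j, |s j| ≤ D) : |∑ j, Real.exp (⟪b j, x⟫_ℝ - c j) * s j| ≤ D := by
  calc |∑ j, Real.exp (⟪b j, x⟫_ℝ - c j) * s j| ≤ ∑ j, |Real.exp (⟪b j, x⟫_ℝ - c j) * s j| :=
        Finset.abs_sum_le_sum_abs _ _
    _ ≤ ∑ j, Real.exp (⟪b j, x⟫_ℝ - c j) * D := by
        refine Finset.sum_le_sum fun j _ => ?_
        rw [abs_mul, abs_of_pos (Real.exp_pos _)]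
        exact mul_le_mul_of_nonneg_left (hs j) (Real.exp_pos _).le
    _ = D := by rw [← Finset.sum_mul]; unfold expSum at hx; rw [hx, one_mul]

theorem isSmoothConvex_expSum {R : ℝ} (h0 : expSum b c 0 < 1)
    (hR : ∀ x, expSum b c x = 1 → ‖x‖ ≤ R) :
    ∃ A, IsSmoothConvex (expSum b c) (expSumGrad b c) (expSumHess b c) A := by
  obtain ⟨β, hβ0, hβ⟩ : ∃ β : ℝ, 0 ≤ β ∧ ∀ j, ‖b j‖ ≤ β :=
    ⟨∑ j, ‖b j‖, by positivity,
      fun j => Finset.single_le_sum (f := fun j => ‖b j‖) (fun _ _ => norm_nonneg _)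
        (Finset.mem_univ j)⟩
  have hin : ∀ j v, |⟪b j, v⟫_ℝ| ≤ β * ‖v‖ := fun j v =>
    (abs_real_inner_le_norm _ _).trans (mul_le_mul_of_nonneg_right (hβ j) (norm_nonneg _))
  have hin1 : ∀ j v, ‖v‖ ≤ 1 → |⟪b j, v⟫_ℝ| ≤ β := fun j v hv =>
    (hin j v).trans (mul_le_of_le_one_right hβ0 hv)
  set θ := 1 - expSum b c 0 with hθ
  have hθ0 : 0 < θ := by rw [hθ]; linarith
  set R' := |R| with hR'
  have hR'0 : 0 ≤ R' := abs_nonneg R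
  have hA1 : 0 ≤ β ^ 3 * Real.exp β := by positivity
  have hA2 : 0 ≤ R' / θ := by positivity
  have hA3 : 0 ≤ β ^ 2 := by positivity
  have hexp : ∀ x v j, Real.exp (⟪b j, x + v⟫_ℝ - c j) =
      Real.exp (⟪b j, x⟫_ℝ - c j) * Real.exp ⟪b j, v⟫_ℝ := by
    intro x v j
    rw [← Real.exp_add, inner_add_right]; congr 1; ring
  refine ⟨1 + β + β ^ 2 + β ^ 3 * Real.exp β + R' / θ, ?_, hasStrictFDerivAt_expSum b c,
    expSum_add_inner_le b c, ?_, ?_, ?_, ?_, ?_, ?_, ?_, ?_⟩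
  · linarith
  · intro x hx v hv
    have e : expSum b c (x + v) - expSum b c x - ⟪expSumGrad b c x, v⟫_ℝ - expSumHess b c x v v / 2 =
        ∑ j, Real.exp (⟪b j, x⟫_ℝ - c j) *
          (Real.exp ⟪b j, v⟫_ℝ - 1 - ⟪b j, v⟫_ℝ - ⟪b j, v⟫_ℝ ^ 2 / 2) := by
      rw [inner_expSumGrad, expSumHess_apply, Finset.sum_div]
      unfold expSum
      rw [← Finset.sum_sub_distrib, ← Finset.sum_sub_distrib, ← Finset.sum_sub_distrib]
      exact Finset.sum_congr rfl fun j _ => by rw [hexp]; ring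
    rw [e]
    refine (abs_sum_exp_mul_le b c hx (D := β ^ 3 * Real.exp β * ‖v‖ ^ 3) fun j => ?_).trans ?_
    · refine (abs_exp_sub_one_sub_sub_le _).trans ?_
      calc |⟪b j, v⟫_ℝ| ^ 3 * Real.exp |⟪b j, v⟫_ℝ| ≤ (β * ‖v‖) ^ 3 * Real.exp β := by
            gcongr
            · exact hin j v
            · exact hin1 j v hv
        _ = _ := by ring
    · gcongr
      linarith
  · intro x hx v w hv
    have e : ⟪expSumGrad b c (x + v) - expSumGrad b c x, w⟫_ℝ - expSumHess b c x v w =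
        ∑ j, Real.exp (⟪b j, x⟫_ℝ - c j) * ((Real.exp ⟪b j, v⟫_ℝ - 1 - ⟪b j, v⟫_ℝ) * ⟪b j, w⟫_ℝ) := by
      rw [inner_sub_left, inner_expSumGrad, inner_expSumGrad, expSumHess_apply,
        ← Finset.sum_sub_distrib, ← Finset.sum_sub_distrib]
      exact Finset.sum_congr rfl fun j _ => by rw [hexp]; ring
    rw [e]
    refine (abs_sum_exp_mul_le b c hx (D := β ^ 3 * Real.exp β * ‖v‖ ^ 2 * ‖w‖) fun j => ?_).trans ?_
    · rw [abs_mul]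
      calc |Real.exp ⟪b j, v⟫_ℝ - 1 - ⟪b j, v⟫_ℝ| * |⟪b j, w⟫_ℝ|
          ≤ (|⟪b j, v⟫_ℝ| ^ 2 * Real.exp |⟪b j, v⟫_ℝ|) * |⟪b j, w⟫_ℝ| := by
            gcongr; exact abs_exp_sub_one_sub_le _
        _ ≤ ((β * ‖v‖) ^ 2 * Real.exp β) * (β * ‖w‖) := by
            gcongr
            · exact hin j v
            · exact hin1 j v hv
            · exact hin j w
        _ = _ := by ring
    · gcongr
      linarith
  · intro x v w
    simp only [expSumHess_apply]
    exact Finset.sum_congr rfl fun j _ => by ring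
  · intro x v
    rw [expSumHess_apply]
    exact Finset.sum_nonneg fun j _ => mul_nonneg (Real.exp_pos _).le (mul_self_nonneg _)
  · intro x v w
    have hsq : ∀ s t : ι → ℝ, ∑ j, Real.exp (⟪b j, x⟫_ℝ - c j) * (s j * t j) =
        ∑ j, (√(Real.exp (⟪b j, x⟫_ℝ - c j)) * s j) * (√(Real.exp (⟪b j, x⟫_ℝ - c j)) * t j) := by
      intro s t
      refine Finset.sum_congr rfl fun j _ => ?_
      rw [mul_mul_mul_comm, Real.mul_self_sqrt (Real.exp_pos _).le]
    have := Finset.sum_mul_sq_le_sq_mul_sq Finset.univ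
      (fun j => √(Real.exp (⟪b j, x⟫_ℝ - c j)) * ⟪b j, v⟫_ℝ)
      (fun j => √(Real.exp (⟪b j, x⟫_ℝ - c j)) * ⟪b j, w⟫_ℝ)
    simpa only [expSumHess_apply, hsq, pow_two] using this
  · intro x hx v w
    rw [expSumHess_apply]
    refine (abs_sum_exp_mul_le b c hx (D := β ^ 2 * ‖v‖ * ‖w‖) fun j => ?_).trans ?_
    · rw [abs_mul]
      calc |⟪b j, v⟫_ℝ| * |⟪b j, w⟫_ℝ| ≤ (β * ‖v‖) * (β * ‖w‖) := by
            gcongr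
            · exact hin j v
            · exact hin j w
        _ = _ := by ring
    · gcongr
      linarith
  · intro x hx
    have h1 : ‖expSumGrad b c x‖ ^ 2 ≤ β * ‖expSumGrad b c x‖ := by
      rw [← real_inner_self_eq_norm_sq, inner_expSumGrad]
      exact (le_abs_self _).trans (abs_sum_exp_mul_le b c hx fun j => hin j _)
    have h2 : ‖expSumGrad b c x‖ ≤ β := by
      rcases (norm_nonneg (expSumGrad b c x)).eq_or_lt with h | h
      · rw [← h]; exact hβ0
      · nlinarith
    linarith
  · intro x hx
    have h1 := expSum_add_inner_le b c x 0
    rw [hx, zero_sub, inner_neg_right] at h1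
    have h2 := real_inner_le_norm (expSumGrad b c x) x
    have h3 : ‖x‖ ≤ R' := (hR x hx).trans (le_abs_self R)
    have h4 : θ ≤ ‖expSumGrad b c x‖ * R' := by
      rw [hθ]
      nlinarith [norm_nonneg (expSumGrad b c x)]
    calc 1 ≤ R' / θ * ‖expSumGrad b c x‖ := by
          rw [div_mul_eq_mul_div, one_le_div hθ0]; linarith
      _ ≤ _ := by
          gcongr
          linarith

end ExpSum

section Approximation

variable {E : Type*} [NormedAddCommGroup E] [InnerProductSpace ℝ E]

theorem le_combo_of_add_inner_le {G : E → ℝ} {G' : E → E}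
    (hG : ∀ x y, G x + ⟪G' x, y - x⟫_ℝ ≤ G y) {x y : E} {s t : ℝ} (hs : 0 ≤ s) (ht : 0 ≤ t)
    (hst : s + t = 1) : G (s • x + t • y) ≤ s * G x + t * G y := by
  have h1 := hG (s • x + t • y) x
  have h2 := hG (s • x + t • y) y
  have e : s * ⟪G' (s • x + t • y), x - (s • x + t • y)⟫_ℝ +
      t * ⟪G' (s • x + t • y), y - (s • x + t • y)⟫_ℝ = 0 := by
    rw [← inner_smul_right, ← inner_smul_right, ← inner_add_right]
    have : s • (x - (s • x + t • y)) + t • (y - (s • x + t • y)) = 0 := by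
      rw [show s = 1 - t by linarith]; module
    rw [this, inner_zero_right]
  have h3 := mul_le_mul_of_nonneg_left h1 hs
  have h4 := mul_le_mul_of_nonneg_left h2 ht
  have h5 : s * G (s • x + t • y) + t * G (s • x + t • y) = G (s • x + t • y) := by
    rw [← add_mul, hst, one_mul]
  linarith

theorem exists_inner_separation [CompleteSpace E] {K : Set E} (hK : IsCompact K) (hc : Convex ℝ K)
    (h0 : 0 ∈ K) {x : E} (hx : x ∉ K) : ∃ a : E, (∀ y ∈ K, ⟪a, y⟫_ℝ ≤ 1) ∧ 1 < ⟪a, x⟫_ℝ := by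
  obtain ⟨f, u, hfK, hfx⟩ := geometric_hahn_banach_closed_point hc hK.isClosed hx
  have hu : 0 < u := by simpa using hfK 0 h0
  refine ⟨u⁻¹ • (InnerProductSpace.toDual ℝ E).symm f, fun y hy => ?_, ?_⟩
  · rw [inner_smul_left, InnerProductSpace.toDual_symm_apply, conj_trivial, inv_mul_le_iff₀ hu,
      mul_one]
    exact (hfK y hy).le
  · rw [inner_smul_left, InnerProductSpace.toDual_symm_apply, conj_trivial, lt_inv_mul_iff₀ hu,
      mul_one]
    exact hfx

theorem exists_isSmoothConvex_approx [FiniteDimensional ℝ E] {K : Set E} (hK : IsCompact K)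
    (hc : Convex ℝ K) {ρ ε : ℝ} (hρ : 0 < ρ) (hball : Metric.ball 0 ρ ⊆ K) (hε : 0 < ε) :
    ∃ (G : E → ℝ) (G' : E → E) (H : E → E →ₗ[ℝ] E →ₗ[ℝ] ℝ) (A : ℝ), IsSmoothConvex G G' H A ∧
      (∀ x ∈ K, G x < 1) ∧ ∀ x, G x ≤ 1 → (1 + ε)⁻¹ • x ∈ K := by
  have hKn : K ∈ 𝓝 (0 : E) := mem_of_superset (Metric.ball_mem_nhds _ hρ) hball
  have h0K : (0 : E) ∈ K := mem_of_mem_nhds hKn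
  have hε1 : 0 < 1 + ε := by linarith
  have hgm : ∀ x, gauge K x ≤ 1 + ε → (1 + ε)⁻¹ • x ∈ K := by
    intro x hx
    rw [← hK.isClosed.closure_eq, ← gauge_le_one_iff_mem_closure hc hKn,
      gauge_smul_of_nonneg (by positivity), smul_eq_mul, inv_mul_le_iff₀ hε1, mul_one]
    exact hx
  obtain ⟨R, hR⟩ := hK.isBounded.exists_norm_le
  have hT : IsCompact {x | gauge K x = 1 + ε} := by
    refine Metric.isCompact_of_isClosed_isBounded
      (isClosed_eq (continuous_gauge hc hKn) continuous_const) ?_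
    refine (Metric.isBounded_closedBall (x := (0 : E)) (r := (1 + ε) * R)).subset fun x hx => ?_
    rw [mem_closedBall_zero_iff]
    have := hR _ (hgm x (le_of_eq hx))
    rwa [norm_smul, norm_inv, Real.norm_of_nonneg hε1.le, inv_mul_le_iff₀ hε1] at this
  have hcov : {x | gauge K x = 1 + ε} ⊆
      ⋃ a : {a : E // ∀ y ∈ K, ⟪a, y⟫_ℝ ≤ 1}, {x | 1 + ε / 2 < ⟪a.1, x⟫_ℝ} := by
    intro x hx
    have hx : gauge K x = 1 + ε := hx
    have hε2 : 0 < 1 + ε / 2 := by linarith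
    have hxK : (1 + ε / 2)⁻¹ • x ∉ K := by
      intro h
      have := gauge_le_one_of_mem h
      rw [gauge_smul_of_nonneg (by positivity), smul_eq_mul, inv_mul_le_iff₀ hε2, hx] at this
      linarith
    obtain ⟨a, ha, hax⟩ := exists_inner_separation hK hc h0K hxK
    refine mem_iUnion.2 ⟨⟨a, ha⟩, ?_⟩
    rwa [inner_smul_right, lt_inv_mul_iff₀ hε2, mul_one] at hax
  obtain ⟨t, ht⟩ := hT.elim_finite_subcover _
    (fun a => isOpen_lt continuous_const (by fun_prop)) hcov
  obtain ⟨n, hn⟩ := exists_nat_gt ((t.card : ℝ) / (ε / 4))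
  have hn0 : (t.card : ℝ) < n * (ε / 4) := by rwa [div_lt_iff₀ (by positivity)] at hn
  set b : t → E := fun a => (n : ℝ) • a.1.1 with hb
  set c : t → ℝ := fun _ => n * (1 + ε / 4) with hcc
  have hterm : ∀ x j, Real.exp (⟪b j, x⟫_ℝ - c j) =
      Real.exp (n * (⟪j.1.1, x⟫_ℝ - (1 + ε / 4))) := by
    intro x j
    rw [hb, hcc]; dsimp only
    rw [inner_smul_left, conj_trivial]; congr 1; ring
  have hin : ∀ x ∈ K, expSum b c x < 1 := by
    intro x hx
    have h1 : expSum b c x ≤ ∑ _j : t, Real.exp (-(n * (ε / 4))) := by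
      refine Finset.sum_le_sum fun j _ => ?_
      rw [hterm, Real.exp_le_exp]
      have := j.1.2 x hx
      have hnn : (0 : ℝ) ≤ n := by positivity
      nlinarith
    rw [Finset.sum_const, Finset.card_univ, Fintype.card_coe, nsmul_eq_mul, Real.exp_neg] at h1
    refine h1.trans_lt ?_
    have h2 := Real.add_one_le_exp (n * (ε / 4))
    rw [← div_eq_mul_inv, div_lt_one (Real.exp_pos _)]
    linarith
  have hout : ∀ x, gauge K x = 1 + ε → 1 < expSum b c x := by
    intro x hx
    obtain ⟨a, ha, hax⟩ := mem_iUnion₂.1 (ht hx)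
    have hax : 1 + ε / 2 < ⟪a.1, x⟫_ℝ := hax
    have h1 : Real.exp (⟪b ⟨a, ha⟩, x⟫_ℝ - c ⟨a, ha⟩) ≤ expSum b c x :=
      Finset.single_le_sum (f := fun j => Real.exp (⟪b j, x⟫_ℝ - c j))
        (fun _ _ => (Real.exp_pos _).le) (Finset.mem_univ _)
    refine lt_of_lt_of_le ?_ h1
    rw [hterm, Real.one_lt_exp_iff]
    have hnp : (0 : ℝ) < n := by
      have : (0 : ℝ) ≤ t.card := by positivity
      by_contra hcon
      have : (n : ℝ) * (ε / 4) ≤ 0 := mul_nonpos_of_nonpos_of_nonneg (not_lt.1 hcon) (by positivity)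
      linarith
    refine mul_pos hnp ?_
    dsimp only
    linarith
  have hsub : ∀ x, expSum b c x ≤ 1 → gauge K x ≤ 1 + ε := by
    intro x hx
    by_contra! hcon
    have hg : 0 < gauge K x := hε1.trans hcon
    have hμ0 : 0 < (1 + ε) / gauge K x := by positivity
    have hμ1 : (1 + ε) / gauge K x < 1 := (div_lt_one hg).2 hcon
    have h1 := hout (((1 + ε) / gauge K x) • x) (by
      rw [gauge_smul_of_nonneg hμ0.le, smul_eq_mul, div_mul_cancel₀ _ hg.ne'])
    have h2 := le_combo_of_add_inner_le (expSum_add_inner_le b c) (x := x) (y := 0) hμ0.le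
      (sub_nonneg.2 hμ1.le) (by ring)
    rw [smul_zero, add_zero] at h2
    have h3 := hin 0 h0K
    nlinarith
  obtain ⟨A, hA⟩ := isSmoothConvex_expSum b c (R := (1 + ε) * R) (hin 0 h0K) fun x hx => by
    have := hR _ (hgm x (hsub x hx.le))
    rwa [norm_smul, norm_inv, Real.norm_of_nonneg hε1.le, inv_mul_le_iff₀ hε1] at this
  exact ⟨_, _, _, A, hA, hin, fun x hx => hgm x (hsub x hx)⟩

end Approximation

section Comparison

open scoped ENNReal Pointwise

variable {E : Type*} [NormedAddCommGroup E] [InnerProductSpace ℝ E]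

namespace IsSmoothConvex

variable {G : E → ℝ} {G' : E → E} {H : E → E →ₗ[ℝ] E →ₗ[ℝ] ℝ} {A : ℝ}

theorem convex_le_one (hG : IsSmoothConvex G G' H A) : Convex ℝ {x | G x ≤ 1} := by
  intro x hx y hy s t hs ht hst
  have hx : G x ≤ 1 := hx
  have hy : G y ≤ 1 := hy
  have := le_combo_of_add_inner_le hG.le (x := x) (y := y) hs ht hst
  show G (s • x + t • y) ≤ 1
  nlinarith

theorem interior_le_one_eq (hG : IsSmoothConvex G G' H A) (h0 : G 0 < 1) :
    interior {x | G x ≤ 1} = {x | G x < 1} := by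
  refine Subset.antisymm (fun x hx => ?_) ?_
  · have hcont : Continuous fun t : ℝ => t • x := by fun_prop
    have hev : ∀ᶠ t in 𝓝 (1 : ℝ), t • x ∈ interior {x | G x ≤ 1} :=
      hcont.continuousAt.eventually_mem (isOpen_interior.mem_nhds (by simpa using hx))
    obtain ⟨t, ht, ht1⟩ := ((hev.filter_mono (nhdsWithin_le_nhds (s := Ioi 1))).and
      self_mem_nhdsWithin).exists
    have ht1 : 1 < t := ht1
    have ht0 : 0 < t := by linarith
    have h1 : t • x ∈ {x | G x ≤ 1} := interior_subset ht
    have h1 : G (t • x) ≤ 1 := h1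
    have h2 := le_combo_of_add_inner_le hG.le (x := t • x) (y := 0) (s := t⁻¹) (t := 1 - t⁻¹)
      (by positivity) (sub_nonneg.2 (inv_le_one_of_one_le₀ ht1.le)) (by ring)
    rw [smul_zero, add_zero, smul_smul, inv_mul_cancel₀ ht0.ne', one_smul] at h2
    have h3 : t⁻¹ < 1 := inv_lt_one_of_one_lt₀ ht1
    have h4 : 0 < t⁻¹ := by positivity
    show G x < 1
    nlinarith
  · exact interior_maximal (fun x (hx : G x < 1) => hx.le)
      (isOpen_lt hG.continuous continuous_const)

theorem frontier_le_one_eq (hG : IsSmoothConvex G G' H A) (h0 : G 0 < 1) :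
    frontier {x | G x ≤ 1} = {x | G x = 1} := by
  rw [(isClosed_le hG.continuous continuous_const).frontier_eq, hG.interior_le_one_eq h0]
  ext x
  simp only [Set.mem_sdiff, mem_ofPred_eq, not_lt]
  exact ⟨fun h => le_antisymm h.1 h.2, fun h => ⟨h.le, h.ge⟩⟩

theorem minEnergy_le_of_norm_le [FiniteDimensional ℝ E] (hE : 2 ≤ Module.finrank ℝ E)
    (hG : IsSmoothConvex G G' H A) (h0 : G 0 < 1) {R : ℝ} (hR : ∀ x, G x ≤ 1 → ‖x‖ ≤ R) {N : ℕ}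
    (hN : 0 < N) {a b : E} (ha : G a = 1) (hb : G b = 1) :
    minEnergy {x | G x = 1} N a b ≤ (12 * R + 1) ^ 2 := by
  have hR0 : 0 ≤ R := (norm_nonneg _).trans (hR a ha.le)
  have hcomp : IsCompact {x | G x ≤ 1} := Metric.isCompact_of_isClosed_isBounded
    (isClosed_le hG.continuous continuous_const)
    (Metric.isBounded_closedBall.subset fun x hx => mem_closedBall_zero_iff.2 (hR x hx))
  have hfr := hG.frontier_le_one_eq h0
  have hint := hG.interior_le_one_eq h0
  have h1 := curveDist_frontier_le hcomp hG.convex_le_one (a := a) (b := b)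
    (by rw [hfr]; exact ha) (by rw [hfr]; exact hb)
  have h2 := curveDist_le_of_norm_le hE hG.convex_le_one (by rw [hint]; exact h0)
    (fun x hx => mem_closedBall_zero_iff.2 (hR x hx)) (a := a) (b := b)
    (by rw [hint]; simp [ha]) (by rw [hint]; simp [hb]) (hR a ha.le) (hR b hb.le)
  rw [hfr] at h1
  refine minEnergy_le_sq_of_curveDist_lt ((h1.trans h2).trans_lt ?_) hN
  rw [ENNReal.ofReal_lt_ofReal_iff (by positivity)]
  linarith

end IsSmoothConvex

theorem curveDist_frontier_le_of_norm_le [FiniteDimensional ℝ E] (hE : 2 ≤ Module.finrank ℝ E)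
    {K : Set E} (hK : IsCompact K) (hc : Convex ℝ K) (h0 : 0 ∈ interior K) {R : ℝ}
    (hKR : ∀ x ∈ K, ‖x‖ ≤ R) {a b : E} (ha : a ∈ frontier K) (hb : b ∈ frontier K) :
    curveDist (frontier K) a b ≤ ENNReal.ofReal (12 * R) := by
  refine (curveDist_frontier_le hK hc ha hb).trans (curveDist_le_of_norm_le hE hc h0
    (fun x hx => mem_closedBall_zero_iff.2 (hKR x hx)) ha.2 hb.2
    (hKR _ (hK.isClosed.frontier_subset ha)) (hKR _ (hK.isClosed.frontier_subset hb)))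

/-- The boundary of a convex body is approximated by level sets of smooth convex functions in such
a way that the squared intrinsic distance is close to the least energy of polygons. -/
theorem exists_smooth_comparison [FiniteDimensional ℝ E] (hE : 2 ≤ Module.finrank ℝ E)
    {K : Set E} (hK : IsCompact K) (hc : Convex ℝ K) {ρ R : ℝ} (hρ : 0 < ρ)
    (hball : Metric.ball 0 ρ ⊆ K) (hR0 : 0 ≤ R) (hKR : ∀ x ∈ K, ‖x‖ ≤ R) {ε : ℝ} (hε : 0 < ε)
    (hε1 : ε ≤ 1) :
    ∃ (G : E → ℝ) (G' : E → E) (H : E → E →ₗ[ℝ] E →ₗ[ℝ] ℝ) (A : ℝ) (T : E → E) (N₁ : ℕ),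
      IsSmoothConvex G G' H A ∧ (∀ x ∈ K, G x < 1) ∧ (∀ x, G x ≤ 1 → ‖x‖ ≤ 2 * R) ∧
      (∀ x ∈ frontier K, G (T x) = 1 ∧ ‖T x - x‖ ≤ 2 * ε * R) ∧
      (∀ x y, ‖T x - T y‖ ≤ (1 + ε) * ‖x - y‖) ∧
      ∀ n ≥ N₁, 0 < n → ∀ a ∈ frontier K, ∀ b ∈ frontier K,
        minEnergy {x | G x = 1} n (T a) (T b) ≤
          ((1 + ε) * (curveDist (frontier K) a b).toReal + ε) ^ 2 ∧
        (curveDist (frontier K) a b).toReal ≤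
          (1 + ε) * √(minEnergy {x | G x = 1} n (T a) (T b)) + 8 * ε * R := by
  obtain ⟨G, G', H, A, hG, hin, hout⟩ := exists_isSmoothConvex_approx hK hc hρ hball hε
  have h0K : (0 : E) ∈ K := hball (Metric.mem_ball_self hρ)
  have h0i : (0 : E) ∈ interior K :=
    interior_maximal hball Metric.isOpen_ball (Metric.mem_ball_self hρ)
  have h0 := hin 0 h0K
  have hl0 : 0 < 1 + ε := by linarith
  have hGR : ∀ x, G x ≤ 1 → ‖x‖ ≤ 2 * R := by
    intro x hx
    have := hKR _ (hout x hx)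
    rw [norm_smul, norm_inv, Real.norm_of_nonneg hl0.le, inv_mul_le_iff₀ hl0] at this
    nlinarith
  have hcomp : IsCompact {x | G x ≤ 1} := Metric.isCompact_of_isClosed_isBounded
    (isClosed_le hG.continuous continuous_const)
    (Metric.isBounded_closedBall.subset fun x hx => mem_closedBall_zero_iff.2 (hGR x hx))
  have hXcomp : IsCompact {x | G x = 1} := hcomp.of_isClosed_subset
    (isClosed_eq hG.continuous continuous_const) fun x (hx : G x = 1) => hx.le
  have hfr := hG.frontier_le_one_eq h0
  have hint := hG.interior_le_one_eq h0
  have hconv := hG.convex_le_one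
  have hKint : interior K ⊆ interior {x | G x ≤ 1} :=
    interior_mono fun x hx => (hin x hx).le
  obtain ⟨P, hP, hPm, hPfix, hPmin⟩ := exists_metric_projection hcomp hconv ⟨0, h0.le⟩
  have hext : ∀ x, x ∉ interior K → (1 + ε) • x ∉ interior {x | G x ≤ 1} := by
    intro x hx h
    refine hx ?_
    have hsm : interior {x | G x ≤ 1} ⊆ interior ((1 + ε) • K) := by
      refine interior_mono fun y hy => ?_
      rw [mem_smul_set_iff_inv_smul_mem₀ hl0.ne']
      exact hout y hy
    have := hsm h
    rwa [interior_smul₀ hl0.ne', smul_mem_smul_set_iff₀ hl0.ne'] at this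
  have hTlip : ∀ x y, ‖P ((1 + ε) • x) - P ((1 + ε) • y)‖ ≤ (1 + ε) * ‖x - y‖ := by
    intro x y
    have := hP.dist_le_mul ((1 + ε) • x) ((1 + ε) • y)
    rwa [NNReal.coe_one, one_mul, dist_eq_norm, dist_eq_norm, ← smul_sub, norm_smul,
      Real.norm_of_nonneg hl0.le] at this
  have hTmap : ∀ x, x ∉ interior K → G (P ((1 + ε) • x)) = 1 := by
    intro x hx
    have := projection_mem_frontier hcomp (hext x hx) (hPm _) (hPmin _)
    rw [hfr] at this
    exact this
  have hmove : ∀ x ∈ frontier K, ‖(1 + ε) • x - x‖ ≤ ε * R := by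
    intro x hx
    have : (1 + ε) • x - x = ε • x := by module
    rw [this, norm_smul, Real.norm_of_nonneg hε.le]
    exact mul_le_mul_of_nonneg_left (hKR x (hK.isClosed.frontier_subset hx)) hε.le
  have hPmove : ∀ x ∈ frontier K, ‖(1 + ε) • x - P ((1 + ε) • x)‖ ≤ ε * R := fun x hx =>
    (hPmin _ x (hin x (hK.isClosed.frontier_subset hx)).le).trans (hmove x hx)
  set η := ε * ρ / 4 with hη
  have hη0 : 0 < η := by positivity
  have hηρ : η < ρ / 2 := by rw [hη]; nlinarith
  have hl : 2 * η / ρ = ε / 2 := by rw [hη]; field_simp; norm_num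
  obtain ⟨N₁, hN₁⟩ := exists_nat_gt ((12 * (2 * R) + 1) ^ 2 / η ^ 2)
  refine ⟨G, G', H, A, fun x => P ((1 + ε) • x), N₁, hG, hin, hGR, fun x hx =>
    ⟨hTmap x hx.2, ?_⟩, hTlip, ?_⟩
  · have := norm_sub_le_norm_sub_add_norm_sub (P ((1 + ε) • x)) ((1 + ε) • x) x
    have h1 := hPmove x hx
    rw [norm_sub_rev] at h1
    linarith [hmove x hx]
  intro n hn hn0 a ha b hb
  have hfin : curveDist (frontier K) a b ≠ ∞ :=
    ((curveDist_frontier_le_of_norm_le hE hK hc h0i hKR ha hb).trans_lt ENNReal.ofReal_lt_top).ne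
  dsimp only
  constructor
  · refine minEnergy_le_sq_of_curveDist_lt ?_ hn0
    have hlip : LipschitzOnWith (1 + ε).toNNReal (fun x => P ((1 + ε) • x)) (frontier K) := by
      refine LipschitzOnWith.of_dist_le_mul fun x _ y _ => ?_
      rw [Real.coe_toNNReal _ hl0.le, dist_eq_norm, dist_eq_norm]
      exact hTlip x y
    refine (curveDist_map_le (X := {x | G x = 1}) (by simpa using hl0) hlip
      (fun x hx => hTmap x hx.2) a b).trans_lt ?_
    rw [← ENNReal.ofReal_toReal hfin, ← ENNReal.ofReal, ← ENNReal.ofReal_mul hl0.le,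
      ENNReal.toReal_ofReal ENNReal.toReal_nonneg, ENNReal.ofReal_lt_ofReal_iff (by positivity)]
    linarith
  · obtain ⟨p, ⟨hp0, hpn, hpX⟩, hpe⟩ := exists_polyEnergy_eq_minEnergy hXcomp hn0
      (hTmap a ha.2) (hTmap b hb.2)
    have heB := hG.minEnergy_le_of_norm_le hE h0 hGR hn0 (hTmap a ha.2) (hTmap b hb.2)
    set e := minEnergy {x | G x = 1} n (P ((1 + ε) • a)) (P ((1 + ε) • b)) with he
    have hnr : (0 : ℝ) < n := by exact_mod_cast hn0
    have hedge : ∀ i < n, ‖p (i + 1) - p i‖ ≤ η := by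
      intro i hi
      have h1 : ‖p (i + 1) - p i‖ ^ 2 ≤ ∑ i ∈ Finset.range n, ‖p (i + 1) - p i‖ ^ 2 :=
        Finset.single_le_sum (f := fun i => ‖p (i + 1) - p i‖ ^ 2) (fun _ _ => by positivity)
          (Finset.mem_range.2 hi)
      have h2 : (12 * (2 * R) + 1) ^ 2 < n * η ^ 2 := by
        rw [div_lt_iff₀ (by positivity)] at hN₁
        refine hN₁.trans_le ?_
        gcongr
      unfold polyEnergy at hpe
      have h3 : (n : ℝ) * ‖p (i + 1) - p i‖ ^ 2 ≤ n * η ^ 2 := by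
        have := mul_le_mul_of_nonneg_left h1 hnr.le
        linarith
      exact le_of_sq_le_sq (le_of_mul_le_mul_left h3 hnr) hη0.le
    have hpK : ∀ i, p i ∉ interior K := fun i hi => by
      have := hKint hi
      rw [hint] at this
      exact absurd (hpX i) (ne_of_lt this)
    have hpoly := curveDist_polygon_le hc hball hη0 hηρ hpK hedge
    rw [hl, hp0, hpn] at hpoly
    have hsum : ∑ i ∈ Finset.range n, ‖p (i + 1) - p i‖ ≤ √e := by
      refine Real.le_sqrt_of_sq_le ?_
      rw [← hpe]; exact sq_sum_edge_le n p
    have hend : ∀ x ∈ frontier K,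
        curveDist (interior K)ᶜ x ((1 + ε / 2) • P ((1 + ε) • x)) ≤
          ENNReal.ofReal (3 * ε * R) := by
      intro x hx
      have hTx := hTmap x hx.2
      have hTK : P ((1 + ε) • x) ∉ interior K := fun h => by
        have := hKint h
        rw [hint] at this
        exact absurd hTx (ne_of_lt this)
      have h1 := curveDist_smul_le hc h0i hx.2 (l := 1 + ε) (by linarith)
      have h2 : curveDist (interior K)ᶜ ((1 + ε) • x) (P ((1 + ε) • x)) ≤
          ENNReal.ofReal (ε * R) :=
        (curveDist_le_of_segment ((segment_subset_compl_interior (hext x hx.2)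
          (hPmin _)).trans (compl_subset_compl.2 hKint))).trans
          (ENNReal.ofReal_le_ofReal (hPmove x hx))
      have h3 := curveDist_smul_le hc h0i hTK (l := 1 + ε / 2) (by linarith)
      have h1' : ENNReal.ofReal ((1 + ε - 1) * ‖x‖) ≤ ENNReal.ofReal (ε * R) := by
        refine ENNReal.ofReal_le_ofReal ?_
        rw [add_sub_cancel_left]
        exact mul_le_mul_of_nonneg_left (hKR x (hK.isClosed.frontier_subset hx)) hε.le
      have h3' : ENNReal.ofReal ((1 + ε / 2 - 1) * ‖P ((1 + ε) • x)‖) ≤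
          ENNReal.ofReal (ε * R) := by
        refine ENNReal.ofReal_le_ofReal ?_
        have := hGR _ hTx.le
        nlinarith
      calc _ ≤ _ := (curveDist_triangle _ _ ((1 + ε) • x) _).trans
            (add_le_add_right (curveDist_triangle _ _ (P ((1 + ε) • x)) _) _)
        _ ≤ ENNReal.ofReal (ε * R) + (ENNReal.ofReal (ε * R) + ENNReal.ofReal (ε * R)) :=
            add_le_add (h1.trans h1') (add_le_add h2 (h3.trans h3'))
        _ = ENNReal.ofReal (3 * ε * R) := by
            rw [← ENNReal.ofReal_add, ← ENNReal.ofReal_add] <;> try positivity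
            congr 1; ring
    have hb' := hend b hb
    rw [curveDist_comm] at hb'
    have htot : curveDist (frontier K) a b ≤
        ENNReal.ofReal ((1 + ε) * √e + 8 * ε * R) := by
      refine (curveDist_frontier_le hK hc ha hb).trans ?_
      calc _ ≤ _ := (curveDist_triangle _ _ ((1 + ε / 2) • P ((1 + ε) • a)) _).trans
            (add_le_add_right (curveDist_triangle _ _ ((1 + ε / 2) • P ((1 + ε) • b)) _) _)
        _ ≤ ENNReal.ofReal (3 * ε * R) + (ENNReal.ofReal ((1 + ε / 2) *
            ∑ i ∈ Finset.range n, ‖p (i + 1) - p i‖) + ENNReal.ofReal (3 * ε * R)) :=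
            add_le_add (hend a ha) (add_le_add hpoly hb')
        _ ≤ _ := by
            rw [← ENNReal.ofReal_add (by positivity) (by positivity),
              ← ENNReal.ofReal_add (by positivity) (by positivity)]
            refine ENNReal.ofReal_le_ofReal ?_
            have h1 : 0 ≤ ε * R := by positivity
            have h2 : (1 + ε / 2) * ∑ i ∈ Finset.range n, ‖p (i + 1) - p i‖ ≤ (1 + ε) * √e := by
              gcongr
              linarith
            linarith
    exact ENNReal.toReal_le_of_le_ofReal (by positivity) htot

end Comparison

section UpperBound

open scoped ENNReal

variable {E : Type*} [NormedAddCommGroup E] [InnerProductSpace ℝ E]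

theorem sq_le_sq_add_mul {x y k ε Y κ : ℝ} (hx : 0 ≤ x) (hy : 0 ≤ y) (hyY : y ≤ Y) (hk : 0 ≤ k)
    (hκ : k ≤ κ) (hε : 0 ≤ ε) (hε1 : ε ≤ 1) (h : x ≤ y + ε * k) :
    x ^ 2 ≤ y ^ 2 + ε * (2 * Y * κ + κ ^ 2) := by
  have h1 : x ^ 2 ≤ (y + ε * k) ^ 2 := by gcongr
  have h2 : y * k ≤ Y * κ := by gcongr; exact hy.trans hyY
  have h3 : k ^ 2 ≤ κ ^ 2 := by gcongr
  have h4 : ε * (y * k) ≤ ε * (Y * κ) := by gcongr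
  have h5 : ε ^ 2 * k ^ 2 ≤ ε * κ ^ 2 := by
    have : ε ^ 2 ≤ ε := by nlinarith
    gcongr
  nlinarith

/-- The squared intrinsic distance of the boundary of a convex body containing a ball around the
origin has, up to an arbitrarily small error, quadratic upper supports with uniform constants. -/
theorem exists_upper_support_of_ball_subset [FiniteDimensional ℝ E] (hE : 2 ≤ Module.finrank ℝ E)
    {K : Set E} (hK : IsCompact K) (hc : Convex ℝ K) {ρ R : ℝ} (hρ : 0 < ρ)
    (hball : Metric.ball 0 ρ ⊆ K) (hR0 : 0 ≤ R) (hKR : ∀ x ∈ K, ‖x‖ ≤ R) :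
    ∃ M C : ℝ, 0 ≤ M ∧ 0 ≤ C ∧ ∀ b₁ ∈ frontier K, ∀ b₂ ∈ frontier K, ∀ δ > 0,
      ∃ u₁ u₂ : E, ‖u₁‖ ≤ M ∧ ‖u₂‖ ≤ M ∧ ∀ q₁ ∈ frontier K, ∀ q₂ ∈ frontier K,
        (curveDist (frontier K) q₁ q₂).toReal ^ 2 ≤ (curveDist (frontier K) b₁ b₂).toReal ^ 2 + δ +
          ⟪u₁, q₁ - b₁⟫_ℝ + ⟪u₂, q₂ - b₂⟫_ℝ + C * (‖q₁ - b₁‖ ^ 2 + ‖q₂ - b₂‖ ^ 2) := by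
  have : CompleteSpace E := FiniteDimensional.complete ℝ E
  obtain ⟨M, C, hM, hC, key⟩ := IsSmoothConvex.exists_joint_upper (E := E) ρ (2 * R)
    ((12 * (2 * R) + 1) ^ 2) hρ (by positivity) (by positivity)
  refine ⟨M, 4 * C, hM, by positivity, ?_⟩
  intro b₁ hb₁ b₂ hb₂ δ hδ
  have h0i : (0 : E) ∈ interior K :=
    interior_maximal hball Metric.isOpen_ball (Metric.mem_ball_self hρ)
  set S := 12 * (2 * R) + 1 with hS
  set D := 12 * R with hD
  have hS0 : 0 ≤ S := by positivity
  have hD0 : 0 ≤ D := by positivity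
  obtain ⟨c, hc_def⟩ : ∃ c, c = (2 * S * (S + 8 * R) + (S + 8 * R) ^ 2) +
    (2 * D * (D + 1) + (D + 1) ^ 2) + 8 * M * R := ⟨_, rfl⟩
  have hc0 : 0 ≤ c := by rw [hc_def]; positivity
  obtain ⟨ε, hε, hε1, hεδ⟩ : ∃ ε : ℝ, 0 < ε ∧ ε ≤ 1 ∧ ε * c ≤ δ := by
    refine ⟨min 1 (δ / (c + 1)), by positivity, min_le_left _ _, ?_⟩
    have h1 : min 1 (δ / (c + 1)) * c ≤ δ / (c + 1) * c := by gcongr; exact min_le_right _ _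
    refine h1.trans ?_
    rw [div_mul_eq_mul_div, div_le_iff₀ (by positivity)]
    nlinarith
  obtain ⟨G, G', H, A, T, N₁, hG, hin, hGR, hT, hTlip, hcmp⟩ :=
    exists_smooth_comparison hE hK hc hρ hball hR0 hKR hε hε1
  have h0 : G 0 < 1 := hin 0 (interior_subset h0i)
  have hX : IsCompact {x | G x = 1} := Metric.isCompact_of_isClosed_isBounded
    (isClosed_eq hG.continuous continuous_const)
    (Metric.isBounded_closedBall.subset fun x (hx : G x = 1) =>
      mem_closedBall_zero_iff.2 (hGR x hx.le))
  have hEB : ∀ N : ℕ, 0 < N → ∀ a b, G a = 1 → G b = 1 → minEnergy {x | G x = 1} N a b ≤ S ^ 2 :=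
    fun N hN a b ha hb => hG.minEnergy_le_of_norm_le hE h0 hGR hN ha hb
  obtain ⟨N₀, hN₀, hup⟩ := key G G' H A hG h0 (fun x hx => (hin x (hball hx)).le) hGR
    hG.convex_le_one hX hEB
  set N := max N₀ N₁ with hN
  have hNN : N₁ ≤ N + N := (le_max_right N₀ N₁).trans (Nat.le_add_right _ _)
  have hNp : 0 < N + N := by have := le_max_left N₀ N₁; omega
  obtain ⟨u₁, u₂, hu₁, hu₂, hu⟩ := hup N (le_max_left _ _) (T b₁) (T b₂) (hT b₁ hb₁).1 (hT b₂ hb₂).1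
  refine ⟨u₁, u₂, hu₁, hu₂, fun q₁ hq₁ q₂ hq₂ => ?_⟩
  have hdD : ∀ a ∈ frontier K, ∀ b ∈ frontier K, (curveDist (frontier K) a b).toReal ≤ D :=
    fun a ha b hb => ENNReal.toReal_le_of_le_ofReal hD0
      (curveDist_frontier_le_of_norm_le hE hK hc h0i hKR ha hb)
  have hlow : (curveDist (frontier K) q₁ q₂).toReal ^ 2 ≤
      minEnergy {x | G x = 1} (N + N) (T q₁) (T q₂) +
        ε * (2 * S * (S + 8 * R) + (S + 8 * R) ^ 2) := by
    have h1 := (hcmp _ hNN hNp q₁ hq₁ q₂ hq₂).2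
    have h2 := hEB _ hNp _ _ (hT q₁ hq₁).1 (hT q₂ hq₂).1
    have h3 := minEnergy_nonneg {x | G x = 1} (N + N) (T q₁) (T q₂)
    have h4 : √(minEnergy {x | G x = 1} (N + N) (T q₁) (T q₂)) ≤ S :=
      Real.sqrt_le_iff.2 ⟨hS0, h2⟩
    have h5 := sq_le_sq_add_mul (k := √(minEnergy {x | G x = 1} (N + N) (T q₁) (T q₂)) + 8 * R)
      (κ := S + 8 * R) ENNReal.toReal_nonneg (Real.sqrt_nonneg _) h4 (by positivity)
      (by linarith) hε.le hε1 (h1.trans (le_of_eq (by ring)))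
    rwa [Real.sq_sqrt h3] at h5
  have hupp : minEnergy {x | G x = 1} (N + N) (T b₁) (T b₂) ≤
      (curveDist (frontier K) b₁ b₂).toReal ^ 2 + ε * (2 * D * (D + 1) + (D + 1) ^ 2) := by
    have h1 := (hcmp _ hNN hNp b₁ hb₁ b₂ hb₂).1
    have h2 := hdD b₁ hb₁ b₂ hb₂
    have hd0 : 0 ≤ (curveDist (frontier K) b₁ b₂).toReal := ENNReal.toReal_nonneg
    refine h1.trans (sq_le_sq_add_mul (k := (curveDist (frontier K) b₁ b₂).toReal + 1) (by positivity)
      hd0 h2 (by positivity) (by linarith) hε.le hε1 (le_of_eq (by ring)))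
  have hinner : ∀ u, ‖u‖ ≤ M → ∀ q ∈ frontier K, ∀ b ∈ frontier K,
      ⟪u, T q - T b⟫_ℝ ≤ ⟪u, q - b⟫_ℝ + ε * (4 * M * R) := by
    intro u hu q hq b hb
    have h1 : T q - T b = (q - b) + ((T q - q) - (T b - b)) := by abel
    rw [h1, inner_add_right]
    have h2 : ⟪u, (T q - q) - (T b - b)⟫_ℝ ≤ ‖u‖ * ‖(T q - q) - (T b - b)‖ := real_inner_le_norm _ _
    have h3 : ‖(T q - q) - (T b - b)‖ ≤ 2 * ε * R + 2 * ε * R :=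
      (norm_sub_le _ _).trans (add_le_add (hT q hq).2 (hT b hb).2)
    have h4 : ‖u‖ * ‖(T q - q) - (T b - b)‖ ≤ M * (2 * ε * R + 2 * ε * R) := by gcongr
    linarith
  have hsq : ∀ q b, ‖T q - T b‖ ^ 2 ≤ 4 * ‖q - b‖ ^ 2 := by
    intro q b
    have h1 : ‖T q - T b‖ ≤ 2 * ‖q - b‖ := (hTlip q b).trans (by gcongr; linarith)
    calc ‖T q - T b‖ ^ 2 ≤ (2 * ‖q - b‖) ^ 2 := by gcongr
      _ = _ := by ring
  have hmain := hu (T q₁) (T q₂) (hT q₁ hq₁).1 (hT q₂ hq₂).1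
  have i1 := hinner u₁ hu₁ q₁ hq₁ b₁ hb₁
  have i2 := hinner u₂ hu₂ q₂ hq₂ b₂ hb₂
  have s : C * (‖T q₁ - T b₁‖ ^ 2 + ‖T q₂ - T b₂‖ ^ 2) ≤
      C * (4 * ‖q₁ - b₁‖ ^ 2 + 4 * ‖q₂ - b₂‖ ^ 2) := by
    gcongr
    exacts [hsq _ _, hsq _ _]
  rw [hc_def] at hεδ
  linarith

theorem IsConvexBody.exists_upper_support [FiniteDimensional ℝ E] (hE : 2 ≤ Module.finrank ℝ E)
    {K : Set E} (hK : IsConvexBody K) :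
    ∃ M C : ℝ, 0 ≤ M ∧ 0 ≤ C ∧ ∀ b₁ ∈ frontier K, ∀ b₂ ∈ frontier K, ∀ δ > 0,
      ∃ u₁ u₂ : E, ‖u₁‖ ≤ M ∧ ‖u₂‖ ≤ M ∧ ∀ q₁ ∈ frontier K, ∀ q₂ ∈ frontier K,
        intrinsicDist (frontier K) q₁ q₂ ^ 2 ≤ intrinsicDist (frontier K) b₁ b₂ ^ 2 + δ +
          ⟪u₁, q₁ - b₁⟫_ℝ + ⟪u₂, q₂ - b₂⟫_ℝ + C * (‖q₁ - b₁‖ ^ 2 + ‖q₂ - b₂‖ ^ 2) := by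
  obtain ⟨hcomp, hconv, v, hv⟩ := hK
  obtain ⟨ρ, hρ, hball⟩ := Metric.mem_nhds_iff.1 (mem_interior_iff_mem_nhds.1 hv)
  have hcomp' : IsCompact ((v + ·) ⁻¹' K) := (Homeomorph.addLeft v).isCompact_preimage.2 hcomp
  have hfr : frontier ((v + ·) ⁻¹' K) = (v + ·) ⁻¹' frontier K :=
    ((Homeomorph.addLeft v).preimage_frontier K).symm
  obtain ⟨R, hR⟩ := hcomp'.isBounded.exists_norm_le
  have hball' : Metric.ball 0 ρ ⊆ (v + ·) ⁻¹' K := fun x hx => hball (by simpa using hx)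
  have hR0 : 0 ≤ R := (norm_nonneg _).trans (hR 0 (hball' (Metric.mem_ball_self hρ)))
  obtain ⟨M, C, hM, hC, h⟩ := exists_upper_support_of_ball_subset hE hcomp'
    (hconv.translate_preimage_right v) hρ hball' hR0 hR
  refine ⟨M, C, hM, hC, fun b₁ hb₁ b₂ hb₂ δ hδ => ?_⟩
  have hmem : ∀ x ∈ frontier K, x - v ∈ frontier ((v + ·) ⁻¹' K) := fun x hx => by
    rw [hfr]; simpa using hx
  obtain ⟨u₁, u₂, hu₁, hu₂, hu⟩ := h _ (hmem b₁ hb₁) _ (hmem b₂ hb₂) δ hδ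
  refine ⟨u₁, u₂, hu₁, hu₂, fun q₁ hq₁ q₂ hq₂ => ?_⟩
  have := hu _ (hmem q₁ hq₁) _ (hmem q₂ hq₂)
  simp only [hfr, curveDist_preimage_add, add_sub_cancel, sub_sub_sub_cancel_right] at this
  exact this

end UpperBound

section Charts

variable {E : Type*} [NormedAddCommGroup E] [InnerProductSpace ℝ E]

theorem combo_norm_sub_sq {F : Type*} [NormedAddCommGroup F] [InnerProductSpace ℝ F] (z w : F)
    {s t : ℝ} (hst : s + t = 1) :
    s * ‖z - (s • z + t • w)‖ ^ 2 + t * ‖w - (s • z + t • w)‖ ^ 2 =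
      s * ‖z‖ ^ 2 + t * ‖w‖ ^ 2 - ‖s • z + t • w‖ ^ 2 := by
  have hy : ‖s • z + t • w‖ ^ 2 = s * ⟪z, s • z + t • w⟫_ℝ + t * ⟪w, s • z + t • w⟫_ℝ := by
    rw [← real_inner_self_eq_norm_sq]
    conv_lhs => rw [inner_add_left, real_inner_smul_left, real_inner_smul_left]
  rw [norm_sub_sq_real, norm_sub_sq_real]
  linear_combination 2 * hy + ‖s • z + t • w‖ ^ 2 * hst

/-- The convex function that dominates, in a chart, the deviation of a quadratic upper support
from being affine. -/
theorem chart_combo_le {e : E} (he : ‖e‖ = 1) {V : Set ↥((Submodule.span ℝ {e})ᗮ)}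
    {f : ↥((Submodule.span ℝ {e})ᗮ) → ℝ} (hf : ConvexOn ℝ V f) {L : ℝ≥0}
    (hL : LipschitzOnWith L f V) {u : E} {M C : ℝ} (hu : ‖u‖ ≤ M) (hC : 0 ≤ C)
    {z w y : ↥((Submodule.span ℝ {e})ᗮ)} (hz : z ∈ V) (hw : w ∈ V) {s t : ℝ} (hs : 0 ≤ s)
    (ht : 0 ≤ t) (hst : s + t = 1) (hy : s • z + t • w = y) :
    s * (⟪u, ((z : E) + f z • e) - (y + f y • e)⟫_ℝ +
        C * ‖((z : E) + f z • e) - (y + f y • e)‖ ^ 2) +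
      t * (⟪u, ((w : E) + f w • e) - (y + f y • e)⟫_ℝ +
        C * ‖((w : E) + f w • e) - (y + f y • e)‖ ^ 2) ≤
    s * (M * f z + C * (1 + L) ^ 2 * ‖z‖ ^ 2) + t * (M * f w + C * (1 + L) ^ 2 * ‖w‖ ^ 2) -
      (M * f y + C * (1 + L) ^ 2 * ‖y‖ ^ 2) := by
  have hyV : y ∈ V := hy ▸ hf.1 hz hw hs ht hst
  have hconv : f y ≤ s * f z + t * f w := by
    have := hf.2 hz hw hs ht hst
    rwa [hy, smul_eq_mul, smul_eq_mul] at this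
  have hlip : ∀ x ∈ V, ‖((x : E) + f x • e) - (y + f y • e)‖ ^ 2 ≤ (1 + L) ^ 2 * ‖x - y‖ ^ 2 := by
    intro x hx
    have h1 : ((x : E) + f x • e) - (y + f y • e) = ((x - y : ↥((Submodule.span ℝ {e})ᗮ)) : E) +
        (f x - f y) • e := by
      rw [Submodule.coe_sub]; module
    have h2 : ‖(f x - f y) • e‖ ≤ L * ‖x - y‖ := by
      rw [norm_smul, he, mul_one, ← dist_eq_norm, ← dist_eq_norm]
      exact hL.dist_le_mul x hx y hyV
    rw [h1, ← mul_pow]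
    gcongr
    refine (norm_add_le _ _).trans ?_
    rw [add_mul, one_mul]
    exact add_le_add le_rfl h2
  have hin : s * ⟪u, ((z : E) + f z • e) - (y + f y • e)⟫_ℝ +
      t * ⟪u, ((w : E) + f w • e) - (y + f y • e)⟫_ℝ = ⟪u, e⟫_ℝ * (s * f z + t * f w - f y) := by
    have hyE : (y : E) = s • (z : E) + t • (w : E) := by rw [← hy]; rfl
    have : s • (((z : E) + f z • e) - (y + f y • e)) + t • (((w : E) + f w • e) - (y + f y • e)) =
        (s * f z + t * f w - f y) • e := by
      obtain rfl : t = 1 - s := by linarith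
      rw [hyE]; module
    rw [← real_inner_smul_right, ← real_inner_smul_right, ← inner_add_right, this,
      real_inner_smul_right, mul_comm]
  have hue : ⟪u, e⟫_ℝ ≤ M := by
    refine (real_inner_le_norm u e).trans ?_
    rwa [he, mul_one]
  have h1 : ⟪u, e⟫_ℝ * (s * f z + t * f w - f y) ≤ M * (s * f z + t * f w - f y) :=
    mul_le_mul_of_nonneg_right hue (by linarith)
  have h2 := combo_norm_sub_sq z w hst
  rw [hy] at h2
  have h3 : s * (C * ‖((z : E) + f z • e) - (y + f y • e)‖ ^ 2) ≤
      s * (C * ((1 + L) ^ 2 * ‖z - y‖ ^ 2)) := by gcongr; exact hlip z hz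
  have h4 : t * (C * ‖((w : E) + f w • e) - (y + f y • e)‖ ^ 2) ≤
      t * (C * ((1 + L) ^ 2 * ‖w - y‖ ^ 2)) := by gcongr; exact hlip w hw
  have h5 : s * (C * ((1 + L) ^ 2 * ‖z - y‖ ^ 2)) + t * (C * ((1 + L) ^ 2 * ‖w - y‖ ^ 2)) =
      C * (1 + L) ^ 2 * (s * ‖z‖ ^ 2 + t * ‖w‖ ^ 2 - ‖y‖ ^ 2) := by rw [← h2]; ring
  linarith

theorem chart_dominating_convexOn {F : Type*} [NormedAddCommGroup F] [InnerProductSpace ℝ F]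
    {V : Set F} {f : F → ℝ} (hf : ConvexOn ℝ V f) {M C : ℝ} (hM : 0 ≤ M) (hC : 0 ≤ C) :
    ConvexOn ℝ V fun x => M * f x + C * ‖x‖ ^ 2 :=
  (hf.smul hM).add (((convexOn_norm hf.1).pow (fun _ _ => norm_nonneg _) 2).smul hC)

theorem IsStandardChart.mem {X : Set E} {e : E} {V : Set ↥((Submodule.span ℝ {e})ᗮ)}
    {f : ↥((Submodule.span ℝ {e})ᗮ) → ℝ} (h : IsStandardChart X e V f)
    {x : ↥((Submodule.span ℝ {e})ᗮ)} (hx : x ∈ V) : (x : E) + f x • e ∈ X := by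
  obtain ⟨-, -, -, -, -, O, -, hO⟩ := h
  exact (hO ▸ mem_image_of_mem _ hx : _ ∈ X ∩ O).1

theorem isDCOn_of_subsingleton {F : Type*} [NormedAddCommGroup F] [NormedSpace ℝ F]
    [Subsingleton F] {W : Set F} (hW : Convex ℝ W) (φ : F → ℝ) : IsDCOn W φ :=
  ⟨fun _ => φ 0, fun _ => 0, convexOn_const _ hW, convexOn_const _ hW, continuousOn_const,
    continuousOn_const, fun x _ => by rw [Subsingleton.elim x 0, sub_zero]⟩

end Charts

/-- Let `X ⊂ ℝ^{n+1}` be a convex surface with `(e₁,V₁)`- and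
`(e₂,V₂)`-standard charts with associated convex functions `f₁, f₂`. Then the squared
intrinsic distance in these charts,
`(x₁,x₂) ↦ dist_X(x₁+f₁(x₁)e₁, x₂+f₂(x₂)e₂)²`, is DC on `V₁ × V₂`. -/
theorem squared_intrinsicDist_isDC (n : ℕ)
    (X : Set (EuclideanSpace ℝ (Fin (n + 1)))) (hX : IsConvexSurface X)
    (e₁ e₂ : EuclideanSpace ℝ (Fin (n + 1)))
    (V₁ : Set ↥((Submodule.span ℝ {e₁})ᗮ)) (f₁ : ↥((Submodule.span ℝ {e₁})ᗮ) → ℝ)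
    (V₂ : Set ↥((Submodule.span ℝ {e₂})ᗮ)) (f₂ : ↥((Submodule.span ℝ {e₂})ᗮ) → ℝ)
    (hchart₁ : IsStandardChart X e₁ V₁ f₁) (hchart₂ : IsStandardChart X e₂ V₂ f₂) :
    IsDCOn (V₁ ×ˢ V₂)
      (fun p : ↥((Submodule.span ℝ {e₁})ᗮ) × ↥((Submodule.span ℝ {e₂})ᗮ) =>
        intrinsicDist X ((p.1 : EuclideanSpace ℝ (Fin (n + 1))) + f₁ p.1 • e₁)
          ((p.2 : EuclideanSpace ℝ (Fin (n + 1))) + f₂ p.2 • e₂) ^ 2) := by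
  obtain ⟨K, hK, rfl⟩ := hX
  have hm₁ := fun x hx => hchart₁.mem (x := x) hx
  have hm₂ := fun x hx => hchart₂.mem (x := x) hx
  obtain ⟨he₁, hV₁, hVc₁, hf₁, ⟨L₁, hL₁⟩, -⟩ := hchart₁
  obtain ⟨he₂, hV₂, hVc₂, hf₂, ⟨L₂, hL₂⟩, -⟩ := hchart₂
  have hWc : Convex ℝ (V₁ ×ˢ V₂) := hVc₁.prod hVc₂
  have hWo : IsOpen (V₁ ×ˢ V₂) := hV₁.prod hV₂
  rcases Nat.eq_zero_or_pos n with rfl | hn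
  · have hsub : ∀ e : EuclideanSpace ℝ (Fin (0 + 1)), ‖e‖ = 1 →
        Subsingleton ↥((Submodule.span ℝ {e})ᗮ) := by
      intro e he
      have : Fact (Module.finrank ℝ (EuclideanSpace ℝ (Fin (0 + 1))) = 0 + 1) :=
        ⟨finrank_euclideanSpace_fin⟩
      exact Module.finrank_zero_iff.1
        (Submodule.finrank_orthogonal_span_singleton (n := 0) (norm_ne_zero_iff.1 (by rw [he]; norm_num)))
    have := hsub e₁ he₁
    have := hsub e₂ he₂
    exact isDCOn_of_subsingleton hWc _
  obtain ⟨M, C, hM, hC, h⟩ := hK.exists_upper_support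
    (by rw [finrank_euclideanSpace_fin]; omega)
  obtain ⟨g, hg⟩ : ∃ g : ↥((Submodule.span ℝ {e₁})ᗮ) × ↥((Submodule.span ℝ {e₂})ᗮ) → ℝ,
      ∀ p, g p = (M * f₁ p.1 + C * (1 + L₁) ^ 2 * ‖p.1‖ ^ 2) +
        (M * f₂ p.2 + C * (1 + L₂) ^ 2 * ‖p.2‖ ^ 2) := ⟨_, fun _ => rfl⟩
  obtain ⟨φ, hφ⟩ : ∃ φ : ↥((Submodule.span ℝ {e₁})ᗮ) × ↥((Submodule.span ℝ {e₂})ᗮ) → ℝ,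
      ∀ p, φ p = intrinsicDist (frontier K)
        ((p.1 : EuclideanSpace ℝ (Fin (n + 1))) + f₁ p.1 • e₁)
        ((p.2 : EuclideanSpace ℝ (Fin (n + 1))) + f₂ p.2 • e₂) ^ 2 := ⟨_, fun _ => rfl⟩
  have hgconv : ConvexOn ℝ (V₁ ×ˢ V₂) g := by
    have h₁ := (chart_dominating_convexOn hf₁ hM (by positivity : 0 ≤ C * (1 + (L₁ : ℝ)) ^ 2))
    have h₂ := (chart_dominating_convexOn hf₂ hM (by positivity : 0 ≤ C * (1 + (L₂ : ℝ)) ^ 2))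
    have h₁' := (h₁.comp_linearMap (LinearMap.fst ℝ _ ↥((Submodule.span ℝ {e₂})ᗮ))).subset
      (fun p hp => hp.1) hWc
    have h₂' := (h₂.comp_linearMap (LinearMap.snd ℝ ↥((Submodule.span ℝ {e₁})ᗮ) _)).subset
      (fun p hp => hp.2) hWc
    rw [funext hg]
    exact h₁'.add h₂'
  have hhconv : ConvexOn ℝ (V₁ ×ˢ V₂) fun p => g p - φ p := by
    refine ⟨hWc, fun z hz w hw s t hs ht hst => ?_⟩
    have hyW := hWc hz hw hs ht hst
    obtain ⟨y, hy⟩ : ∃ y, s • z + t • w = y := ⟨_, rfl⟩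
    rw [hy] at hyW ⊢
    have hy₁ : s • z.1 + t • w.1 = y.1 := by rw [← hy]; rfl
    have hy₂ : s • z.2 + t • w.2 = y.2 := by rw [← hy]; rfl
    rw [smul_eq_mul, smul_eq_mul]
    refine le_of_forall_pos_le_add fun δ hδ => ?_
    obtain ⟨u₁, u₂, hu₁, hu₂, hu⟩ := h _ (hm₁ _ hyW.1) _ (hm₂ _ hyW.2) δ hδ
    have hz' := mul_le_mul_of_nonneg_left (hu _ (hm₁ _ hz.1) _ (hm₂ _ hz.2)) hs
    have hw' := mul_le_mul_of_nonneg_left (hu _ (hm₁ _ hw.1) _ (hm₂ _ hw.2)) ht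
    rw [← hφ, ← hφ] at hz' hw'
    have c₁ := chart_combo_le he₁ hf₁ hL₁ hu₁ hC hz.1 hw.1 hs ht hst hy₁
    have c₂ := chart_combo_le he₂ hf₂ hL₂ hu₂ hC hz.2 hw.2 hs ht hst hy₂
    simp only [hg]
    obtain rfl : t = 1 - s := by linarith
    linarith
  refine ⟨g, fun p => g p - φ p, hgconv, hhconv, hgconv.continuousOn hWo, hhconv.continuousOn hWo,
    fun p _ => ?_⟩
  rw [sub_sub_cancel, hφ]
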